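/- Let D be a totally definite quaternion algebra over a totally real number field F, and O an O_F-order in D. Then h(F) divides 2·h(O). -/

import Mathlib

/-!
STATEMENT 13: Let `D = ℍ[F,c₁,c₂]` be a totally definite quaternion algebra over a totally
real number field `F`, and `O` an `O_F`-order in `D`.  Then `h(F)` divides `2·h(O)`,
where `h(F)` is the class number of `F` and `h(O) = |Cl(O)|` is the number of classes of
locally principal right fractional `O`-ideals.
-/

noncomputable section
set_option synthInstance.maxHeartbeats 1000000
set_option maxHeartbeats 1000000

/-- `F` is totally real: every complex embedding of `F` is real. -/
def TotReal (F : Type*) [Field F] [NumberField F] : Prop :=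
  ∀ φ : F →+* ℂ, NumberField.ComplexEmbedding.IsReal φ

section PicardConstruction

open scoped Pointwise

variable {L : Type*} [CommRing L]

instance unitsCommGroup (A : Subalgebra ℤ L) : CommGroup (Submodule ↥A L)ˣ :=
  Units.instCommGroupUnits (α := Submodule ↥A L)

/-- The subgroup of principal invertible fractional ideals (those generated by a single
invertible element of `L`). -/
def principalSub (A : Subalgebra ℤ L) : Subgroup (Submodule ↥A L)ˣ where
  carrier := {u | ∃ x : L, IsUnit x ∧ (u : Submodule ↥A L) = Submodule.span ↥A {x}}
  one_mem' := ⟨1, isUnit_one, by simp [Submodule.one_eq_span]⟩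
  mul_mem' := by
    rintro u v ⟨x, hx, hux⟩ ⟨y, hy, hvy⟩
    exact ⟨x * y, hx.mul hy, by
      push_cast [hux, hvy]
      rw [Submodule.span_mul_span, Set.singleton_mul_singleton]⟩
  inv_mem' := by
    rintro u ⟨x, hx, hux⟩
    refine ⟨(hx.unit⁻¹ : Lˣ), Units.isUnit _, ?_⟩
    have h1 : (u : Submodule ↥A L) * Submodule.span ↥A {((hx.unit⁻¹ : Lˣ) : L)} = 1 := by
      rw [hux, Submodule.span_mul_span, Set.singleton_mul_singleton]
      simp [Submodule.one_eq_span]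
    calc ((u⁻¹ : (Submodule ↥A L)ˣ) : Submodule ↥A L)
        = (u⁻¹ : (Submodule ↥A L)ˣ) * ((u : Submodule ↥A L) *
            Submodule.span ↥A {((hx.unit⁻¹ : Lˣ) : L)}) := by
            rw [h1]; exact (mul_one ((u⁻¹ : (Submodule ↥A L)ˣ) : Submodule ↥A L)).symm
      _ = Submodule.span ↥A {((hx.unit⁻¹ : Lˣ) : L)} := by
            rw [← mul_assoc, ← Units.val_mul, inv_mul_cancel, Units.val_one]
            exact one_mul (Submodule.span ↥A {((hx.unit⁻¹ : Lˣ) : L)})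

/-- The Picard group of a `ℤ`-order `A` realized inside `L`: invertible (equivalently,
locally principal) fractional `A`-ideals modulo principal fractional `A`-ideals. -/
def Picard (A : Subalgebra ℤ L) : Type _ := (Submodule ↥A L)ˣ ⧸ principalSub A

noncomputable instance (A : Subalgebra ℤ L) : CommGroup (Picard A) :=
  QuotientGroup.Quotient.commGroup (principalSub A)

/-- The ideal class of an invertible fractional ideal in the Picard group. -/
def picCls (A : Subalgebra ℤ L) (u : (Submodule ↥A L)ˣ) : Picard A := QuotientGroup.mk u

/-- The class number `h(A) = |Pic(A)|` of a `ℤ`-order `A` realized in `L`. -/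
noncomputable def hPic (A : Subalgebra ℤ L) : ℕ := Nat.card (Picard A)

end PicardConstruction
open scoped Quaternion Pointwise

/-- A `ℤ`-order in a `ℚ`-algebra `V`: a subring, finitely generated as a `ℤ`-module,
containing a `ℚ`-basis of `V` (i.e. spanning `V` over `ℚ`). -/
def IsZOrder {V : Type*} [Ring V] [Algebra ℚ V] (O : Subalgebra ℤ V) : Prop :=
  (Subalgebra.toSubmodule O).FG ∧ Submodule.span ℚ (O : Set V) = ⊤

variable {F : Type*} [Field F] [NumberField F] {c₁ c₂ : F}

/-- The reduced norm on the quaternion algebra `ℍ[F, c₁, c₂]`. -/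
def quatNrd (x : ℍ[F, c₁, c₂]) : F :=
  x.re * x.re - c₁ * x.imI * x.imI - c₂ * x.imJ * x.imJ + c₁ * c₂ * x.imK * x.imK

/-- `O` is a proper `A`-order in the quaternion algebra `D = ℍ[F,c₁,c₂]`:
a `ℤ`-order of full rank in `D` with `O ∩ F = A`. -/
def IsProperOrder (A : Subalgebra ℤ F) (O : Subalgebra ℤ ℍ[F, c₁, c₂]) : Prop :=
  IsZOrder O ∧ ∀ x : F, algebraMap F ℍ[F, c₁, c₂] x ∈ O ↔ x ∈ A

/-- `Ã = Nr_A(O)`: the suborder of `O_F` spanned over `A` by the reduced norms of the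
elements of `O` (equivalently, the subring generated by `A` and these reduced norms). -/
def normOrder (A : Subalgebra ℤ F) (O : Subalgebra ℤ ℍ[F, c₁, c₂]) : Subalgebra ℤ F :=
  Algebra.adjoin ℤ ((A : Set F) ∪ (quatNrd '' (O : Set ℍ[F, c₁, c₂])))

/-- The localization at a prime `p` of a subset of a `ℤ`-module. -/
def locAt {V : Type*} [AddCommGroup V] (p : ℕ) (S : Set V) : Set V :=
  {x | ∃ n : ℤ, ¬ (p : ℤ) ∣ n ∧ n • x ∈ S}

/-- `I` is a locally principal right fractional `O`-ideal in `D = ℍ[F,c₁,c₂]`: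
a full `ℤ`-lattice in `D`, stable under right multiplication by `O`, which at every
rational prime `p` is principal, generated by a unit `λ` of `D`. -/
def IsLocPrincRightIdeal (O : Subalgebra ℤ ℍ[F, c₁, c₂]) (I : Submodule ℤ ℍ[F, c₁, c₂]) :
    Prop :=
  I.FG ∧ Submodule.span ℚ (I : Set ℍ[F, c₁, c₂]) = ⊤ ∧
    (∀ x ∈ I, ∀ r ∈ O, x * r ∈ I) ∧
    ∀ p : ℕ, p.Prime → ∃ lam : ℍ[F, c₁, c₂]ˣ,
      locAt p (I : Set ℍ[F, c₁, c₂]) = locAt p ((fun y => (lam : ℍ[F, c₁, c₂]) * y) '' O)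

/-- Left multiplication `I ↦ λI` on right `O`-ideals. -/
def lmul (lam : ℍ[F, c₁, c₂]ˣ) (I : Submodule ℤ ℍ[F, c₁, c₂]) : Submodule ℤ ℍ[F, c₁, c₂] :=
  I.map (LinearMap.mulLeft ℤ (lam : ℍ[F, c₁, c₂]))

/-- The product ideal `a·I` of a fractional `A`-ideal `a ⊆ F` and a right ideal `I ⊆ D`. -/
def idMul (A : Subalgebra ℤ F) (a : Submodule ↥A F) (I : Submodule ℤ ℍ[F, c₁, c₂]) :
    Submodule ℤ ℍ[F, c₁, c₂] :=
  Submodule.span ℤ {z | ∃ f ∈ a, ∃ y ∈ I, z = algebraMap F ℍ[F, c₁, c₂] f * y}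

/-- The type of locally principal right `O`-ideals. -/
def LPIdeals (O : Subalgebra ℤ ℍ[F, c₁, c₂]) : Type _ :=
  {I : Submodule ℤ ℍ[F, c₁, c₂] // IsLocPrincRightIdeal O I}

/-- The right ideal class set `Cl(O)`:  locally principal right `O`-ideals modulo the
equivalence `I ∼ J ↔ I = λJ` for some `λ ∈ Dˣ`. -/
def ClO (O : Subalgebra ℤ ℍ[F, c₁, c₂]) : Type _ :=
  Quot (fun I J : LPIdeals O => ∃ lam : ℍ[F, c₁, c₂]ˣ, I.1 = lmul lam J.1)

/-- The class number `h(O) = |Cl(O)|`. -/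
noncomputable def hCl (O : Subalgebra ℤ ℍ[F, c₁, c₂]) : ℕ := Nat.card (ClO O)

/-- `D = ℍ[F,c₁,c₂]` is totally definite (`F` totally real):
`D ⊗_{F,σ} ℝ` is the Hamilton quaternion algebra for every real embedding `σ`,
i.e. `σ(c₁) < 0` and `σ(c₂) < 0` for every embedding `σ : F → ℝ`. -/
def TotallyDefinite (c₁ c₂ : F) : Prop := ∀ σ : F →+* ℝ, σ c₁ < 0 ∧ σ c₂ < 0

/-- The class of a locally principal right `O`-ideal in `Cl(O)`. -/
def clsO (O : Subalgebra ℤ ℍ[F, c₁, c₂]) (I : LPIdeals O) : ClO O := Quot.mk _ I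

/-- Every finite `2`-subgroup is the union of a cyclic subgroup `C` and at most one further coset
of `C`, whose elements invert `C` under conjugation. -/
def TwoSubgroupsDihedral (H : Type*) [Group H] : Prop :=
  ∀ Q : Subgroup H, Finite Q → IsPGroup 2 Q → ∃ r ∈ Q,
    (∀ s ∈ Q, s ∉ Subgroup.zpowers r → s * r * s⁻¹ = r⁻¹) ∧
    ∀ s ∈ Q, s ∉ Subgroup.zpowers r → ∀ t ∈ Q, t ∉ Subgroup.zpowers r →
      s * t ∈ Subgroup.zpowers r

theorem TwoSubgroupsDihedral.of_injective {M H : Type*} [Group M] [Group H]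
    (hH : TwoSubgroupsDihedral H) (f : M →* H) (hf : Function.Injective f) :
    TwoSubgroupsDihedral M := by
  intro Q hQ hQ2
  have hmem : ∀ r s : M, f s ∈ Subgroup.zpowers (f r) ↔ s ∈ Subgroup.zpowers r := by
    intro r s
    rw [Subgroup.mem_zpowers_iff, Subgroup.mem_zpowers_iff]
    constructor <;> rintro ⟨k, hk⟩ <;> refine ⟨k, ?_⟩
    · exact hf (by simpa using hk)
    · simp [← hk]
  have hfin : Finite (Q.map f) := Finite.of_surjective _ (f.subgroupMap_surjective Q)
  obtain ⟨r, hr, h1, h2⟩ := hH (Q.map f) hfin (hQ2.map f)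
  obtain ⟨r, hrQ, rfl⟩ := hr
  refine ⟨r, hrQ, fun s hs hsr => ?_, fun s hs hsr t ht htr => ?_⟩
  · have := h1 (f s) (Subgroup.mem_map_of_mem f hs) (by rwa [hmem])
    exact hf (by simpa using this)
  · have := h2 (f s) (Subgroup.mem_map_of_mem f hs) (by rwa [hmem])
      (f t) (Subgroup.mem_map_of_mem f ht) (by rwa [hmem])
    rwa [← map_mul, hmem] at this

section Dihedral

variable {M G : Type*} [Group M] [CommGroup G]

theorem zpow_eq_one_or_self {g : G} (hg : g ^ 2 = 1) (k : ℤ) :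
    (Even k ∧ g ^ k = 1) ∨ (Odd k ∧ g ^ k = g) := by
  have hg' : g ^ (2 : ℤ) = 1 := by exact_mod_cast hg
  rcases Int.even_or_odd' k with ⟨m, rfl | rfl⟩
  · left
    exact ⟨even_two_mul m, by rw [zpow_mul, hg', one_zpow]⟩
  · right
    exact ⟨odd_two_mul_add_one m, by rw [zpow_add, zpow_mul, hg', one_zpow]; simp⟩

theorem card_map_le_four_of_dihedral {r : M} (χ : M →* G) (hχ : ∀ x, χ x ^ 2 = 1)
    (h2 : ∀ s ∉ Subgroup.zpowers r, ∀ t ∉ Subgroup.zpowers r, s * t ∈ Subgroup.zpowers r) :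
    Nat.card χ.range ≤ 4 := by
  classical
  have hC : ∀ c ∈ Subgroup.zpowers r, χ c = 1 ∨ χ c = χ r := by
    rintro c ⟨k, rfl⟩
    rcases zpow_eq_one_or_self (hχ r) k with h | h <;> simp [h.2]
  obtain ⟨s, hs⟩ : ∃ s, ∀ x ∉ Subgroup.zpowers r, s * x ∈ Subgroup.zpowers r := by
    by_cases h : ∃ s, s ∉ Subgroup.zpowers r
    · obtain ⟨s, hs⟩ := h
      exact ⟨s, fun x hx => h2 s hs x hx⟩
    · push Not at h
      exact ⟨1, fun x hx => (hx (h x)).elim⟩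
  have hsub : (χ.range : Set G) ⊆ (({1, χ r, χ s, χ s * χ r} : Finset G) : Set G) := by
    rintro _ ⟨x, rfl⟩
    by_cases hx : x ∈ Subgroup.zpowers r
    · rcases hC x hx with h | h <;> simp [h]
    · have hxs : χ x = χ s * χ (s * x) := by
        rw [map_mul, ← mul_assoc, ← pow_two, hχ, one_mul]
      rcases hC _ (hs x hx) with h | h <;> rw [h] at hxs <;> simp [hxs]
  have := Set.ncard_le_ncard hsub (Finset.finite_toSet _)
  rw [Set.ncard_coe_finset] at this
  exact this.trans Finset.card_le_four

theorem mem_zpowers_zpow_of_odd [Finite M] (hM : IsPGroup 2 M) (r : M) {k : ℤ} (hk : Odd k) :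
    r ∈ Subgroup.zpowers (r ^ k) := by
  obtain ⟨n, hn⟩ := hM r
  have hco : IsCoprime k (2 ^ n : ℤ) :=
    IsCoprime.pow_right (Int.prime_two.coprime_iff_not_dvd.2 (by
      rwa [← even_iff_two_dvd, Int.not_even_iff_odd])).symm
  obtain ⟨a, b, hab⟩ := hco
  refine ⟨a, ?_⟩
  have h1 : r ^ (a * k + b * 2 ^ n) = r := by rw [hab, zpow_one]
  rw [zpow_add, mul_comm b, zpow_mul r (2 ^ n) b] at h1
  have h2 : r ^ (2 ^ n : ℤ) = 1 := by exact_mod_cast hn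
  rw [h2, one_zpow, mul_one] at h1
  simpa [← zpow_mul, mul_comm] using h1

theorem eq_top_of_dihedral [Finite M] (hM : IsPGroup 2 M) {r : M} (χ : M →* G)
    (hχ : ∀ x, χ x ^ 2 = 1)
    (h2 : ∀ s ∉ Subgroup.zpowers r, ∀ t ∉ Subgroup.zpowers r, s * t ∈ Subgroup.zpowers r)
    (T : Subgroup M) (hT : 2 < Nat.card (T.map χ)) : T = ⊤ := by
  classical
  have hpair : ∀ g : G, ¬ (∀ t ∈ T, χ t = 1 ∨ χ t = g) := by
    intro g hg
    have hsub : (T.map χ : Set G) ⊆ (({1, g} : Finset G) : Set G) := by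
      rintro _ ⟨t, ht, rfl⟩
      rcases hg t ht with h | h <;> simp [h]
    have h := Set.ncard_le_ncard hsub (Finset.finite_toSet _)
    rw [Set.ncard_coe_finset] at h
    have h' := h.trans Finset.card_le_two
    exact absurd hT (not_lt.2 h')
  obtain ⟨s, hsT, hs⟩ : ∃ s ∈ T, s ∉ Subgroup.zpowers r := by
    by_contra! h
    refine hpair (χ r) fun t ht => ?_
    obtain ⟨k, rfl⟩ := h t ht
    rcases zpow_eq_one_or_self (hχ r) k with h | h <;> simp [h.2]
  obtain ⟨c, hcT, hc, hc1⟩ : ∃ c ∈ T, c ∈ Subgroup.zpowers r ∧ χ c ≠ 1 := by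
    by_contra! h
    refine hpair (χ s) fun t ht => ?_
    by_cases htr : t ∈ Subgroup.zpowers r
    · exact Or.inl (h t ht htr)
    · right
      have := h (s * t) (T.mul_mem hsT ht) (h2 s hs t htr)
      rw [map_mul] at this
      calc χ t = χ s * (χ s * χ t) := by rw [← mul_assoc, ← pow_two, hχ, one_mul]
        _ = χ s := by rw [this, mul_one]
  obtain ⟨k, rfl⟩ := hc
  have hk : Odd k := by
    rcases zpow_eq_one_or_self (hχ r) k with h | h
    · exact absurd (by simpa using h.2) hc1
    · exact h.1
  have hr : r ∈ T := (Subgroup.zpowers_le.2 hcT) (mem_zpowers_zpow_of_odd hM r hk)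
  have hC : Subgroup.zpowers r ≤ T := Subgroup.zpowers_le.2 hr
  refine eq_top_iff.2 fun x _ => ?_
  by_cases hx : x ∈ Subgroup.zpowers r
  · exact hC hx
  · exact (T.mul_mem_cancel_left hsT).1 (hC (h2 s hs x hx))

theorem card_range_le_two_of_dihedral {r : M}
    (h1 : ∀ s ∉ Subgroup.zpowers r, s * r * s⁻¹ = r⁻¹)
    (h2 : ∀ s ∉ Subgroup.zpowers r, ∀ t ∉ Subgroup.zpowers r, s * t ∈ Subgroup.zpowers r)
    (N : Subgroup M) [N.Normal] (hN : N ≠ ⊤) (hN2 : ∀ x ∉ N, ∀ y ∉ N, x * y ∈ N)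
    (χ : N →* G) (hχ : ∀ x, χ x ^ 2 = 1)
    (hinv : ∀ (m : M) (n n' : N), (n' : M) = m * n * m⁻¹ → χ n' = χ n) :
    Nat.card χ.range ≤ 2 := by
  classical
  suffices h : ∃ g : G, ∀ x, χ x = 1 ∨ χ x = g by
    obtain ⟨g, hg⟩ := h
    have hsub : (χ.range : Set G) ⊆ (({1, g} : Finset G) : Set G) := by
      rintro _ ⟨t, rfl⟩
      rcases hg t with h | h <;> simp [h]
    have h := Set.ncard_le_ncard hsub (Finset.finite_toSet _)
    rw [Set.ncard_coe_finset] at h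
    exact h.trans Finset.card_le_two
  by_cases hr : r ∈ N
  · by_cases hNC : ∀ s ∈ N, s ∈ Subgroup.zpowers r
    · refine ⟨χ ⟨r, hr⟩, fun x => ?_⟩
      obtain ⟨k, hk⟩ := hNC x x.2
      have : x = ⟨r, hr⟩ ^ k := by ext; simp [← hk]
      rw [this, map_zpow]
      rcases zpow_eq_one_or_self (hχ ⟨r, hr⟩) k with h | h <;> simp [h.2]
    · push Not at hNC
      obtain ⟨s, hsN, hs⟩ := hNC
      refine (hN (eq_top_iff.2 fun x _ => ?_)).elim
      have hC : Subgroup.zpowers r ≤ N := Subgroup.zpowers_le.2 hr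
      by_cases hx : x ∈ Subgroup.zpowers r
      · exact hC hx
      · exact (N.mul_mem_cancel_left hsN).1 (hC (h2 s hs x hx))
  · have hr2 : r ^ 2 ∈ N := by rw [pow_two]; exact hN2 r hr r hr
    have hC : ∀ x : N, (x : M) ∈ Subgroup.zpowers r → ∃ k : ℤ, x = ⟨r ^ 2, hr2⟩ ^ k := by
      rintro ⟨x, hx⟩ ⟨k, rfl⟩
      rcases Int.even_or_odd' k with ⟨m, rfl | rfl⟩
      · exact ⟨m, by ext; simp [zpow_mul]⟩
      · exfalso
        have hx' : r ^ (2 * m + 1) ∈ N := hx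
        rw [zpow_add, zpow_mul, zpow_one] at hx'
        have h3 : (r ^ (2 : ℤ)) ^ m ∈ N := N.zpow_mem (by exact_mod_cast hr2) m
        exact hr ((N.mul_mem_cancel_left h3).1 hx')
    by_cases hNC : ∀ s ∈ N, s ∈ Subgroup.zpowers r
    · refine ⟨χ ⟨r ^ 2, hr2⟩, fun x => ?_⟩
      obtain ⟨k, hk⟩ := hC x (hNC x x.2)
      rw [hk, map_zpow]
      rcases zpow_eq_one_or_self (hχ ⟨r ^ 2, hr2⟩) k with h | h <;> simp [h.2]
    · push Not at hNC
      obtain ⟨s, hsN, hs⟩ := hNC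
      have hrs : r * s * r⁻¹ = r ^ 2 * s := by
        have h := h1 s hs
        have h' : s * r⁻¹ = r * s := by
          have : s * r⁻¹ * s⁻¹ = r := by
            have h3 := congrArg (·⁻¹) h
            simpa [mul_assoc] using h3
          exact mul_inv_eq_iff_eq_mul.1 this
        rw [mul_assoc, h', pow_two, mul_assoc]
      have hχ2 : χ ⟨r ^ 2, hr2⟩ = 1 := by
        have h := hinv r ⟨s, hsN⟩ (⟨r ^ 2, hr2⟩ * ⟨s, hsN⟩) (by simp [hrs])
        rw [map_mul] at h
        simpa using h
      have hCχ : ∀ x : N, (x : M) ∈ Subgroup.zpowers r → χ x = 1 := by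
        intro x hx
        obtain ⟨k, rfl⟩ := hC x hx
        simp [hχ2]
      refine ⟨χ ⟨s, hsN⟩, fun x => ?_⟩
      by_cases hx : (x : M) ∈ Subgroup.zpowers r
      · exact Or.inl (hCχ x hx)
      · right
        have := hCχ (⟨s, hsN⟩ * x) (h2 s hs x hx)
        rw [map_mul] at this
        calc χ x = χ ⟨s, hsN⟩ * (χ ⟨s, hsN⟩ * χ x) := by
              rw [← mul_assoc, ← pow_two, hχ, one_mul]
          _ = χ ⟨s, hsN⟩ := by rw [this, mul_one]

end Dihedral

section FiniteDihedral

variable {M G : Type*} [Group M] [Finite M] [CommGroup G]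

theorem exists_card_range_eq_two_pow (χ : M →* G) (hχ : ∀ x, χ x ^ 2 = 1) :
    ∃ n, Nat.card χ.range = 2 ^ n := by
  have hfin : Finite χ.range := Finite.of_surjective _ χ.rangeRestrict_surjective
  have : IsPGroup 2 χ.range := by
    rintro ⟨_, x, rfl⟩
    exact ⟨1, by ext; simpa using hχ x⟩
  exact IsPGroup.iff_card.1 this

theorem map_eq_range_of_odd_index (χ : M →* G) (hχ : ∀ x, χ x ^ 2 = 1) (Q : Subgroup M)
    (hQ : Odd Q.index) : Q.map χ = χ.range := by
  obtain ⟨n, hn⟩ := exists_card_range_eq_two_pow χ hχ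
  have h1 : (Q.map χ.rangeRestrict).index ∣ Q.index :=
    Q.index_map_dvd χ.rangeRestrict_surjective
  have h2 : (Q.map χ.rangeRestrict).index ∣ 2 ^ n := hn ▸ (Subgroup.index_dvd_card _)
  have h3 : (Q.map χ.rangeRestrict).index = 1 :=
    Nat.Coprime.eq_one_of_dvd (Nat.Coprime.coprime_dvd_left h1
      (Nat.Coprime.pow_right n (Nat.coprime_two_right.2 hQ))) h2
  rw [Subgroup.index_eq_one] at h3
  have h4 := congrArg (Subgroup.map χ.range.subtype) h3
  rw [Subgroup.map_map] at h4
  rw [← MonoidHom.range_eq_map, Subgroup.range_subtype] at h4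
  exact h4

theorem odd_index_sylow (Q : Sylow 2 M) : Odd (Q : Subgroup M).index := by
  rw [← Nat.not_even_iff_odd, even_iff_two_dvd]
  exact Q.not_dvd_index

variable (hM : TwoSubgroupsDihedral M)
include hM

theorem card_range_dvd_four (χ : M →* G) (hχ : ∀ x, χ x ^ 2 = 1) : Nat.card χ.range ∣ 4 := by
  obtain ⟨n, hn⟩ := exists_card_range_eq_two_pow χ hχ
  obtain ⟨Q⟩ : Nonempty (Sylow 2 M) := inferInstance
  obtain ⟨r, hr, -, h2⟩ := hM Q inferInstance Q.isPGroup'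
  have hmem : ∀ s : Q, s ∈ Subgroup.zpowers (⟨r, hr⟩ : Q) ↔ (s : M) ∈ Subgroup.zpowers r := by
    intro s
    simp only [Subgroup.mem_zpowers_iff, Subtype.ext_iff, SubgroupClass.coe_zpow]
  have h := card_map_le_four_of_dihedral (r := (⟨r, hr⟩ : Q)) (χ.comp (Q : Subgroup M).subtype)
    (fun x => hχ x) (fun s hs t ht => by
      rw [hmem] at hs ht ⊢
      exact h2 s s.2 hs t t.2 ht)
  rw [MonoidHom.range_comp, Subgroup.range_subtype,
    map_eq_range_of_odd_index χ hχ Q (odd_index_sylow Q), hn] at h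
  rw [hn]
  have hn2 : n ≤ 2 :=
    (Nat.pow_le_pow_iff_right (by norm_num)).1 (h.trans_eq (by norm_num : 4 = 2 ^ 2))
  exact (pow_dvd_pow 2 hn2).trans (by norm_num)

theorem odd_index_of_card_map_eq_four (χ : M →* G) (hχ : ∀ x, χ x ^ 2 = 1) (T : Subgroup M)
    (hT : Nat.card (T.map χ) = 4) : Odd T.index := by
  obtain ⟨P⟩ : Nonempty (Sylow 2 T) := inferInstance
  obtain ⟨Q, hQ⟩ := (P.isPGroup'.map T.subtype).exists_le_sylow
  obtain ⟨r, hr, -, h2⟩ := hM Q inferInstance Q.isPGroup'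
  have hmem : ∀ s : Q, s ∈ Subgroup.zpowers (⟨r, hr⟩ : Q) ↔ (s : M) ∈ Subgroup.zpowers r := by
    intro s
    simp only [Subgroup.mem_zpowers_iff, Subtype.ext_iff, SubgroupClass.coe_zpow]
  have hPT : ((P : Subgroup T).map T.subtype).map χ = T.map χ := by
    have := map_eq_range_of_odd_index (χ.comp T.subtype) (fun x => hχ x) P (odd_index_sylow P)
    rw [Subgroup.map_map, this, MonoidHom.range_comp, Subgroup.range_subtype]
  have htop := eq_top_of_dihedral (r := (⟨r, hr⟩ : Q)) Q.isPGroup'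
    (χ.comp (Q : Subgroup M).subtype) (fun x => hχ x) (fun s hs t ht => by
      rw [hmem] at hs ht ⊢
      exact h2 s s.2 hs t t.2 ht) (((P : Subgroup T).map T.subtype).subgroupOf Q) (by
      rw [← Subgroup.map_map, Subgroup.subgroupOf_map_subtype, inf_eq_left.2 hQ, hPT, hT]
      norm_num)
  rw [Subgroup.subgroupOf_eq_top] at htop
  have hQT : (Q : Subgroup M) ≤ T := htop.trans (Subgroup.map_subtype_le _)
  exact Odd.of_dvd_nat (odd_index_sylow Q) (Subgroup.index_dvd_of_le hQT)

theorem card_range_ne_four_of_index_eq_two (N : Subgroup M) (hN : N.index = 2)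
    (χ : N →* G) (hχ : ∀ x, χ x ^ 2 = 1)
    (hinv : ∀ (m : M) (n n' : N), (n' : M) = m * n * m⁻¹ → χ n' = χ n) :
    Nat.card χ.range ≠ 4 := by
  have hNn : N.Normal := Subgroup.normal_of_index_eq_two hN
  obtain ⟨Q⟩ : Nonempty (Sylow 2 M) := inferInstance
  have hQodd := odd_index_sylow Q
  have hrel : N.relIndex Q ∣ 2 := 
    (Subgroup.relIndex_dvd_index_of_normal N Q).trans hN.dvd
  have hmul : N.relIndex Q * (Q : Subgroup M).index = (Q : Subgroup M).relIndex N * 2 := by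
    have h1 := Subgroup.relIndex_mul_index (inf_le_right : N ⊓ (Q : Subgroup M) ≤ Q)
    have h2 := Subgroup.relIndex_mul_index (inf_le_left : N ⊓ (Q : Subgroup M) ≤ N)
    rw [Subgroup.inf_relIndex_right] at h1
    rw [Subgroup.inf_relIndex_left, hN] at h2
    rw [h1, h2]
  have hrel2 : N.relIndex Q = 2 := by
    rcases (Nat.dvd_prime Nat.prime_two).1 hrel with h | h
    · rw [h, one_mul] at hmul
      rw [hmul] at hQodd
      exact absurd hQodd (by simp)
    · exact h
  have hodd : Odd ((Q : Subgroup M).subgroupOf N).index := by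
    change Odd ((Q : Subgroup M).relIndex N)
    have : (Q : Subgroup M).relIndex N = (Q : Subgroup M).index := by rw [hrel2] at hmul; omega
    rwa [this]
  obtain ⟨r, hr, h1, h2⟩ := hM Q inferInstance Q.isPGroup'
  have hmem : ∀ s : Q, s ∈ Subgroup.zpowers (⟨r, hr⟩ : Q) ↔ (s : M) ∈ Subgroup.zpowers r := by
    intro s
    simp only [Subgroup.mem_zpowers_iff, Subtype.ext_iff, SubgroupClass.coe_zpow]
  have hNQ : (N.subgroupOf (Q : Subgroup M)).Normal := inferInstance
  let ι : N.subgroupOf Q →* N :=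
    { toFun := fun x => ⟨(x : Q), x.2⟩
      map_one' := rfl
      map_mul' := fun _ _ => rfl }
  have hι : ι.range = (Q : Subgroup M).subgroupOf N := by
    ext x
    constructor
    · rintro ⟨y, rfl⟩
      exact (y : Q).2
    · intro hx
      exact ⟨⟨⟨x, hx⟩, x.2⟩, rfl⟩
  have hle := card_range_le_two_of_dihedral (r := (⟨r, hr⟩ : Q))
    (fun s hs => by
      rw [hmem] at hs
      exact Subtype.ext (h1 s s.2 hs))
    (fun s hs t ht => by
      rw [hmem] at hs ht ⊢
      exact h2 s s.2 hs t t.2 ht) (N.subgroupOf Q)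
    (by
      intro h
      have : N.relIndex Q = 1 := by rw [Subgroup.relIndex, h, Subgroup.index_top]
      omega)
    (fun x hx y hy => by
      have := Subgroup.mul_mem_iff_of_index_two hrel2 (a := x) (b := y)
      rw [this]
      tauto)
    (χ.comp ι) (fun x => hχ _) (fun m n n' h => hinv m (ι n) (ι n') (by
      simpa [ι] using congrArg Subtype.val h))
  rw [MonoidHom.range_comp, hι, map_eq_range_of_odd_index χ hχ _ hodd] at hle
  omega

end FiniteDihedral

section Descent

variable {Γ G H : Type*} [Group Γ] [CommGroup G] [Group H] {π : Γ →* H} {χ : Γ →* G}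

theorem even_relIndex_of_card_map_eq_four {N T : Subgroup Γ} (hT : T ≤ N)
    (h4 : Nat.card (N.map χ) = 4)
    (hT4 : Nat.card (T.map χ) ≠ 4) : Even (T.relIndex N) := by
  have hle : T.map χ ≤ N.map χ := Subgroup.map_mono hT
  have h1 : Nat.card (T.map χ) * (T.map χ).relIndex (N.map χ) = 4 := by
    rw [← h4, ← Subgroup.relIndex_bot_left, ← Subgroup.relIndex_bot_left]
    exact Subgroup.relIndex_mul_relIndex _ _ _ bot_le hle
  have h2 : (T.map χ).relIndex (N.map χ) ∣ T.relIndex N := by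
    have hmap : (T.subgroupOf N).map (χ.subgroupMap N) = (T.map χ).subgroupOf (N.map χ) := by
      ext ⟨x, hx⟩
      rw [Subgroup.mem_subgroupOf]
      constructor
      · rintro ⟨t, ht, htx⟩
        exact ⟨t, ht, congrArg Subtype.val htx⟩
      · rintro ⟨t, ht, htx⟩
        exact ⟨⟨t, hT ht⟩, ht, Subtype.ext htx⟩
    rw [Subgroup.relIndex, Subgroup.relIndex, ← hmap]
    exact Subgroup.index_map_dvd _ (χ.subgroupMap_surjective N)
  have h3 : Nat.card (T.map χ) ∣ 4 := ⟨_, h1.symm⟩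
  have h5 : Nat.card (T.map χ) ≤ 4 := Nat.le_of_dvd (by norm_num) h3
  refine (even_iff_two_dvd.2 ?_ : Even ((T.map χ).relIndex (N.map χ))).trans_dvd h2
  generalize Nat.card (T.map χ) = a at *
  generalize (T.map χ).relIndex (N.map χ) = b at *
  interval_cases a <;> omega

/-- The image of `N` under `π` is finite, and `χ` induces on it a character with values of order
at most two. -/
structure QuadraticOn (π : Γ →* H) (χ : Γ →* G) (N : Subgroup Γ) : Prop where
  finite_map : Finite (N.map π)
  sq_eq_one : ∀ n ∈ N, χ n ^ 2 = 1
  eq_one : ∀ n ∈ N, π n = 1 → χ n = 1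

namespace QuadraticOn

variable {N : Subgroup Γ}

theorem mono (hN : QuadraticOn π χ N) {T : Subgroup Γ} (hT : T ≤ N) : QuadraticOn π χ T where
  finite_map := by
    have := hN.finite_map
    exact Finite.of_injective _ (Subgroup.inclusion_injective (Subgroup.map_mono (f := π) hT))
  sq_eq_one n hn := hN.sq_eq_one n (hT hn)
  eq_one n hn := hN.eq_one n (hT hn)

theorem exists_hom (hN : QuadraticOn π χ N) :
    ∃ ξ : N.map π →* G, ∀ n (hn : n ∈ N), ξ ⟨π n, Subgroup.mem_map_of_mem π hn⟩ = χ n := by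
  have hsurj := π.subgroupMap_surjective N
  have hker : (π.subgroupMap N).ker ≤ (χ.comp N.subtype).ker := by
    intro n hn
    rw [MonoidHom.mem_ker] at hn ⊢
    exact hN.eq_one n n.2 (congrArg Subtype.val hn)
  refine ⟨(π.subgroupMap N).liftOfSurjective hsurj ⟨χ.comp N.subtype, hker⟩, fun n hn => ?_⟩
  exact MonoidHom.liftOfRightInverse_comp_apply (π.subgroupMap N) _
    (Function.rightInverse_surjInv hsurj) ⟨χ.comp N.subtype, hker⟩ ⟨n, hn⟩

theorem range_eq_map {ξ : N.map π →* G}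
    (hξ : ∀ n (hn : n ∈ N), ξ ⟨π n, Subgroup.mem_map_of_mem π hn⟩ = χ n) :
    ξ.range = N.map χ := by
  ext g
  constructor
  · rintro ⟨⟨_, n, hn, rfl⟩, rfl⟩
    exact ⟨n, hn, (hξ n hn).symm⟩
  · rintro ⟨n, hn, rfl⟩
    exact ⟨_, hξ n hn⟩

theorem hom_sq (hN : QuadraticOn π χ N) {ξ : N.map π →* G}
    (hξ : ∀ n (hn : n ∈ N), ξ ⟨π n, Subgroup.mem_map_of_mem π hn⟩ = χ n) (x : N.map π) :
    ξ x ^ 2 = 1 := by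
  obtain ⟨_, n, hn, rfl⟩ := x
  rw [hξ n hn]
  exact hN.sq_eq_one n hn

variable (hH : TwoSubgroupsDihedral H) (hN : QuadraticOn π χ N)
include hH hN

theorem card_map_dvd_four : Nat.card (N.map χ) ∣ 4 := by
  obtain ⟨ξ, hξ⟩ := hN.exists_hom
  have := hN.finite_map
  rw [← range_eq_map hξ]
  exact card_range_dvd_four (hH.of_injective _ (N.map π).subtype_injective) ξ (hN.hom_sq hξ)

theorem odd_relIndex {T : Subgroup Γ} (hT : T ≤ N) (hker : ∀ n ∈ N, π n = 1 → n ∈ T)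
    (h4 : Nat.card (T.map χ) = 4) : Odd (T.relIndex N) := by
  obtain ⟨ξ, hξ⟩ := hN.exists_hom
  have := hN.finite_map
  have hmap : ((T.map π).subgroupOf (N.map π)).map ξ = T.map χ := by
    ext g
    constructor
    · rintro ⟨⟨x, hx⟩, ⟨t, ht, htx⟩, rfl⟩
      refine ⟨t, ht, ?_⟩
      rw [← hξ t (hT ht)]
      congr 1
      exact Subtype.ext htx
    · rintro ⟨t, ht, rfl⟩
      exact ⟨⟨π t, Subgroup.mem_map_of_mem π (hT ht)⟩, Subgroup.mem_map_of_mem π ht, hξ t (hT ht)⟩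
  have hodd := odd_index_of_card_map_eq_four (hH.of_injective _ (N.map π).subtype_injective) ξ
    (hN.hom_sq hξ) ((T.map π).subgroupOf (N.map π)) (by rw [hmap, h4])
  have hcomap : ((T.map π).subgroupOf (N.map π)).comap (π.subgroupMap N) = T.subgroupOf N := by
    ext ⟨n, hn⟩
    rw [Subgroup.mem_comap, Subgroup.mem_subgroupOf, Subgroup.mem_subgroupOf]
    constructor
    · rintro ⟨t, ht, htn⟩
      have htn' : π t = π n := htn
      have := hker (t⁻¹ * n) (N.mul_mem (N.inv_mem (hT ht)) hn) (by simp [htn'])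
      exact (T.mul_mem_cancel_left (T.inv_mem ht)).1 this
    · intro h
      exact Subgroup.mem_map_of_mem π h
  rw [Subgroup.relIndex, ← hcomap, Subgroup.index_comap_of_surjective _
    (π.subgroupMap_surjective N)]
  exact hodd

theorem card_map_eq_four {T : Subgroup Γ} (hT : T ≤ N) (h4 : Nat.card (T.map χ) = 4) :
    Nat.card (N.map χ) = 4 :=
  Nat.dvd_antisymm (hN.card_map_dvd_four hH)
    (h4 ▸ Subgroup.card_dvd_of_le (Subgroup.map_mono hT))

theorem card_map_ne_four_of_normalizes (h : Γ) (hnorm : ∀ n, n ∈ N ↔ h * n * h⁻¹ ∈ N)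
    (hsq : π h ^ 2 ∈ N.map π) (hh : π h ∉ N.map π) : Nat.card (N.map χ) ≠ 4 := by
  obtain ⟨ξ, hξ⟩ := hN.exists_hom
  have hfin := hN.finite_map
  have hconj : ∀ x, x ∈ N.map π ↔ π h * x * (π h)⁻¹ ∈ N.map π := by
    intro x
    constructor
    · rintro ⟨n, hn, rfl⟩
      exact ⟨h * n * h⁻¹, (hnorm n).1 hn, by simp⟩
    · rintro ⟨n, hn, hnx⟩
      refine ⟨h⁻¹ * n * h, (hnorm _).2 (by simpa [mul_assoc] using hn), ?_⟩
      simp [hnx, mul_assoc]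
  have hconj' : ∀ x, x ∈ N.map π ↔ (π h)⁻¹ * x * π h ∈ N.map π := by
    intro x
    rw [hconj ((π h)⁻¹ * x * π h)]
    simp [mul_assoc]
  let M : Subgroup H :=
    { carrier := {x | x ∈ N.map π ∨ (π h)⁻¹ * x ∈ N.map π}
      one_mem' := Or.inl (one_mem _)
      mul_mem' := by
        rintro x y (hx | hx) (hy | hy)
        · exact Or.inl (mul_mem hx hy)
        · refine Or.inr ?_
          have := mul_mem ((hconj' x).1 hx) hy
          simpa [mul_assoc] using this
        · refine Or.inr ?_
          have := mul_mem hx hy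
          simpa [mul_assoc] using this
        · refine Or.inl ?_
          have := mul_mem (mul_mem hsq ((hconj' _).1 hx)) hy
          simpa [mul_assoc, pow_two] using this
      inv_mem' := by
        rintro x (hx | hx)
        · exact Or.inl (inv_mem hx)
        · refine Or.inr ?_
          have := mul_mem (inv_mem hsq) ((hconj _).1 (inv_mem hx))
          simpa [mul_assoc, pow_two] using this }
  have hNM : N.map π ≤ M := fun x hx => Or.inl hx
  have hhM : π h ∈ M := Or.inr (by simp)
  have hMfin : Finite M := by
    have h1 : (M : Set H) ⊆ (N.map π : Set H) ∪ (fun x => π h * x) '' (N.map π : Set H) := by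
      rintro x (hx | hx)
      · exact Or.inl hx
      · exact Or.inr ⟨_, hx, by simp⟩
    have h2 : (N.map π : Set H).Finite := Set.toFinite _
    exact (h2.union (h2.image _)).subset h1
  have hindex : ((N.map π).subgroupOf M).index = 2 := by
    rw [Subgroup.index_eq_two_iff]
    refine ⟨⟨π h, hhM⟩, fun b => ?_⟩
    have hb : (b : H) ∈ N.map π ∨ (π h)⁻¹ * b ∈ N.map π := b.2
    rw [Subgroup.mem_subgroupOf, Subgroup.mem_subgroupOf]
    change Xor (((b : H) * π h) ∈ N.map π) _
    by_cases hbN : (b : H) ∈ N.map π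
    · refine Or.inr ⟨hbN, fun h' => hh ?_⟩
      exact (Subgroup.mul_mem_cancel_left _ hbN).1 h'
    · refine Or.inl ⟨?_, hbN⟩
      have := mul_mem hsq ((hconj' _).1 (hb.resolve_left hbN))
      simpa [pow_two, mul_assoc] using this
  let e : (N.map π).subgroupOf M ≃* N.map π := Subgroup.subgroupOfEquivOfLe hNM
  have hrange : (ξ.comp e.toMonoidHom).range = N.map χ := by
    rw [← range_eq_map hξ, MonoidHom.range_comp, MonoidHom.range_eq_top.2 e.surjective,
      ← MonoidHom.range_eq_map]
  rw [← hrange]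
  refine card_range_ne_four_of_index_eq_two (hH.of_injective _ M.subtype_injective) _ hindex _
    (fun x => hN.hom_sq hξ _) ?_
  rintro ⟨m, hm⟩ ⟨⟨n, hnM⟩, hn⟩ ⟨⟨n', hnM'⟩, hn'⟩ heq
  have heq' : n' = m * n * m⁻¹ := congrArg Subtype.val heq
  obtain ⟨ν, hν, rfl⟩ : n ∈ N.map π := hn
  obtain ⟨μ, hμ, rfl⟩ : ∃ μ, (∀ ν ∈ N, μ * ν * μ⁻¹ ∈ N) ∧ π μ = m := by
    rcases hm with ⟨μ, hμ, rfl⟩ | ⟨μ, hμ, hμm⟩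
    · exact ⟨μ, fun ν hν => mul_mem (mul_mem hμ hν) (inv_mem hμ), rfl⟩
    · refine ⟨h * μ, fun ν hν => ?_, by simp [hμm]⟩
      have := (hnorm _).1 (mul_mem (mul_mem hμ hν) (inv_mem hμ))
      simpa [mul_assoc] using this
  have hν' : ν ∈ N := hν
  have h1 : n' = π (μ * ν * μ⁻¹) := by simpa using heq'
  subst h1
  change ξ ⟨π (μ * ν * μ⁻¹), Subgroup.mem_map_of_mem π (hμ ν hν')⟩ =
    ξ ⟨π ν, Subgroup.mem_map_of_mem π hν'⟩
  rw [hξ _ (hμ ν hν'), hξ _ hν']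
  simp

end QuadraticOn

end Descent

section OrbitCount

open MulAction

variable {Γ G H : Type*} [Group Γ] [CommGroup G] [Group H] (π : Γ →* H) (χ : Γ →* G)

theorem map_stabilizer_smul {A : Type*} [MulAction Γ A] (g : Γ) (a : A) :
    (stabilizer Γ (g • a)).map χ = (stabilizer Γ a).map χ := by
  rw [stabilizer_smul_eq_stabilizer_map_conj, Subgroup.map_map]
  congr 1
  ext x
  simp

/-- The order of the image under `χ` of the stabilizers of the points of an orbit. -/
def orbitWeight (A : Type*) [MulAction Γ A] (o : orbitRel.Quotient Γ A) : ℕ :=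
  Quotient.liftOn' o (fun a => Nat.card ((stabilizer Γ a).map χ)) (by
    rintro _ b ⟨g, rfl⟩
    change Nat.card ((stabilizer Γ (g • b)).map χ) = _
    rw [map_stabilizer_smul])

theorem orbitWeight_mk {A : Type*} [MulAction Γ A] (a : A) :
    orbitWeight χ A (Quotient.mk'' a) = Nat.card ((stabilizer Γ a).map χ) := rfl

variable {A B : Type*} [MulAction Γ A] [MulAction Γ B]

/-- The map on orbit spaces induced by an equivariant map. -/
def orbitMap (f : A → B) (hf : ∀ (g : Γ) a, f (g • a) = g • f a) :
    orbitRel.Quotient Γ A → orbitRel.Quotient Γ B :=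
  Quotient.map' f (by
    rintro _ b ⟨g, rfl⟩
    exact ⟨g, (hf g b).symm⟩)

theorem stabilizer_le_of_equivariant {f : A → B} (hf : ∀ (g : Γ) a, f (g • a) = g • f a) (a : A) :
    stabilizer Γ a ≤ stabilizer Γ (f a) := by
  intro g hg
  rw [mem_stabilizer_iff] at hg ⊢
  rw [← hf, hg]

theorem card_fiber_orbit {f : A → B} (hf : ∀ (g : Γ) a, f (g • a) = g • f a) (a : A) :
    Nat.card {x : A // f x = f a ∧ (Quotient.mk'' x : orbitRel.Quotient Γ A) = Quotient.mk'' a} =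
      (stabilizer Γ a).relIndex (stabilizer Γ (f a)) := by
  have h1 : (stabilizer (stabilizer Γ (f a)) a) =
      (stabilizer Γ a).subgroupOf (stabilizer Γ (f a)) := by
    ext g
    rfl
  rw [Subgroup.relIndex, ← h1, index_stabilizer, ← Nat.card_coe_set_eq]
  refine Nat.card_congr (Equiv.subtypeEquivRight fun x => ?_)
  rw [Quotient.eq'', orbitRel_apply]
  constructor
  · rintro ⟨hx, g, rfl⟩
    exact ⟨⟨g, by rw [mem_stabilizer_iff, ← hf]; exact hx⟩, rfl⟩
  · rintro ⟨g, rfl⟩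
    refine ⟨?_, ⟨g, rfl⟩⟩
    have := g.2
    rw [mem_stabilizer_iff, ← hf] at this
    exact this

theorem finite_orbits_of_finite_fibers {f : A → B} (hf : ∀ (g : Γ) a, f (g • a) = g • f a)
    (hfin : ∀ b, Finite {a // f a = b}) [Finite (orbitRel.Quotient Γ B)] :
    Finite (orbitRel.Quotient Γ A) := by
  refine Finite.of_surjective
    (fun x : Σ o : orbitRel.Quotient Γ B, {a // f a = Quotient.out o} =>
      (Quotient.mk'' x.2.1 : orbitRel.Quotient Γ A)) fun o => ?_
  induction o using Quotient.inductionOn' with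
  | h a =>
    obtain ⟨g, hg⟩ : (Quotient.out (Quotient.mk'' (f a) : orbitRel.Quotient Γ B)) ∈
        orbit Γ (f a) := by
      rw [← orbitRel_apply, ← Quotient.eq'']
      exact Quotient.out_eq' _
    refine ⟨⟨Quotient.mk'' (f a), ⟨g • a, by rw [hf]; exact hg⟩⟩, ?_⟩
    rw [Quotient.eq'', orbitRel_apply]
    exact ⟨g, rfl⟩

section Parity

variable {π χ} (hH : TwoSubgroupsDihedral H)
  (hB : ∀ b : B, QuadraticOn π χ (stabilizer Γ b)) {f : A → B}
  (hf : ∀ (g : Γ) a, f (g • a) = g • f a)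
  (hker : ∀ k, π k = 1 → ∀ a, k • f a = f a → k • a = a)
  (hfin : ∀ b, Finite {a // f a = b})

include hH hB hf hker hfin

open Classical in
theorem card_fiber_eq_sum [Fintype (orbitRel.Quotient Γ A)] (b : B)
    (hb : orbitWeight χ B (Quotient.mk'' b) = 4) :
    (Nat.card {a // f a = b} : ZMod 2) = ∑ o : orbitRel.Quotient Γ A,
      if orbitWeight χ A o = 4 ∧ orbitMap f hf o = Quotient.mk'' b then 1 else 0 := by
  have := hfin b
  rw [Nat.card_congr (Equiv.sigmaFiberEquiv
    (fun a : {a // f a = b} => (Quotient.mk'' a.1 : orbitRel.Quotient Γ A))).symm, Nat.card_sigma,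
    Nat.cast_sum]
  refine Finset.sum_congr rfl fun o _ => ?_
  by_cases ho : ∃ a, f a = b ∧ (Quotient.mk'' a : orbitRel.Quotient Γ A) = o
  · obtain ⟨a, rfl, rfl⟩ := ho
    have h1 : Nat.card {x : {x // f x = f a} //
        (Quotient.mk'' x.1 : orbitRel.Quotient Γ A) = Quotient.mk'' a} =
        (stabilizer Γ a).relIndex (stabilizer Γ (f a)) := by
      rw [← card_fiber_orbit hf a]
      exact Nat.card_congr (Equiv.subtypeSubtypeEquivSubtypeInter (fun x => f x = f a)
        (fun x => (Quotient.mk'' x : orbitRel.Quotient Γ A) = Quotient.mk'' a))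
    rw [h1]
    have h2 : orbitMap f hf (Quotient.mk'' a) = Quotient.mk'' (f a) := rfl
    simp only [h2, and_true]
    have hle := stabilizer_le_of_equivariant hf a
    rw [orbitWeight_mk] at hb ⊢
    split_ifs with h
    · exact (ZMod.natCast_eq_one_iff_odd).2 ((hB (f a)).odd_relIndex hH hle
        (fun n hn hπ => hker n hπ a hn) h)
    · exact (ZMod.natCast_eq_zero_iff_even).2 (even_relIndex_of_card_map_eq_four hle hb h)
  · have h1 : IsEmpty {x : {x // f x = b} // (Quotient.mk'' x.1 : orbitRel.Quotient Γ A) = o} :=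
      ⟨fun x => ho ⟨x.1.1, x.1.2, x.2⟩⟩
    rw [Nat.card_of_isEmpty, Nat.cast_zero, if_neg]
    rintro ⟨-, h⟩
    induction o using Quotient.inductionOn' with
    | h a =>
      have h2 : (Quotient.mk'' (f a) : orbitRel.Quotient Γ B) = Quotient.mk'' b := h
      rw [Quotient.eq'', orbitRel_apply] at h2
      obtain ⟨g, hg⟩ := h2
      refine ho ⟨g⁻¹ • a, by rw [hf, ← hg]; simp, ?_⟩
      rw [Quotient.eq'', orbitRel_apply]
      exact ⟨g⁻¹, rfl⟩

open Classical in
theorem card_weight_four_eq_sum [Fintype (orbitRel.Quotient Γ A)] [Fintype (orbitRel.Quotient Γ B)]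
    (c : orbitRel.Quotient Γ B → ℕ) (hc : ∀ b, c (Quotient.mk'' b) = Nat.card {a // f a = b}) :
    (∑ o : orbitRel.Quotient Γ A, if orbitWeight χ A o = 4 then (1 : ZMod 2) else 0) =
      ∑ o : orbitRel.Quotient Γ B, if orbitWeight χ B o = 4 then (c o : ZMod 2) else 0 := by
  have h1 : ∀ o : orbitRel.Quotient Γ B,
      (if orbitWeight χ B o = 4 then (c o : ZMod 2) else 0) =
      ∑ o' : orbitRel.Quotient Γ A,
        if orbitWeight χ A o' = 4 ∧ orbitMap f hf o' = o then (1 : ZMod 2) else 0 := by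
    intro o
    split_ifs with h
    · induction o using Quotient.inductionOn' with
      | h b => rw [hc, card_fiber_eq_sum hH hB hf hker hfin b h]
    · symm
      refine Finset.sum_eq_zero fun o' _ => if_neg ?_
      rintro ⟨h4, rfl⟩
      refine h ?_
      induction o' using Quotient.inductionOn' with
      | h a => exact (hB (f a)).card_map_eq_four hH (stabilizer_le_of_equivariant hf a) h4
  rw [Finset.sum_congr rfl fun o _ => h1 o, Finset.sum_comm]
  refine Finset.sum_congr rfl fun o _ => ?_
  split_ifs with h <;> simp [h]

end Parity

open Classical in
theorem sum_weight_four_eq_zero (hH : TwoSubgroupsDihedral H)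
    (hB : ∀ b : B, QuadraticOn π χ (stabilizer Γ b)) [Fintype (orbitRel.Quotient Γ B)]
    (ψ : B → B) (hψ : ∀ (g : Γ) b, ψ (g • b) = g • ψ b) (p : Γ) (hp : π p = 1)
    (hψψ : ∀ b, ψ (ψ b) = p • b) (hne : ∀ k, π k = 1 → ∀ b, k • b ≠ ψ b)
    (c : orbitRel.Quotient Γ B → ℕ) (hc : ∀ b, c (Quotient.mk'' (ψ b)) = c (Quotient.mk'' b)) :
    (∑ o : orbitRel.Quotient Γ B, if orbitWeight χ B o = 4 then (c o : ZMod 2) else 0) = 0 := by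
  have hstab : ∀ b, stabilizer Γ (ψ b) = stabilizer Γ b := by
    intro b
    ext g
    rw [mem_stabilizer_iff, mem_stabilizer_iff, ← hψ]
    refine ⟨fun h => ?_, fun h => by rw [h]⟩
    have := congrArg ψ h
    rw [hψψ, hψψ] at this
    exact smul_left_cancel p this
  have hw : ∀ o, orbitWeight χ B (orbitMap ψ hψ o) = orbitWeight χ B o := by
    intro o
    induction o using Quotient.inductionOn' with
    | h b =>
      change Nat.card ((stabilizer Γ (ψ b)).map χ) = _
      rw [hstab, orbitWeight_mk]
  have hc' : ∀ o, c (orbitMap ψ hψ o) = c o := by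
    intro o
    induction o using Quotient.inductionOn' with
    | h b => exact hc b
  refine Finset.sum_involution (fun o _ => orbitMap ψ hψ o) ?_ ?_ ?_ ?_
  · intro o _
    rw [hw, hc', ← two_mul]
    have h2 : (2 : ZMod 2) = 0 := rfl
    rw [h2, zero_mul]
  · intro o _ ho heq
    have h4 : orbitWeight χ B o = 4 := by
      by_contra h
      exact ho (if_neg h)
    induction o using Quotient.inductionOn' with
    | h b =>
      have h1 : (Quotient.mk'' (ψ b) : orbitRel.Quotient Γ B) = Quotient.mk'' b := heq
      rw [Quotient.eq'', orbitRel_apply] at h1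
      obtain ⟨h, hh⟩ := h1
      change h • b = ψ b at hh
      refine (hB b).card_map_ne_four_of_normalizes hH h ?_ ?_ ?_ h4
      · intro n
        have h2 := stabilizer_smul_eq_stabilizer_map_conj h b
        rw [hh, hstab] at h2
        conv_rhs => rw [h2]
        rw [Subgroup.mem_map_equiv]
        simp [mul_assoc]
      · refine ⟨p⁻¹ * h ^ 2, ?_, by simp [hp]⟩
        change _ ∈ stabilizer Γ b
        rw [mem_stabilizer_iff, mul_smul, pow_two, mul_smul, hh, ← hψ, hh, hψψ, inv_smul_smul]
      · rintro ⟨n, hn, hnh⟩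
        refine hne (h * n⁻¹) (by simp [hnh]) b ?_
        rw [mul_smul, (inv_mem hn : n⁻¹ ∈ stabilizer Γ b), hh]
  · intro o _
    exact Finset.mem_univ _
  · intro o _
    induction o using Quotient.inductionOn' with
    | h b =>
      change (Quotient.mk'' (ψ (ψ b)) : orbitRel.Quotient Γ B) = Quotient.mk'' b
      rw [hψψ, Quotient.eq'', orbitRel_apply]
      exact ⟨p, rfl⟩

theorem card_fiber_mul_card_map (hχ : Function.Surjective χ)
    (q : orbitRel.Quotient χ.ker A → orbitRel.Quotient Γ A)
    (hq : ∀ a, q (Quotient.mk'' a) = Quotient.mk'' a) (a : A) :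
    Nat.card {x // q x = Quotient.mk'' a} * Nat.card ((stabilizer Γ a).map χ) = Nat.card G := by
  rw [Subgroup.card_eq_card_quotient_mul_card_subgroup ((stabilizer Γ a).map χ)]
  congr 1
  have hs := Function.rightInverse_surjInv hχ
  set s := Function.surjInv hχ
  have hqs : ∀ γ : Γ, q (Quotient.mk'' (γ • a)) = Quotient.mk'' a := by
    intro γ
    rw [hq, Quotient.eq'', orbitRel_apply]
    exact ⟨γ, rfl⟩
  have hsurj : Function.Surjective (fun g : G =>
      (⟨Quotient.mk'' (s g • a), hqs _⟩ : {x // q x = Quotient.mk'' a})) := by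
    rintro ⟨x, hx⟩
    induction x using Quotient.inductionOn' with
    | h b =>
      rw [hq, Quotient.eq'', orbitRel_apply] at hx
      obtain ⟨γ, rfl⟩ := hx
      refine ⟨χ γ, Subtype.ext ?_⟩
      change (Quotient.mk'' _ : orbitRel.Quotient χ.ker A) = Quotient.mk'' _
      rw [Quotient.eq'', orbitRel_apply]
      refine ⟨⟨s (χ γ) * γ⁻¹, by rw [MonoidHom.mem_ker, map_mul, hs]; simp⟩, ?_⟩
      change (s (χ γ) * γ⁻¹) • γ • a = _
      rw [mul_smul, inv_smul_smul]
  refine (Nat.card_congr ((Quotient.congrRight fun g g' => ?_).trans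
    (Setoid.quotientKerEquivOfSurjective _ hsurj))).symm
  rw [QuotientGroup.leftRel_apply]
  change _ ↔ (⟨Quotient.mk'' (s g • a), hqs _⟩ : {x // q x = Quotient.mk'' a}) =
    ⟨Quotient.mk'' (s g' • a), hqs _⟩
  rw [Subtype.mk.injEq, Quotient.eq'', orbitRel_apply]
  constructor
  · rintro ⟨n, hn, hng⟩
    have hn' : n • a = a := hn
    refine ⟨⟨s g * n * (s g')⁻¹, by simp [MonoidHom.mem_ker, hs g, hs g', hng]⟩, ?_⟩
    change (s g * n * (s g')⁻¹) • s g' • a = _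
    rw [mul_smul, inv_smul_smul, mul_smul, hn']
  · rintro ⟨⟨k, hk⟩, hkg⟩
    have hkg' : k • s g' • a = s g • a := hkg
    refine ⟨(s g)⁻¹ * k * s g', ?_, ?_⟩
    · change _ ∈ stabilizer Γ a
      rw [mem_stabilizer_iff, mul_smul, mul_smul, hkg', inv_smul_smul]
    · rw [MonoidHom.mem_ker] at hk
      simp [hs g, hs g', hk]

open Classical in
theorem card_dvd_two_mul_of_sum_weight_eq_zero (hχ : Function.Surjective χ)
    (h4 : ∀ a : A, Nat.card ((stabilizer Γ a).map χ) ∣ 4) [Finite (orbitRel.Quotient χ.ker A)]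
    [Fintype (orbitRel.Quotient Γ A)]
    (h0 : (∑ o : orbitRel.Quotient Γ A, if orbitWeight χ A o = 4 then (1 : ZMod 2) else 0) = 0) :
    Nat.card G ∣ 2 * Nat.card (orbitRel.Quotient χ.ker A) := by
  let q : orbitRel.Quotient χ.ker A → orbitRel.Quotient Γ A := Quotient.map' id (by
    rintro _ b ⟨g, rfl⟩
    exact ⟨g, rfl⟩)
  have hq : ∀ a, q (Quotient.mk'' a) = Quotient.mk'' a := fun a => rfl
  have hw : ∀ o, orbitWeight χ A o ∣ 4 := by
    intro o
    induction o using Quotient.inductionOn' with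
    | h a => exact h4 a
  have hfib : ∀ o, 4 * Nat.card {x // q x = o} = Nat.card G * (4 / orbitWeight χ A o) := by
    intro o
    have h1 : Nat.card {x // q x = o} * orbitWeight χ A o = Nat.card G := by
      induction o using Quotient.inductionOn' with
      | h a => exact card_fiber_mul_card_map χ hχ q hq a
    rw [← h1, mul_assoc, Nat.mul_div_cancel' (hw o), mul_comm]
  have heven : Even (∑ o, 4 / orbitWeight χ A o) := by
    rw [← ZMod.natCast_eq_zero_iff_even, Nat.cast_sum, ← h0]
    refine Finset.sum_congr rfl fun o _ => ?_
    have h1 := hw o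
    have h2 : orbitWeight χ A o ≤ 4 := Nat.le_of_dvd (by norm_num) h1
    generalize orbitWeight χ A o = w at *
    interval_cases w <;> first | omega | (revert h1; decide)
  obtain ⟨m, hm⟩ := heven
  have hcard : 4 * Nat.card (orbitRel.Quotient χ.ker A) = Nat.card G * (m + m) := by
    rw [← hm, Finset.mul_sum, ← Finset.sum_congr rfl fun o _ => hfib o, ← Finset.mul_sum,
      ← Nat.card_sigma, Nat.card_congr (Equiv.sigmaFiberEquiv q)]
  exact ⟨m, by linarith⟩

theorem card_fiber_smul {f : A → B} (hf : ∀ (g : Γ) a, f (g • a) = g • f a) (g : Γ) (b : B) :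
    Nat.card {a // f a = g • b} = Nat.card {a // f a = b} := by
  refine (Nat.card_congr ((MulAction.toPerm g : Equiv.Perm A).subtypeEquiv fun a => ?_)).symm
  rw [MulAction.toPerm_apply, hf, smul_left_cancel_iff]

theorem card_dvd_two_mul_card_orbits (hH : TwoSubgroupsDihedral H) (hχ : Function.Surjective χ)
    {W E E' : Type*} [MulAction Γ W] [MulAction Γ E] [MulAction Γ E']
    (hW : ∀ w : W, QuadraticOn π χ (stabilizer Γ w))
    (hE' : ∀ e : E', QuadraticOn π χ (stabilizer Γ e))
    (hkE : ∀ k, π k = 1 → ∀ w : W, k • w = w → ∀ e : E, k • e = e)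
    (hkE' : ∀ k, π k = 1 → ∀ e' : E', k • e' = e' → ∀ e : E, k • e = e)
    (f₁ : E → W) (hf₁ : ∀ (g : Γ) e, f₁ (g • e) = g • f₁ e)
    (hodd : ∀ w, Odd (Nat.card {e // f₁ e = w}))
    (f₂ : E → E') (hf₂ : ∀ (g : Γ) e, f₂ (g • e) = g • f₂ e)
    (hsurj : Function.Surjective f₂) (hfin : ∀ e', Finite {e // f₂ e = e'})
    (ψ : E' → E') (hψ : ∀ (g : Γ) b, ψ (g • b) = g • ψ b) (p : Γ) (hp : π p = 1)
    (hψψ : ∀ b, ψ (ψ b) = p • b) (hne : ∀ k, π k = 1 → ∀ b, k • b ≠ ψ b)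
    (hcard : ∀ b, Nat.card {e // f₂ e = ψ b} = Nat.card {e // f₂ e = b}) :
    Nat.card G ∣ 2 * Nat.card (orbitRel.Quotient χ.ker W) := by
  classical
  rcases finite_or_infinite (orbitRel.Quotient χ.ker W) with hX | hX
  swap
  · simp
  have hΩ : Finite (orbitRel.Quotient Γ W) := by
    refine Finite.of_surjective (Quotient.map' id (by
      rintro _ b ⟨g, rfl⟩
      exact ⟨g, rfl⟩) : orbitRel.Quotient χ.ker W → orbitRel.Quotient Γ W) fun o => ?_
    induction o using Quotient.inductionOn' with
    | h a => exact ⟨Quotient.mk'' a, rfl⟩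
  have hfin₁ : ∀ w, Finite {e // f₁ e = w} := by
    intro w
    by_contra h
    have := not_finite_iff_infinite.1 h
    have := hodd w
    rw [Nat.card_eq_zero_of_infinite] at this
    exact absurd this (by decide)
  have hΩE : Finite (orbitRel.Quotient Γ E) := finite_orbits_of_finite_fibers hf₁ hfin₁
  have hΩE' : Finite (orbitRel.Quotient Γ E') := by
    refine Finite.of_surjective (orbitMap f₂ hf₂) fun o => ?_
    induction o using Quotient.inductionOn' with
    | h b =>
      obtain ⟨e, rfl⟩ := hsurj b
      exact ⟨Quotient.mk'' e, rfl⟩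
  have := Fintype.ofFinite (orbitRel.Quotient Γ W)
  have := Fintype.ofFinite (orbitRel.Quotient Γ E)
  have := Fintype.ofFinite (orbitRel.Quotient Γ E')
  let c : orbitRel.Quotient Γ E' → ℕ := fun o =>
    Quotient.liftOn' o (fun b => Nat.card {e // f₂ e = b}) (by
      rintro _ b ⟨g, rfl⟩
      exact card_fiber_smul hf₂ g b)
  let c₁ : orbitRel.Quotient Γ W → ℕ := fun o =>
    Quotient.liftOn' o (fun b => Nat.card {e // f₁ e = b}) (by
      rintro _ b ⟨g, rfl⟩
      exact card_fiber_smul hf₁ g b)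
  have hc₁ : ∀ o, (c₁ o : ZMod 2) = 1 := by
    intro o
    induction o using Quotient.inductionOn' with
    | h w => exact ZMod.natCast_eq_one_iff_odd.2 (hodd w)
  refine card_dvd_two_mul_of_sum_weight_eq_zero χ hχ (fun w => (hW w).card_map_dvd_four hH) ?_
  have h1 := card_weight_four_eq_sum hH hW hf₁ (fun k hk e h => hkE k hk _ h e) hfin₁ c₁
    fun _ => rfl
  have h2 := card_weight_four_eq_sum hH hE' hf₂ (fun k hk e h => hkE' k hk _ h e) hfin c
    fun _ => rfl
  have h3 := sum_weight_four_eq_zero π χ hH hE' ψ hψ p hp hψψ hne c fun b => hcard b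
  rw [h2, h3] at h1
  refine Eq.trans (Finset.sum_congr rfl fun o _ => ?_) h1.symm
  rw [hc₁]

end OrbitCount

section QuaternionBasics

namespace QuatAlg

/-- The reduced norm is anisotropic. -/
def Anisotropic (c₁ c₂ : F) : Prop := ∀ x : ℍ[F, c₁, c₂], quatNrd x = 0 → x = 0

/-- The reduced trace. -/
def trd (x : ℍ[F, c₁, c₂]) : F := x.re + x.re


section Algebraic

omit [NumberField F]

theorem algebraMap_mul (f : F) (x : ℍ[F, c₁, c₂]) :
    algebraMap F ℍ[F, c₁, c₂] f * x = f • x := (Algebra.smul_def f x).symm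

theorem mul_algebraMap (f : F) (x : ℍ[F, c₁, c₂]) :
    x * algebraMap F ℍ[F, c₁, c₂] f = f • x := by
  rw [← Algebra.commutes, algebraMap_mul]

theorem nrd_mul (x y : ℍ[F, c₁, c₂]) : quatNrd (x * y) = quatNrd x * quatNrd y := by
  simp [quatNrd]; ring

theorem nrd_algebraMap (f : F) : quatNrd (algebraMap F ℍ[F, c₁, c₂] f) = f ^ 2 := by
  simp [quatNrd]; ring

theorem nrd_smul (f : F) (x : ℍ[F, c₁, c₂]) : quatNrd (f • x) = f ^ 2 * quatNrd x := by
  rw [← algebraMap_mul, nrd_mul, nrd_algebraMap]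

theorem nrd_one : quatNrd (1 : ℍ[F, c₁, c₂]) = 1 := by simp [quatNrd]

theorem nrd_zero : quatNrd (0 : ℍ[F, c₁, c₂]) = 0 := by simp [quatNrd]

theorem nrd_star (x : ℍ[F, c₁, c₂]) : quatNrd (star x) = quatNrd x := by
  simp [quatNrd]

theorem star_algebraMap (f : F) :
    star (algebraMap F ℍ[F, c₁, c₂] f) = algebraMap F ℍ[F, c₁, c₂] f := by
  ext <;> simp

theorem star_smul (f : F) (x : ℍ[F, c₁, c₂]) : star (f • x) = f • star x := by
  ext <;> simp

theorem mul_star (x : ℍ[F, c₁, c₂]) : x * star x = algebraMap F _ (quatNrd x) := by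
  ext <;> simp [quatNrd] <;> ring

theorem star_mul (x : ℍ[F, c₁, c₂]) : star x * x = algebraMap F _ (quatNrd x) := by
  ext <;> simp [quatNrd] <;> ring

theorem add_star (x : ℍ[F, c₁, c₂]) : x + star x = algebraMap F _ (trd x) := by
  ext <;> simp [trd]

theorem star_eq (x : ℍ[F, c₁, c₂]) : star x = algebraMap F _ (trd x) - x := by
  rw [← add_star]; abel

theorem nrd_add (x y : ℍ[F, c₁, c₂]) :
    quatNrd (x + y) = quatNrd x + trd (x * star y) + quatNrd y := by
  simp [quatNrd, trd]; ring

theorem nrd_one_add (x : ℍ[F, c₁, c₂]) : quatNrd (1 + x) = 1 + trd x + quatNrd x := by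
  simp [quatNrd, trd]; ring

theorem trd_mul_comm (x y : ℍ[F, c₁, c₂]) : trd (x * y) = trd (y * x) := by
  simp [trd]; ring

theorem trd_add (x y : ℍ[F, c₁, c₂]) : trd (x + y) = trd x + trd y := by
  simp [trd]; ring

theorem trd_smul (f : F) (x : ℍ[F, c₁, c₂]) : trd (f • x) = f * trd x := by
  simp [trd]; ring

theorem trd_algebraMap (f : F) : trd (algebraMap F ℍ[F, c₁, c₂] f) = 2 * f := (two_mul f).symm

theorem sq_eq (x : ℍ[F, c₁, c₂]) : x * x = trd x • x - algebraMap F _ (quatNrd x) := by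
  rw [← mul_star, star_eq, mul_sub, mul_algebraMap]; abel

/-- The polarized form of the relation `t z t = trd (t z) t - nrd t z̄`. -/
theorem mul_mul_self (t z : ℍ[F, c₁, c₂]) :
    t * z * t = trd (t * z) • t - quatNrd t • star z := by
  ext <;> simp [quatNrd, trd] <;> ring

theorem mem_range_algebraMap_iff {x : ℍ[F, c₁, c₂]} :
    (∃ f : F, algebraMap F _ f = x) ↔ x.imI = 0 ∧ x.imJ = 0 ∧ x.imK = 0 := by
  constructor
  · rintro ⟨f, rfl⟩
    exact ⟨rfl, rfl, rfl⟩
  · rintro ⟨h1, h2, h3⟩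
    exact ⟨x.re, by ext <;> simp [*]⟩

end Algebraic

theorem exists_real_embedding (hF : TotReal F) : Nonempty (F →+* ℝ) := by
  obtain ⟨φ⟩ : Nonempty (F →+* ℂ) := inferInstance
  exact ⟨(hF φ).embedding⟩

theorem map_nrd (σ : F →+* ℝ) (x : ℍ[F, c₁, c₂]) :
    σ (quatNrd x) = σ x.re ^ 2 + (-σ c₁) * σ x.imI ^ 2 + (-σ c₂) * σ x.imJ ^ 2 +
      (σ c₁ * σ c₂) * σ x.imK ^ 2 := by
  simp [quatNrd]; ring

theorem anisotropic (hF : TotReal F) (hdef : TotallyDefinite c₁ c₂) : Anisotropic c₁ c₂ := by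
  intro x hx
  obtain ⟨σ⟩ := exists_real_embedding hF
  obtain ⟨h1, h2⟩ := hdef σ
  have h := map_nrd σ x
  rw [hx, map_zero] at h
  have h3 : 0 < σ c₁ * σ c₂ := mul_pos_of_neg_of_neg h1 h2
  have e1 : 0 ≤ (-σ c₁) * σ x.imI ^ 2 := mul_nonneg (by linarith) (sq_nonneg _)
  have e2 : 0 ≤ (-σ c₂) * σ x.imJ ^ 2 := mul_nonneg (by linarith) (sq_nonneg _)
  have e3 : 0 ≤ (σ c₁ * σ c₂) * σ x.imK ^ 2 := mul_nonneg h3.le (sq_nonneg _)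
  have e0 := sq_nonneg (σ x.re)
  have z0 : σ x.re ^ 2 = 0 := by linarith
  have z1 : (-σ c₁) * σ x.imI ^ 2 = 0 := by linarith
  have z2 : (-σ c₂) * σ x.imJ ^ 2 = 0 := by linarith
  have z3 : (σ c₁ * σ c₂) * σ x.imK ^ 2 = 0 := by linarith
  have n1 : -σ c₁ ≠ 0 := by linarith
  have n2 : -σ c₂ ≠ 0 := by linarith
  simp only [mul_eq_zero, n1, n2, h3.ne', false_or, pow_eq_zero_iff, ne_eq, OfNat.ofNat_ne_zero,
    not_false_eq_true, map_eq_zero] at z0 z1 z2 z3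
  ext <;> simp [z0, z1, z2, z3]

theorem nrd_unit_ne_zero (x : ℍ[F, c₁, c₂]ˣ) : quatNrd (x : ℍ[F, c₁, c₂]) ≠ 0 := by
  intro h
  have h1 := nrd_mul (x : ℍ[F, c₁, c₂]) (x⁻¹ : ℍ[F, c₁, c₂]ˣ)
  rw [Units.mul_inv, nrd_one, h, zero_mul] at h1
  exact one_ne_zero h1

theorem val_inv (x : ℍ[F, c₁, c₂]ˣ) :
    ((x⁻¹ : ℍ[F, c₁, c₂]ˣ) : ℍ[F, c₁, c₂]) = (quatNrd (x : ℍ[F, c₁, c₂]))⁻¹ • star x.1 := by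
  rw [← Units.mul_right_inj x, Units.mul_inv, mul_smul_comm, mul_star, ← algebraMap_mul, ← map_mul,
    inv_mul_cancel₀ (nrd_unit_ne_zero x), map_one]

omit [NumberField F] in
theorem nrd_inv (x : ℍ[F, c₁, c₂]ˣ) :
    quatNrd ((x⁻¹ : ℍ[F, c₁, c₂]ˣ) : ℍ[F, c₁, c₂]) = (quatNrd (x : ℍ[F, c₁, c₂]))⁻¹ := by
  exact eq_inv_of_mul_eq_one_left (by rw [← nrd_mul, Units.inv_mul, nrd_one])

section Anisotropic

variable (hD : Anisotropic c₁ c₂)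
include hD

omit [NumberField F] in
theorem nrd_eq_zero {x : ℍ[F, c₁, c₂]} : quatNrd x = 0 ↔ x = 0 :=
  ⟨hD x, fun h => h ▸ nrd_zero⟩

omit [NumberField F] in
theorem noZeroDivisors : NoZeroDivisors ℍ[F, c₁, c₂] where
  eq_zero_or_eq_zero_of_mul_eq_zero {x y} h := by
    rw [← nrd_eq_zero hD, ← nrd_eq_zero hD, ← mul_eq_zero, ← nrd_mul, h, nrd_zero]

omit [NumberField F] in
theorem isUnit_of_ne_zero {x : ℍ[F, c₁, c₂]} (hx : x ≠ 0) : IsUnit x := by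
  have h : quatNrd x ≠ 0 := fun h => hx (hD x h)
  refine ⟨⟨x, (quatNrd x)⁻¹ • star x, ?_, ?_⟩, rfl⟩
  · rw [mul_smul_comm, mul_star, ← algebraMap_mul, ← map_mul, inv_mul_cancel₀ h, map_one]
  · rw [smul_mul_assoc, star_mul, ← algebraMap_mul, ← map_mul, inv_mul_cancel₀ h, map_one]

theorem c₁_ne_zero : c₁ ≠ 0 := by
  rintro rfl
  have := hD ⟨0, 1, 0, 0⟩ (by simp [quatNrd])
  simpa using congrArg QuaternionAlgebra.imI this

theorem c₂_ne_zero : c₂ ≠ 0 := by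
  rintro rfl
  have := hD ⟨0, 0, 1, 0⟩ (by simp [quatNrd])
  simpa using congrArg QuaternionAlgebra.imJ this

theorem mem_center_iff {x : ℍ[F, c₁, c₂]ˣ} :
    x ∈ Subgroup.center ℍ[F, c₁, c₂]ˣ ↔ ∃ f : F, algebraMap F _ f = (x : ℍ[F, c₁, c₂]) := by
  rw [Subgroup.mem_center_iff]
  constructor
  · intro h
    have hI : (⟨0, 1, 0, 0⟩ : ℍ[F, c₁, c₂]) ≠ 0 := fun h => by
      simpa using congrArg QuaternionAlgebra.imI h
    have hJ : (⟨0, 0, 1, 0⟩ : ℍ[F, c₁, c₂]) ≠ 0 := fun h => by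
      simpa using congrArg QuaternionAlgebra.imJ h
    have h1 := congrArg Units.val (h (isUnit_of_ne_zero hD hI).unit)
    have h2 := congrArg Units.val (h (isUnit_of_ne_zero hD hJ).unit)
    rw [Units.val_mul, Units.val_mul, IsUnit.unit_spec] at h1 h2
    rw [mem_range_algebraMap_iff]
    have a1 := congrArg QuaternionAlgebra.imJ h1
    have a2 := congrArg QuaternionAlgebra.imK h1
    have a3 := congrArg QuaternionAlgebra.imK h2
    simp at a1 a2 a3
    have n1 := c₁_ne_zero hD
    refine ⟨?_, ?_, ?_⟩
    · exact self_eq_neg.1 (by linear_combination -a3)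
    · exact self_eq_neg.1 (by linear_combination a2)
    · exact self_eq_neg.1 (mul_left_cancel₀ n1 (by linear_combination a1))
  · rintro ⟨f, hf⟩ g
    ext1
    rw [Units.val_mul, Units.val_mul, ← hf, Algebra.commutes]

end Anisotropic

end QuatAlg

end QuaternionBasics

section QuaternionGroup

namespace QuatAlg

variable (hD : Anisotropic c₁ c₂)
include hD

theorem center_mk_eq_iff {x y : ℍ[F, c₁, c₂]ˣ} :
    (QuotientGroup.mk x : ℍ[F, c₁, c₂]ˣ ⧸ Subgroup.center ℍ[F, c₁, c₂]ˣ) = QuotientGroup.mk y ↔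
      ∃ f : F, f ≠ 0 ∧ (y : ℍ[F, c₁, c₂]) = f • (x : ℍ[F, c₁, c₂]) := by
  rw [QuotientGroup.eq, mem_center_iff hD]
  constructor
  · rintro ⟨f, hf⟩
    have h1 : (y : ℍ[F, c₁, c₂]) = f • (x : ℍ[F, c₁, c₂]) := by
      rw [← mul_algebraMap, hf, ← Units.val_mul, mul_inv_cancel_left]
    refine ⟨f, ?_, h1⟩
    rintro rfl
    rw [zero_smul] at h1
    exact nrd_unit_ne_zero y (by rw [h1, nrd_zero])
  · rintro ⟨f, -, hf⟩
    refine ⟨f, ?_⟩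
    rw [Units.val_mul, hf, mul_smul_comm, Units.inv_mul, ← mul_algebraMap, one_mul]

/-- An element commuting with a non-central element `i` of trace zero lies in `F + F i`. -/
theorem exists_eq_add_smul_of_commute {i y : ℍ[F, c₁, c₂]} (hi : i ≠ 0) (hi0 : i.re = 0)
    (h : y * i = i * y) : ∃ a b : F, y = algebraMap F _ a + b • i := by
  set y₀ := y - algebraMap F _ y.re with hy₀
  have h0 : y₀.re = 0 := by simp [y₀]
  have hc : y₀ * i = i * y₀ := by
    rw [hy₀, sub_mul, mul_sub, h, Algebra.commutes]
  have hs : star (y₀ * i) = y₀ * i := by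
    have e1 : star i = -i := QuaternionAlgebra.star_eq_neg.2 hi0
    have e2 : star y₀ = -y₀ := QuaternionAlgebra.star_eq_neg.2 h0
    rw [StarMul.star_mul, e1, e2, neg_mul_neg, hc]
  have h1 := QuaternionAlgebra.star_eq_self.1 hs
  obtain ⟨u, rfl⟩ := isUnit_of_ne_zero hD hi
  refine ⟨y.re, (y₀ * u).re * -(quatNrd (u : ℍ[F, c₁, c₂]))⁻¹, ?_⟩
  have h2 : y₀ = (y₀ * u).re • ((u⁻¹ : ℍ[F, c₁, c₂]ˣ) : ℍ[F, c₁, c₂]) := by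
    rw [← algebraMap_mul, QuaternionAlgebra.coe_algebraMap, ← h1, Units.mul_inv_cancel_right]
  have e1 : star (u : ℍ[F, c₁, c₂]) = -u := QuaternionAlgebra.star_eq_neg.2 hi0
  rw [val_inv, e1, smul_neg, smul_neg] at h2
  rw [mul_neg, neg_smul, ← smul_smul]
  have h3 : y = algebraMap F _ y.re + y₀ := by rw [hy₀]; abel
  exact h3.trans (congrArg _ h2)

theorem commute_of_commute {i y y' : ℍ[F, c₁, c₂]} (hi : i ≠ 0) (hi0 : i.re = 0)
    (h : y * i = i * y) (h' : y' * i = i * y') : y * y' = y' * y := by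
  obtain ⟨a, b, rfl⟩ := exists_eq_add_smul_of_commute hD hi hi0 h
  rw [add_mul, mul_add, smul_mul_assoc, mul_smul_comm, h', Algebra.commutes]

/-- The classes modulo the centre of the elements commuting with a trace zero unit `i` embed into
the multiplicative monoid of a commutative domain, by `y ↦ y / ȳ`. -/
theorem isCyclic_of_commute {i : ℍ[F, c₁, c₂]} (hi : i ≠ 0) (hi0 : i.re = 0)
    (C : Subgroup (ℍ[F, c₁, c₂]ˣ ⧸ Subgroup.center ℍ[F, c₁, c₂]ˣ)) [Finite C]
    (hC : ∀ x : ℍ[F, c₁, c₂]ˣ, QuotientGroup.mk x ∈ C →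
      (x : ℍ[F, c₁, c₂]) * i = i * (x : ℍ[F, c₁, c₂])) : IsCyclic C := by
  have hcomm : ∀ a ∈ ({i} : Set ℍ[F, c₁, c₂]), ∀ b ∈ ({i} : Set ℍ[F, c₁, c₂]), a * b = b * a := by
    rintro _ rfl _ rfl
    rfl
  have := Algebra.isMulCommutative_adjoin F hcomm
  have : IsDomain (Algebra.adjoin F {i}) := by
    have := noZeroDivisors hD
    have h1 : NoZeroDivisors (Algebra.adjoin F {i}) :=
      Function.Injective.noZeroDivisors _ Subtype.val_injective rfl fun _ _ => rfl
    have h2 : Nontrivial (Algebra.adjoin F {i}) := ⟨0, 1, fun h => by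
      simpa using congrArg (fun x : Algebra.adjoin F {i} => (x : ℍ[F, c₁, c₂]).re) h⟩
    exact NoZeroDivisors.to_isDomain _
  have hmem : ∀ y : ℍ[F, c₁, c₂], y * i = i * y → y ∈ Algebra.adjoin F {i} := by
    intro y hy
    obtain ⟨a, b, rfl⟩ := exists_eq_add_smul_of_commute hD hi hi0 hy
    exact add_mem (Subalgebra.algebraMap_mem _ a)
      (Subalgebra.smul_mem _ (Algebra.self_mem_adjoin_singleton F i) b)
  let ρ : C → ℍ[F, c₁, c₂]ˣ := fun q => Quotient.out q.1
  have hρ : ∀ q, QuotientGroup.mk (ρ q) = q.1 := fun q => Quotient.out_eq' q.1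
  have hρi : ∀ q, (ρ q : ℍ[F, c₁, c₂]) * i = i * ρ q := fun q => hC _ (by rw [hρ]; exact q.2)
  let g : ℍ[F, c₁, c₂]ˣ → ℍ[F, c₁, c₂] := fun x =>
    (quatNrd (x : ℍ[F, c₁, c₂]))⁻¹ • ((x : ℍ[F, c₁, c₂]) * x)
  have hg : ∀ x y : ℍ[F, c₁, c₂]ˣ,
      (QuotientGroup.mk x : ℍ[F, c₁, c₂]ˣ ⧸ Subgroup.center ℍ[F, c₁, c₂]ˣ) = QuotientGroup.mk y →
      g x = g y := by
    intro x y h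
    obtain ⟨f, hf, hxy⟩ := (center_mk_eq_iff hD).1 h
    simp only [g, hxy, nrd_smul, smul_mul_smul_comm, smul_smul]
    congr 1
    have := nrd_unit_ne_zero x
    field_simp
  have hgi : ∀ q, g (ρ q) ∈ Algebra.adjoin F {i} := fun q =>
    Subalgebra.smul_mem _ (mul_mem (hmem _ (hρi q)) (hmem _ (hρi q))) _
  let φ : C →* Algebra.adjoin F {i} :=
    { toFun := fun q => ⟨g (ρ q), hgi q⟩
      map_one' := Subtype.ext (by
        change g (ρ 1) = 1
        rw [hg (ρ 1) 1 (by rw [hρ]; rfl)]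
        simp [g, nrd_one])
      map_mul' := fun q q' => Subtype.ext (by
        change g (ρ (q * q')) = g (ρ q) * g (ρ q')
        rw [hg (ρ (q * q')) (ρ q * ρ q') (by rw [hρ, QuotientGroup.mk_mul, hρ, hρ]; rfl)]
        simp only [g, Units.val_mul, nrd_mul, smul_mul_smul_comm, mul_inv]
        congr 1
        have := commute_of_commute hD hi hi0 (hρi q) (hρi q')
        rw [mul_assoc, ← mul_assoc (ρ q').val, ← this]
        simp only [mul_assoc]) }
  refine isCyclic_of_injective_ringHom φ ((injective_iff_map_eq_one φ).2 fun q hq => ?_)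
  have h1 : g (ρ q) = 1 := congrArg Subtype.val hq
  have h2 : (ρ q : ℍ[F, c₁, c₂]) * ρ q = ρ q * star (ρ q : ℍ[F, c₁, c₂]) := by
    rw [mul_star, ← mul_one (algebraMap F ℍ[F, c₁, c₂] _), algebraMap_mul, ← h1, smul_smul,
      mul_inv_cancel₀ (nrd_unit_ne_zero _), one_smul]
  have h3 := QuaternionAlgebra.star_eq_self.1 ((Units.mul_right_inj _).1 h2).symm
  refine Subtype.ext ?_
  rw [← hρ q, Subgroup.coe_one, QuotientGroup.eq_one_iff, mem_center_iff hD]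
  exact ⟨_, h3.symm⟩

theorem twoSubgroupsDihedral :
    TwoSubgroupsDihedral (ℍ[F, c₁, c₂]ˣ ⧸ Subgroup.center ℍ[F, c₁, c₂]ˣ) := by
  intro Q hQ hQ2
  by_cases hnt : Nontrivial Q
  swap
  · rw [not_nontrivial_iff_subsingleton] at hnt
    have h1 : ∀ s ∈ Q, s ∈ Subgroup.zpowers (1 : ℍ[F, c₁, c₂]ˣ ⧸ Subgroup.center _) := by
      intro s hs
      have := congrArg Subtype.val (Subsingleton.elim (⟨s, hs⟩ : Q) 1)
      rw [show s = 1 from this]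
      exact one_mem _
    exact ⟨1, Q.one_mem, fun s hs hs' => absurd (h1 s hs) hs',
      fun s hs hs' => absurd (h1 s hs) hs'⟩
  have hZ := hQ2.center_nontrivial
  have : Fact (Nat.Prime 2) := ⟨Nat.prime_two⟩
  obtain ⟨z, hz⟩ : ∃ z : Subgroup.center Q, orderOf z = 2 := by
    refine exists_prime_orderOf_dvd_card' 2 ?_
    obtain ⟨n, hn⟩ := (hQ2.to_subgroup (Subgroup.center Q)).exists_card_eq
    rcases n with _ | n
    · have := Finite.one_lt_card (α := Subgroup.center Q)
      omega
    · exact hn ▸ dvd_pow_self 2 n.succ_ne_zero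
  obtain ⟨i, hi⟩ := QuotientGroup.mk_surjective (s := Subgroup.center _) z.1.1
  have hi1 : (QuotientGroup.mk i : ℍ[F, c₁, c₂]ˣ ⧸ Subgroup.center _) ≠ 1 := by
    intro h
    have : z = 1 := Subtype.ext (Subtype.ext (hi.symm.trans h))
    rw [this, orderOf_one] at hz
    omega
  have hi2 : (QuotientGroup.mk (i * i) : ℍ[F, c₁, c₂]ˣ ⧸ Subgroup.center _) = 1 := by
    have h1 : z * z = 1 := by rw [← pow_two, ← hz, pow_orderOf_eq_one]
    rw [QuotientGroup.mk_mul, hi]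
    exact congrArg (fun w : Subgroup.center Q => w.1.1) h1
  have hi0 : (i : ℍ[F, c₁, c₂]).re = 0 := by
    by_contra h0
    rw [Ne, QuotientGroup.eq_one_iff, mem_center_iff hD] at hi1
    rw [QuotientGroup.eq_one_iff, mem_center_iff hD] at hi2
    obtain ⟨f, hf⟩ := hi2
    have ht : trd (i : ℍ[F, c₁, c₂]) ≠ 0 := by
      rw [trd, ← two_mul]
      exact mul_ne_zero two_ne_zero h0
    rw [Units.val_mul, sq_eq, eq_sub_iff_add_eq, ← map_add] at hf
    refine hi1 ⟨(trd (i : ℍ[F, c₁, c₂]))⁻¹ * (f + quatNrd (i : ℍ[F, c₁, c₂])), ?_⟩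
    rw [map_mul, hf, algebraMap_mul, smul_smul, inv_mul_cancel₀ ht, one_smul]
  have hpm : ∀ x : ℍ[F, c₁, c₂]ˣ, QuotientGroup.mk x ∈ Q → (x : ℍ[F, c₁, c₂]) * i = i * x ∨
      (x : ℍ[F, c₁, c₂]) * i = -(i * x) := by
    intro x hx
    have h1 : (QuotientGroup.mk (i * x) : ℍ[F, c₁, c₂]ˣ ⧸ Subgroup.center _) =
        QuotientGroup.mk (x * i) := by
      have := Subgroup.mem_center_iff.1 z.2 ⟨_, hx⟩
      rw [QuotientGroup.mk_mul, QuotientGroup.mk_mul, hi]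
      exact (congrArg Subtype.val this).symm
    obtain ⟨f, -, hf⟩ := (center_mk_eq_iff hD).1 h1
    rw [Units.val_mul, Units.val_mul] at hf
    have h2 : f ^ 2 = 1 := by
      have := congrArg quatNrd hf
      rw [nrd_smul, nrd_mul, nrd_mul, mul_comm (quatNrd x.1)] at this
      exact mul_right_cancel₀ (mul_ne_zero (nrd_unit_ne_zero i) (nrd_unit_ne_zero x))
        (by rw [one_mul]; exact this.symm)
    rcases mul_self_eq_one_iff.1 ((pow_two f).symm.trans h2) with rfl | rfl
    · exact Or.inl (by rw [hf, one_smul])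
    · exact Or.inr (by rw [hf, neg_smul, one_smul])
  have hiz : (i : ℍ[F, c₁, c₂]) ≠ 0 := i.ne_zero
  let C : Subgroup (ℍ[F, c₁, c₂]ˣ ⧸ Subgroup.center ℍ[F, c₁, c₂]ˣ) :=
    Q ⊓ (Subgroup.centralizer {i}).map (QuotientGroup.mk' _)
  have hCmem : ∀ x : ℍ[F, c₁, c₂]ˣ, QuotientGroup.mk x ∈ Q →
      (QuotientGroup.mk x ∈ C ↔ (x : ℍ[F, c₁, c₂]) * i = i * x) := by
    intro x hx
    constructor
    · rintro ⟨-, y, hy, hyx⟩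
      obtain ⟨f, -, hf⟩ := (center_mk_eq_iff hD).1 hyx
      have := congrArg Units.val (Subgroup.mem_centralizer_singleton_iff.1 hy)
      simp only [Units.val_mul] at this
      rw [hf, smul_mul_assoc, mul_smul_comm, this]
    · intro h
      exact ⟨hx, x, Subgroup.mem_centralizer_singleton_iff.2 (Units.ext h), rfl⟩
  have hCfin : Finite C :=
    Finite.of_injective _ (Subgroup.inclusion_injective (inf_le_left : C ≤ Q))
  have hcyc : IsCyclic C := isCyclic_of_commute hD hiz hi0 C fun x hx => (hCmem x hx.1).1 hx
  obtain ⟨⟨r, hr⟩, hgen⟩ := hcyc.exists_generator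
  have hCr : ∀ s, s ∈ Subgroup.zpowers r ↔ s ∈ C := by
    intro s
    constructor
    · intro h
      exact Subgroup.zpowers_le.2 hr h
    · intro h
      obtain ⟨k, hk⟩ := hgen ⟨s, h⟩
      exact ⟨k, congrArg Subtype.val hk⟩
  refine ⟨r, hr.1, fun s hs hs' => ?_, fun s hs hs' t ht ht' => ?_⟩
  · rw [hCr] at hs'
    obtain ⟨x, rfl⟩ := QuotientGroup.mk_surjective s
    obtain ⟨y, rfl⟩ := QuotientGroup.mk_surjective r
    have hx := (hpm x hs).resolve_left fun h => hs' ((hCmem x hs).2 h)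
    obtain ⟨a, b, hab⟩ := exists_eq_add_smul_of_commute hD hiz hi0 ((hCmem y hr.1).1 hr)
    have hstar : star (y : ℍ[F, c₁, c₂]) = algebraMap F _ a - b • i := by
      have e1 : star (i : ℍ[F, c₁, c₂]) = -i := QuaternionAlgebra.star_eq_neg.2 hi0
      rw [hab, star_add, star_algebraMap, star_smul, e1, smul_neg, ← sub_eq_add_neg]
    have hxy : (x : ℍ[F, c₁, c₂]) * y = star (y : ℍ[F, c₁, c₂]) * x := by
      rw [hstar, hab, mul_add, sub_mul, mul_smul_comm, hx, Algebra.commutes, smul_mul_assoc,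
        smul_neg, sub_eq_add_neg]
    rw [← QuotientGroup.mk_mul, ← QuotientGroup.mk_inv, ← QuotientGroup.mk_mul,
      ← QuotientGroup.mk_inv, eq_comm, center_mk_eq_iff hD]
    refine ⟨quatNrd (y : ℍ[F, c₁, c₂]), nrd_unit_ne_zero y, ?_⟩
    rw [val_inv y, smul_smul, mul_inv_cancel₀ (nrd_unit_ne_zero y), one_smul, Units.val_mul,
      Units.val_mul, hxy, Units.mul_inv_cancel_right]
  · rw [hCr] at hs' ht' ⊢
    obtain ⟨x, rfl⟩ := QuotientGroup.mk_surjective s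
    obtain ⟨y, rfl⟩ := QuotientGroup.mk_surjective t
    have hx := (hpm x hs).resolve_left fun h => hs' ((hCmem x hs).2 h)
    have hy := (hpm y ht).resolve_left fun h => ht' ((hCmem y ht).2 h)
    rw [← QuotientGroup.mk_mul, hCmem _ (mul_mem hs ht), Units.val_mul, mul_assoc, hy, mul_neg,
      ← mul_assoc, hx, neg_mul, neg_neg, mul_assoc]

end QuatAlg

end QuaternionGroup

section Localization

namespace LatLoc

variable {A D : Type*} [CommRing A] [Ring D] [Algebra A D] {M : Submonoid ℤ}

/-- The localization inside `D` of an `A`-submodule at a multiplicative set of integers. -/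
def loc (M : Submonoid ℤ) (L : Submodule A D) : Submodule A D where
  carrier := {x | ∃ n ∈ M, n • x ∈ L}
  zero_mem' := ⟨1, M.one_mem, by simp⟩
  add_mem' := by
    rintro x y ⟨m, hm, hx⟩ ⟨n, hn, hy⟩
    refine ⟨m * n, M.mul_mem hm hn, ?_⟩
    rw [smul_add]
    refine add_mem ?_ ?_
    · rw [mul_comm, mul_smul]
      exact zsmul_mem hx n
    · rw [mul_smul]
      exact zsmul_mem hy m
  smul_mem' := by
    rintro a x ⟨m, hm, hx⟩
    exact ⟨m, hm, by rw [smul_comm]; exact L.smul_mem a hx⟩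

theorem le_loc (L : Submodule A D) : L ≤ loc M L := fun x hx => ⟨1, M.one_mem, by simpa using hx⟩

theorem loc_mono {L L' : Submodule A D} (h : L ≤ L') : loc M L ≤ loc M L' :=
  fun _ ⟨n, hn, hx⟩ => ⟨n, hn, h hx⟩

theorem loc_le_iff {L L' : Submodule A D} : loc M L ≤ loc M L' ↔ L ≤ loc M L' := by
  refine ⟨(le_loc L).trans, fun h x ⟨n, hn, hx⟩ => ?_⟩
  obtain ⟨m, hm, hx⟩ := h hx
  exact ⟨m * n, M.mul_mem hm hn, by rwa [mul_smul]⟩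

theorem loc_loc (L : Submodule A D) : loc M (loc M L) = loc M L :=
  le_antisymm (loc_le_iff.2 le_rfl) (le_loc _)

theorem loc_eq_iff {L L' : Submodule A D} :
    loc M L = loc M L' ↔ L ≤ loc M L' ∧ L' ≤ loc M L := by
  rw [le_antisymm_iff, loc_le_iff, loc_le_iff]

theorem loc_inf (L L' : Submodule A D) : loc M (L ⊓ L') = loc M L ⊓ loc M L' := by
  refine le_antisymm (le_inf (loc_mono inf_le_left) (loc_mono inf_le_right)) ?_
  rintro x ⟨⟨m, hm, hx⟩, n, hn, hx'⟩
  refine ⟨m * n, M.mul_mem hm hn, ?_, ?_⟩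
  · rw [mul_comm, mul_smul]
    exact zsmul_mem hx n
  · rw [mul_smul]
    exact zsmul_mem hx' m

theorem loc_mul_le (X Y : Submodule A D) : loc M X * loc M Y ≤ loc M (X * Y) := by
  rw [Submodule.mul_le]
  rintro x ⟨m, hm, hx⟩ y ⟨n, hn, hy⟩
  refine ⟨m * n, M.mul_mem hm hn, ?_⟩
  rw [← smul_mul_smul_comm]
  exact Submodule.mul_mem_mul hx hy

theorem loc_mul_congr {X X' Y Y' : Submodule A D} (hX : loc M X = loc M X')
    (hY : loc M Y = loc M Y') : loc M (X * Y) = loc M (X' * Y') := by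
  have key : ∀ {X X' Y Y' : Submodule A D}, loc M X = loc M X' → loc M Y = loc M Y' →
      X * Y ≤ loc M (X' * Y') := fun {X X' Y Y'} hX hY =>
    (mul_le_mul' ((le_loc X).trans_eq hX) ((le_loc Y).trans_eq hY)).trans (loc_mul_le _ _)
  exact loc_eq_iff.2 ⟨key hX hY, key hX.symm hY.symm⟩

theorem unit_mul_le_iff (u : (Submodule A D)ˣ) {X Y : Submodule A D} :
    u.1 * X ≤ u.1 * Y ↔ X ≤ Y := by
  refine ⟨fun h => ?_, fun h => mul_le_mul' le_rfl h⟩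
  have := mul_le_mul' (le_refl (u⁻¹).1) h
  rwa [Units.inv_mul_cancel_left, Units.inv_mul_cancel_left] at this

theorem exists_smul_mem_of_fg {X Y : Submodule A D} (hX : X.FG) (h : X ≤ loc M Y) :
    ∃ n ∈ M, ∀ x ∈ X, n • x ∈ Y := by
  induction X, hX using Submodule.fg_induction with
  | singleton x =>
    obtain ⟨n, hn, hx⟩ := h (Submodule.mem_span_singleton_self x)
    refine ⟨n, hn, fun y hy => ?_⟩
    obtain ⟨a, rfl⟩ := Submodule.mem_span_singleton.1 hy
    rw [smul_comm]
    exact Y.smul_mem a hx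
  | sup X₁ X₂ _ _ h₁ h₂ =>
    obtain ⟨m, hm, h₁⟩ := h₁ (le_sup_left.trans h)
    obtain ⟨n, hn, h₂⟩ := h₂ (le_sup_right.trans h)
    refine ⟨m * n, M.mul_mem hm hn, fun x hx => ?_⟩
    obtain ⟨y, hy, z, hz, rfl⟩ := Submodule.mem_sup.1 hx
    rw [smul_add]
    refine add_mem ?_ ?_
    · rw [mul_comm, mul_smul]
      exact zsmul_mem (h₁ y hy) n
    · rw [mul_smul]
      exact zsmul_mem (h₂ z hz) m

/-- The integers coprime to `p`. -/
def primeTo (p : ℤ) : Submonoid ℤ where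
  carrier := {n | IsCoprime n p}
  one_mem' := isCoprime_one_left
  mul_mem' := IsCoprime.mul_left

theorem mem_primeTo {p n : ℤ} : n ∈ primeTo p ↔ IsCoprime n p := Iff.rfl

theorem mem_primeTo_iff {p : ℕ} (hp : p.Prime) {n : ℤ} : n ∈ primeTo p ↔ ¬ (p : ℤ) ∣ n := by
  rw [mem_primeTo, isCoprime_comm]
  exact (Nat.prime_iff_prime_int.1 hp).coprime_iff_not_dvd

theorem mem_of_isCoprime {L : Submodule A D} {x : D} {m n : ℤ} (h : IsCoprime m n)
    (hm : m • x ∈ L) (hn : n • x ∈ L) : x ∈ L := by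
  obtain ⟨a, b, hab⟩ := h
  have := add_mem (zsmul_mem hm a) (zsmul_mem hn b)
  rwa [← mul_smul, ← mul_smul, ← add_smul, hab, one_smul] at this

theorem le_of_forall_prime {L L' : Submodule A D}
    (h : ∀ p : ℕ, p.Prime → L ≤ loc (primeTo p) L') : L ≤ L' := by
  intro x hx
  let I : Ideal ℤ :=
    { carrier := {n | n • x ∈ L'}
      zero_mem' := by simp
      add_mem' := fun {a b} ha hb => by
        change (a + b) • x ∈ L'
        rw [add_smul]
        exact add_mem ha hb
      smul_mem' := fun c a ha => by
        change (c * a) • x ∈ L'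
        rw [mul_smul]
        exact zsmul_mem ha c }
  suffices h1 : I = ⊤ by
    have : (1 : ℤ) ∈ I := h1 ▸ Submodule.mem_top
    simpa [I] using this
  by_contra hI
  obtain ⟨P, hP, hIP⟩ := Ideal.exists_le_maximal I hI
  obtain ⟨g, rfl⟩ := (IsPrincipalIdealRing.principal P).principal
  rw [Ideal.submodule_span_eq] at hP hIP
  obtain ⟨p, hp⟩ : ∃ p : ℕ, p.Prime ∧ g ∣ p := by
    by_cases hg : g = 0
    · exact ⟨2, Nat.prime_two, by
        exfalso
        subst hg
        rw [show ({0} : Set ℤ) = {0} from rfl, Ideal.span_singleton_eq_bot.2 rfl] at hP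
        exact Ring.ne_bot_of_isMaximal_of_not_isField hP Int.not_isField rfl⟩
    · refine ⟨g.natAbs, ?_, Int.dvd_natAbs_self⟩
      exact Int.prime_iff_natAbs_prime.1 ((Ideal.span_singleton_prime hg).1 hP.isPrime)
  obtain ⟨n, hn, hnx⟩ := h p hp.1 hx
  have h1 : n ∈ Ideal.span {g} := hIP hnx
  rw [Ideal.mem_span_singleton] at h1
  have h2 : IsUnit g := IsCoprime.isUnit_of_dvd' (mem_primeTo.1 hn) h1 hp.2
  exact hP.ne_top (Ideal.span_singleton_eq_top.2 h2)

theorem loc_primeTo_inf_loc_powers (p : ℤ) (L : Submodule A D) :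
    loc (primeTo p) L ⊓ loc (Submonoid.powers p) L = L := by
  refine le_antisymm ?_ (le_inf (le_loc L) (le_loc L))
  rintro x ⟨⟨m, hm, hx⟩, _, ⟨k, rfl⟩, hx'⟩
  exact mem_of_isCoprime (IsCoprime.pow_right hm) hx hx'

theorem loc_primeTo_le_of_powers {p q : ℤ} (h : IsCoprime p q) {L L' : Submodule A D}
    (hL : loc (Submonoid.powers p) L ≤ loc (Submonoid.powers p) L') :
    loc (primeTo q) L ≤ loc (primeTo q) L' := by
  rw [loc_le_iff] at hL ⊢
  intro x hx
  obtain ⟨_, ⟨k, rfl⟩, h'⟩ := hL hx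
  exact ⟨_, IsCoprime.pow_left h, h'⟩

theorem loc_primeTo_congr_of_powers {p q : ℤ} (h : IsCoprime p q) {L L' : Submodule A D}
    (hL : loc (Submonoid.powers p) L = loc (Submonoid.powers p) L') :
    loc (primeTo q) L = loc (primeTo q) L' :=
  le_antisymm (loc_primeTo_le_of_powers h hL.le) (loc_primeTo_le_of_powers h hL.ge)

/-- A full lattice: finitely generated, and containing a nonzero integral multiple of every
element. -/
structure IsLat (L : Submodule A D) : Prop where
  fg : L.FG
  full : ∀ d : D, ∃ n : ℤ, n ≠ 0 ∧ n • d ∈ L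

theorem IsLat.exists_smul_mem {L X : Submodule A D} (hL : IsLat L) (hX : X.FG) :
    ∃ n : ℤ, n ≠ 0 ∧ ∀ x ∈ X, n • x ∈ L := by
  obtain ⟨n, hn, h⟩ := exists_smul_mem_of_fg (M := nonZeroDivisors ℤ) (Y := L) hX fun d _ => by
    obtain ⟨n, hn, hd⟩ := hL.full d
    exact ⟨n, mem_nonZeroDivisors_of_ne_zero hn, hd⟩
  exact ⟨n, nonZeroDivisors.ne_zero hn, h⟩

theorem IsLat.of_le {L L' : Submodule A D} (hL : IsLat L) (hfg : L'.FG) (h : L ≤ L') : IsLat L' :=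
  ⟨hfg, fun d => (hL.full d).imp fun _ hn => ⟨hn.1, h hn.2⟩⟩

theorem IsLat.of_smul_le {L L' : Submodule A D} (hL : IsLat L) (hfg : L'.FG) {n : ℤ} (hn : n ≠ 0)
    (h : ∀ x ∈ L, n • x ∈ L') : IsLat L' := by
  refine ⟨hfg, fun d => ?_⟩
  obtain ⟨m, hm, hd⟩ := hL.full d
  exact ⟨n * m, mul_ne_zero hn hm, by rw [mul_smul]; exact h _ hd⟩

theorem IsLat.unit_mul {L : Submodule A D} (hL : IsLat L) (u : (Submodule A D)ˣ) :
    IsLat (u.1 * L) := by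
  refine ⟨(Submodule.fg_unit u).mul hL.fg, fun d => ?_⟩
  obtain ⟨n, hn, h⟩ := hL.exists_smul_mem
    ((Submodule.fg_unit u⁻¹).mul (Submodule.fg_span_singleton d))
  refine ⟨n, hn, ?_⟩
  have h2 : Submodule.span A {n • d} ≤ u.1 * L := by
    rw [← unit_mul_le_iff u⁻¹, Units.inv_mul_cancel_left, Submodule.mul_le]
    intro x hx y hy
    obtain ⟨a, rfl⟩ := Submodule.mem_span_singleton.1 hy
    have := h _ (Submodule.mul_mem_mul hx
      (Submodule.smul_mem _ a (Submodule.mem_span_singleton_self d)))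
    rwa [smul_comm, mul_smul_comm]
  exact h2 (Submodule.mem_span_singleton_self _)

end LatLoc

end Localization

section QuaternionLattices

/-- The ring of integers of `F`, as a `ℤ`-subalgebra. -/
abbrev RI (F : Type*) [Field F] [NumberField F] : Subalgebra ℤ F := integralClosure ℤ F

/-- The `O_F`-submodules of `ℍ[F,c₁,c₂]`. -/
abbrev QLat (c₁ c₂ : F) : Type _ := Submodule ↥(RI F) ℍ[F, c₁, c₂]

namespace RI

instance : IsDedekindDomain ↥(RI F) :=
  inferInstanceAs (IsDedekindDomain (NumberField.RingOfIntegers F))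

instance : IsFractionRing ↥(RI F) F :=
  inferInstanceAs (IsFractionRing (NumberField.RingOfIntegers F) F)

instance : Module.Finite ℤ ↥(RI F) :=
  inferInstanceAs (Module.Finite ℤ (NumberField.RingOfIntegers F))

theorem smul_def (a : ↥(RI F)) (x : ℍ[F, c₁, c₂]) : a • x = (a : F) • x := rfl

theorem exists_zsmul_mem (f : F) : ∃ n : ℤ, n ≠ 0 ∧ n • f ∈ RI F := by
  obtain ⟨n, hn, h⟩ := IsAlgebraic.exists_integral_multiple
    ((IsFractionRing.isAlgebraic_iff ℤ ℚ F).2 (Algebra.IsAlgebraic.isAlgebraic (R := ℚ) f))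
  exact ⟨n, hn, h⟩

theorem exists_zsmul_mem₂ (f g : F) : ∃ n : ℤ, n ≠ 0 ∧ n • f ∈ RI F ∧ n • g ∈ RI F := by
  obtain ⟨m, hm, h⟩ := exists_zsmul_mem f
  obtain ⟨n, hn, h'⟩ := exists_zsmul_mem g
  refine ⟨m * n, mul_ne_zero hm hn, ?_, ?_⟩
  · rw [mul_comm, mul_smul]
    exact zsmul_mem h n
  · rw [mul_smul]
    exact zsmul_mem h' m

theorem mem_of_forall_zsmul_pow {f : F} {n : ℤ} (hn : n ≠ 0) (h : ∀ k : ℕ, n • f ^ k ∈ RI F) :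
    f ∈ RI F := by
  have h1 : IsAlmostIntegral ↥(RI F) f := by
    refine ⟨(n : ↥(RI F)), ?_, fun k => ?_⟩
    · exact mem_nonZeroDivisors_of_ne_zero (by exact_mod_cast hn)
    · refine ⟨⟨_, h k⟩, ?_⟩
      change n • f ^ k = (n : ↥(RI F)) • f ^ k
      rw [Int.cast_smul_eq_zsmul]
  obtain ⟨y, rfl⟩ := IsIntegrallyClosed.isIntegral_iff.1 h1.isIntegral
  exact y.2

end RI

namespace QuatAlg

/-- The lattice of the elements with integral coordinates. -/
def stdLat (c₁ c₂ : F) : QLat c₁ c₂ where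
  carrier := {x | x.re ∈ RI F ∧ x.imI ∈ RI F ∧ x.imJ ∈ RI F ∧ x.imK ∈ RI F}
  zero_mem' := by simp [zero_mem]
  add_mem' := fun hx hy =>
    ⟨add_mem hx.1 hy.1, add_mem hx.2.1 hy.2.1, add_mem hx.2.2.1 hy.2.2.1,
      add_mem hx.2.2.2 hy.2.2.2⟩
  smul_mem' := fun a _ hx =>
    ⟨mul_mem a.2 hx.1, mul_mem a.2 hx.2.1, mul_mem a.2 hx.2.2.1, mul_mem a.2 hx.2.2.2⟩

theorem exists_zsmul_mem_stdLat (x : ℍ[F, c₁, c₂]) : ∃ n : ℤ, n ≠ 0 ∧ n • x ∈ stdLat c₁ c₂ := by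
  obtain ⟨m, hm, h1, h2⟩ := RI.exists_zsmul_mem₂ x.re x.imI
  obtain ⟨n, hn, h3, h4⟩ := RI.exists_zsmul_mem₂ x.imJ x.imK
  have key : ∀ {f : F} {a b : ℤ}, b • f ∈ RI F → (a * b) • f ∈ RI F := fun {f a b} h => by
    rw [mul_smul]
    exact zsmul_mem h a
  refine ⟨m * n, mul_ne_zero hm hn, ?_, ?_, ?_, ?_⟩
  · rw [mul_comm, QuaternionAlgebra.re_smul]; exact key h1
  · rw [mul_comm, QuaternionAlgebra.imI_smul]; exact key h2
  · rw [QuaternionAlgebra.imJ_smul]; exact key h3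
  · rw [QuaternionAlgebra.imK_smul]; exact key h4

theorem exists_zsmul_mem_stdLat_of_fg {L : QLat c₁ c₂} (hL : L.FG) :
    ∃ n : ℤ, n ≠ 0 ∧ ∀ x ∈ L, n • x ∈ stdLat c₁ c₂ := by
  obtain ⟨n, hn, h⟩ := LatLoc.exists_smul_mem_of_fg (M := nonZeroDivisors ℤ)
    (Y := stdLat c₁ c₂) hL fun d _ => by
      obtain ⟨n, hn, hd⟩ := exists_zsmul_mem_stdLat d
      exact ⟨n, mem_nonZeroDivisors_of_ne_zero hn, hd⟩
  exact ⟨n, nonZeroDivisors.ne_zero hn, h⟩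

omit [NumberField F] in
theorem nrd_zsmul (n : ℤ) (x : ℍ[F, c₁, c₂]) : quatNrd (n • x) = (n ^ 2) • quatNrd x := by
  rw [← Int.cast_smul_eq_zsmul F, nrd_smul, ← Int.cast_smul_eq_zsmul F, smul_eq_mul]
  push_cast
  rfl

theorem exists_zsmul_nrd_mem {L : QLat c₁ c₂} (hL : L.FG) :
    ∃ n : ℤ, n ≠ 0 ∧ ∀ x ∈ L, n • quatNrd x ∈ RI F := by
  obtain ⟨m, hm, h⟩ := exists_zsmul_mem_stdLat_of_fg hL
  obtain ⟨n, hn, h1, h2⟩ := RI.exists_zsmul_mem₂ c₁ c₂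
  refine ⟨n ^ 2 * m ^ 2, by positivity, fun x hx => ?_⟩
  obtain ⟨e0, e1, e2, e3⟩ := h x hx
  rw [mul_smul, ← nrd_zsmul]
  set y := m • x
  rw [zsmul_eq_mul] at h1 h2 ⊢
  have hn' : ((n : ℤ) : F) ∈ RI F := intCast_mem _ n
  have : ((n ^ 2 : ℤ) : F) * quatNrd y = n * n * (y.re * y.re) - n * (n * c₁) * (y.imI * y.imI) -
      n * (n * c₂) * (y.imJ * y.imJ) + (n * c₁) * (n * c₂) * (y.imK * y.imK) := by
    rw [quatNrd]; push_cast; ring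
  rw [this]
  exact add_mem (sub_mem (sub_mem (mul_mem (mul_mem hn' hn') (mul_mem e0 e0))
    (mul_mem (mul_mem hn' h1) (mul_mem e1 e1))) (mul_mem (mul_mem hn' h2) (mul_mem e2 e2)))
    (mul_mem (mul_mem h1 h2) (mul_mem e3 e3))

omit [NumberField F] in
theorem nrd_pow (x : ℍ[F, c₁, c₂]) (k : ℕ) : quatNrd (x ^ k) = quatNrd x ^ k := by
  induction k with
  | zero => simp [nrd_one]
  | succ k ih => rw [pow_succ, nrd_mul, ih, pow_succ]

theorem nrd_mem {L : QLat c₁ c₂} (hL : LatLoc.IsLat L) {x : ℍ[F, c₁, c₂]}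
    (h : ∀ y ∈ L, x * y ∈ L) : quatNrd x ∈ RI F := by
  obtain ⟨m, hm, h1⟩ := hL.full 1
  obtain ⟨n, hn, h2⟩ := exists_zsmul_nrd_mem hL.fg
  have hk : ∀ k : ℕ, m • x ^ k ∈ L := by
    intro k
    induction k with
    | zero => simpa using h1
    | succ k ih =>
      rw [pow_succ', ← mul_smul_comm]
      exact h _ ih
  refine RI.mem_of_forall_zsmul_pow (n := n * m ^ 2) (by positivity) fun k => ?_
  rw [mul_smul, ← nrd_pow, ← nrd_zsmul]
  exact h2 _ (hk k)

theorem trd_mem {L : QLat c₁ c₂} (hL : LatLoc.IsLat L) {x : ℍ[F, c₁, c₂]}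
    (h : ∀ y ∈ L, x * y ∈ L) : trd x ∈ RI F := by
  have h1 := nrd_mem hL (x := 1 + x) fun y hy => by
    rw [add_mul, one_mul]
    exact add_mem hy (h y hy)
  have h2 := sub_mem (sub_mem h1 (one_mem _)) (nrd_mem hL h)
  rwa [nrd_one_add, add_sub_right_comm, add_sub_cancel_right, add_sub_cancel_left] at h2

theorem mem_of_algebraMap_mul_mem {L : QLat c₁ c₂} (hL : LatLoc.IsLat L) {f : F}
    (h : ∀ y ∈ L, f • y ∈ L) : f ∈ RI F := by
  have h1 := nrd_mem hL (x := algebraMap F _ f) fun y hy => by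
    rw [algebraMap_mul]
    exact h y hy
  rw [nrd_algebraMap] at h1
  exact IsIntegral.of_pow two_pos h1

theorem finite_nrd_eq (hF : TotReal F) (hdef : TotallyDefinite c₁ c₂) {L : QLat c₁ c₂}
    (hL : L.FG) (ν : F) : {x : ℍ[F, c₁, c₂] | x ∈ L ∧ quatNrd x = ν}.Finite := by
  obtain ⟨m, hm, h⟩ := exists_zsmul_mem_stdLat_of_fg hL
  have hb : ∀ φ : F →+* ℂ, ∃ B : ℝ, 0 ≤ B ∧ ∀ x : ℍ[F, c₁, c₂], quatNrd x = m ^ 2 • ν →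
      ‖φ x.re‖ ≤ B ∧ ‖φ x.imI‖ ≤ B ∧ ‖φ x.imJ‖ ≤ B ∧ ‖φ x.imK‖ ≤ B := by
    intro φ
    have hφ : ∀ y, ‖φ y‖ = |(hF φ).embedding y| := by
      intro y
      rw [← NumberField.ComplexEmbedding.IsReal.coe_embedding_apply (hF φ), Complex.norm_real,
        Real.norm_eq_abs]
    set σ := (hF φ).embedding
    obtain ⟨d1, d2⟩ := hdef σ
    set μ := σ (m ^ 2 • ν)
    have d3 : 0 < σ c₁ * σ c₂ := mul_pos_of_neg_of_neg d1 d2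
    have key : ∀ {t c : ℝ}, 0 < c → c * t ^ 2 ≤ μ → |t| ≤ 1 + |μ| / c := by
      intro t c hc ht
      have h1 : t ^ 2 ≤ |μ| / c := by
        rw [le_div_iff₀ hc, mul_comm]
        exact ht.trans (le_abs_self μ)
      have h2 : |t| ^ 2 = t ^ 2 := sq_abs t
      nlinarith [sq_nonneg (|t| - 1), abs_nonneg t]
    refine ⟨1 + |μ| / 1 + |μ| / (-σ c₁) + |μ| / (-σ c₂) + |μ| / (σ c₁ * σ c₂), ?_, ?_⟩
    · have := neg_pos.2 d1
      have := neg_pos.2 d2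
      positivity
    intro x hx
    have hσ := map_nrd σ x
    rw [hx] at hσ
    have n1 := neg_pos.2 d1
    have n2 := neg_pos.2 d2
    have e0 := sq_nonneg (σ x.re)
    have e1 : 0 ≤ (-σ c₁) * σ x.imI ^ 2 := by positivity
    have e2 : 0 ≤ (-σ c₂) * σ x.imJ ^ 2 := by positivity
    have e3 : 0 ≤ (σ c₁ * σ c₂) * σ x.imK ^ 2 := by positivity
    have p0 : 0 ≤ |μ| / 1 := by positivity
    have p1 : 0 ≤ |μ| / (-σ c₁) := by positivity
    have p2 : 0 ≤ |μ| / (-σ c₂) := by positivity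
    have p3 : 0 ≤ |μ| / (σ c₁ * σ c₂) := by positivity
    simp only [hφ]
    refine ⟨(key one_pos (by simp only [μ]; linarith)).trans (by linarith),
      (key n1 (by simp only [μ]; linarith)).trans (by linarith),
      (key n2 (by simp only [μ]; linarith)).trans (by linarith),
      (key d3 (by simp only [μ]; linarith)).trans (by linarith)⟩
  choose B hB0 hB using hb
  have hfin := NumberField.Embeddings.finite_of_norm_le F ℂ (∑ φ, B φ)
  set T := {x : F | IsIntegral ℤ x ∧ ∀ φ : F →+* ℂ, ‖φ x‖ ≤ ∑ φ, B φ}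
  have hBle : ∀ φ, B φ ≤ ∑ φ, B φ := fun φ =>
    Finset.single_le_sum (fun ψ _ => hB0 ψ) (Finset.mem_univ φ)
  have hfin4 := (hfin.prod (hfin.prod (hfin.prod hfin)))
  refine Set.Finite.of_injOn (f := fun x : ℍ[F, c₁, c₂] =>
    ((m • x).re, (m • x).imI, (m • x).imJ, (m • x).imK)) ?_ ?_ hfin4
  · rintro x ⟨hx, hν⟩
    obtain ⟨e0, e1, e2, e3⟩ := h x hx
    have hb := fun φ => hB φ (m • x) (by rw [nrd_zsmul, hν])
    exact ⟨⟨e0, fun φ => (hb φ).1.trans (hBle φ)⟩, ⟨e1, fun φ => (hb φ).2.1.trans (hBle φ)⟩,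
      ⟨e2, fun φ => (hb φ).2.2.1.trans (hBle φ)⟩, ⟨e3, fun φ => (hb φ).2.2.2.trans (hBle φ)⟩⟩
  · intro x _ y _ hxy
    simp only [Prod.mk.injEq] at hxy
    obtain ⟨h0, h1, h2, h3⟩ := hxy
    have : m • x = m • y := QuaternionAlgebra.ext h0 h1 h2 h3
    rw [← Int.cast_smul_eq_zsmul F, ← Int.cast_smul_eq_zsmul F] at this
    exact smul_right_injective _ (by exact_mod_cast hm : (m : F) ≠ 0) this

end QuatAlg

end QuaternionLattices

section IdeleAction

open LatLoc

namespace QuatAlg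

/-- The invertible `O_F`-submodules of `F`. -/
abbrev FracUnits (F : Type*) [Field F] [NumberField F] : Type _ := (Submodule ↥(RI F) F)ˣ

/-- The `O_F`-submodule spanned by a single unit. -/
def pr : ℍ[F, c₁, c₂]ˣ →* (QLat c₁ c₂)ˣ :=
  Units.map
    { toFun := fun x => Submodule.span ↥(RI F) {x}
      map_one' := Submodule.one_eq_span.symm
      map_mul' := fun x y => by
        rw [Submodule.span_mul_span, Set.singleton_mul_singleton] }

theorem pr_val (x : ℍ[F, c₁, c₂]ˣ) : (pr x).1 = Submodule.span ↥(RI F) {x.1} := rfl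

theorem mem_pr_mul {x : ℍ[F, c₁, c₂]ˣ} {L : QLat c₁ c₂} {y : ℍ[F, c₁, c₂]} :
    y ∈ (pr x).1 * L ↔ ∃ z ∈ L, x * z = y := Submodule.mem_span_singleton_mul

theorem pr_mul_le_iff {x : ℍ[F, c₁, c₂]ˣ} {L L' : QLat c₁ c₂} :
    (pr x).1 * L ≤ L' ↔ ∀ y ∈ L, x * y ∈ L' := by
  constructor
  · exact fun h y hy => h (mem_pr_mul.2 ⟨y, hy, rfl⟩)
  · intro h z hz
    obtain ⟨y, hy, rfl⟩ := mem_pr_mul.1 hz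
    exact h y hy

/-- Extension of `O_F`-submodules of `F` to `D`. -/
def ext : Submodule ↥(RI F) F →+* QLat c₁ c₂ :=
  Submodule.mapHom (IsScalarTower.toAlgHom ↥(RI F) F ℍ[F, c₁, c₂])

theorem mem_ext {a : Submodule ↥(RI F) F} {x : ℍ[F, c₁, c₂]} :
    x ∈ ext a ↔ ∃ f ∈ a, algebraMap F _ f = x := Iff.rfl

theorem ext_mul_comm (a : Submodule ↥(RI F) F) (L : QLat c₁ c₂) : ext a * L = L * ext a := by
  refine Submodule.mul_comm_of_commute ?_
  rintro x hx y -
  obtain ⟨f, -, rfl⟩ := mem_ext.1 hx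
  exact Algebra.commutes f y

theorem ext_mul_le_iff {a : Submodule ↥(RI F) F} {L L' : QLat c₁ c₂} :
    ext a * L ≤ L' ↔ ∀ f ∈ a, ∀ y ∈ L, f • y ∈ L' := by
  rw [Submodule.mul_le]
  constructor
  · intro h f hf y hy
    rw [← algebraMap_mul]
    exact h _ (mem_ext.2 ⟨f, hf, rfl⟩) y hy
  · intro h x hx y hy
    obtain ⟨f, hf, rfl⟩ := mem_ext.1 hx
    rw [algebraMap_mul]
    exact h f hf y hy

/-- Extension of invertible `O_F`-submodules of `F` to `D`. -/
def extU : FracUnits F →* (QLat c₁ c₂)ˣ := Units.map ext.toMonoidHom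

theorem extU_val (a : FracUnits F) : (extU a : (QLat c₁ c₂)ˣ).1 = ext a.1 := rfl

/-- The action of `Dˣ × J` on lattices is through this homomorphism. -/
def theta : ℍ[F, c₁, c₂]ˣ × FracUnits F →* (QLat c₁ c₂)ˣ :=
  MonoidHom.noncommCoprod pr extU fun _ a => Units.ext (ext_mul_comm a.1 _).symm

theorem theta_val (γ : ℍ[F, c₁, c₂]ˣ × FracUnits F) :
    (theta γ).1 = (pr γ.1).1 * ext γ.2.1 := rfl

/-- The action of `Dˣ × J` on lattices. -/
instance latAction : MulAction (ℍ[F, c₁, c₂]ˣ × FracUnits F) (QLat c₁ c₂) :=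
  MulAction.compHom _ theta

theorem smul_lat_def (γ : ℍ[F, c₁, c₂]ˣ × FracUnits F) (L : QLat c₁ c₂) :
    γ • L = (theta γ).1 * L := rfl

/-- The class of `Dˣ × J` in `Dˣ / Fˣ`. -/
def projHom : ℍ[F, c₁, c₂]ˣ × FracUnits F →* ℍ[F, c₁, c₂]ˣ ⧸ Subgroup.center ℍ[F, c₁, c₂]ˣ :=
  (QuotientGroup.mk' _).comp (MonoidHom.fst _ _)

/-- The class of `Dˣ × J` in the Picard group. -/
def picHom : ℍ[F, c₁, c₂]ˣ × FracUnits F →* Picard (RI F) :=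
  MonoidHom.comp (QuotientGroup.mk' (principalSub (RI F))) (MonoidHom.snd _ _)

theorem picHom_surjective :
    Function.Surjective (picHom : ℍ[F, c₁, c₂]ˣ × FracUnits F →* Picard (RI F)) := by
  intro g
  obtain ⟨a, rfl⟩ := QuotientGroup.mk'_surjective _ g
  exact ⟨(1, a), rfl⟩

theorem picHom_eq_one_iff (γ : ℍ[F, c₁, c₂]ˣ × FracUnits F) :
    picHom γ = 1 ↔ ∃ f : F, f ≠ 0 ∧ γ.2.1 = Submodule.span ↥(RI F) {f} := by
  refine (QuotientGroup.eq_one_iff γ.2).trans ?_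
  constructor
  · rintro ⟨x, hx, h⟩
    exact ⟨x, hx.ne_zero, h⟩
  · rintro ⟨x, hx, h⟩
    exact ⟨x, hx.isUnit, h⟩

theorem one_eq_span_one : (1 : Submodule ↥(RI F) F) = Submodule.span ↥(RI F) {1} :=
  Submodule.one_eq_span

theorem mem_one_iff {f : F} : f ∈ (1 : Submodule ↥(RI F) F) ↔ f ∈ RI F := by
  rw [Submodule.mem_one]
  exact ⟨fun ⟨y, hy⟩ => hy ▸ y.2, fun h => ⟨⟨f, h⟩, rfl⟩⟩

theorem ext_span (f : F) :
    (ext (Submodule.span ↥(RI F) {f}) : QLat c₁ c₂) =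
      Submodule.span ↥(RI F) {algebraMap F _ f} := by
  refine (Submodule.map_span _ _).trans ?_
  rw [Set.image_singleton]
  rfl

theorem eq_one_of_ext_mul_eq {L : QLat c₁ c₂} (hL : IsLat L) {c : FracUnits F}
    (h : ext c.1 * L = L) : c = 1 := by
  have key : ∀ {c : FracUnits F}, ext c.1 * L = L → c.1 ≤ 1 := fun {c} h f hf =>
    mem_one_iff.2 (mem_of_algebraMap_mul_mem hL (ext_mul_le_iff.1 h.le f hf))
  have h' : ext (c⁻¹).1 * L = L := by
    conv_lhs => rw [← h, ← mul_assoc, ← map_mul, Units.inv_mul, map_one, one_mul]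
  refine Units.ext (le_antisymm (key h) ?_)
  have := mul_le_mul' (le_refl c.1) (key h')
  rwa [Units.mul_inv, mul_one] at this

variable (hD : Anisotropic c₁ c₂)
include hD

theorem exists_of_projHom_eq_one {γ : ℍ[F, c₁, c₂]ˣ × FracUnits F} (h : projHom γ = 1) :
    ∃ f : F, algebraMap F _ f = (γ.1 : ℍ[F, c₁, c₂]) :=
  (mem_center_iff hD).1 ((QuotientGroup.eq_one_iff _).1 h)

theorem exists_theta_eq_extU {γ : ℍ[F, c₁, c₂]ˣ × FracUnits F} (h : projHom γ = 1) :
    ∃ f : F, f ≠ 0 ∧ ∃ u : FracUnits F, (u⁻¹).1 = Submodule.span ↥(RI F) {f⁻¹} ∧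
      theta γ = extU (u * γ.2) := by
  obtain ⟨f, hf⟩ := exists_of_projHom_eq_one hD h
  have hf0 : f ≠ 0 := by
    rintro rfl
    exact γ.1.ne_zero (by rw [← hf, map_zero])
  let u : FracUnits F := ⟨Submodule.span ↥(RI F) {f}, Submodule.span ↥(RI F) {f⁻¹},
    by rw [Submodule.span_mul_span, Set.singleton_mul_singleton, mul_inv_cancel₀ hf0,
        one_eq_span_one],
    by rw [Submodule.span_mul_span, Set.singleton_mul_singleton, inv_mul_cancel₀ hf0,
        one_eq_span_one]⟩
  refine ⟨f, hf0, u, rfl, Units.ext ?_⟩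
  rw [theta_val, extU_val, Units.val_mul, map_mul]
  congr 1
  rw [pr_val, ← hf]
  exact (ext_span f).symm

theorem eq_one_of_projHom_eq_one {L : QLat c₁ c₂} (hL : IsLat L)
    {γ : ℍ[F, c₁, c₂]ˣ × FracUnits F} (hπ : projHom γ = 1) (hγ : γ • L = L) :
    theta γ = 1 ∧ picHom γ = 1 := by
  obtain ⟨f, hf0, u, hu, hth⟩ := exists_theta_eq_extU hD hπ
  have h1 : u * γ.2 = 1 := eq_one_of_ext_mul_eq hL (by
    rw [← extU_val, ← hth]
    exact hγ)
  refine ⟨by rw [hth, h1, map_one], (picHom_eq_one_iff γ).2 ⟨f⁻¹, inv_ne_zero hf0, ?_⟩⟩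
  rw [eq_inv_of_mul_eq_one_right h1]
  exact hu

omit hD in
theorem sq_mul_nrd_le {L : QLat c₁ c₂} (hL : IsLat L) {γ : ℍ[F, c₁, c₂]ˣ × FracUnits F}
    (hγ : γ • L = L) :
    γ.2.1 * γ.2.1 * Submodule.span ↥(RI F) {quatNrd (γ.1 : ℍ[F, c₁, c₂])} ≤ 1 := by
  have key : ∀ f ∈ γ.2.1, f ^ 2 * quatNrd (γ.1 : ℍ[F, c₁, c₂]) ∈ RI F := by
    intro f hf
    rw [← nrd_smul]
    refine nrd_mem hL fun y hy => ?_
    rw [← hγ, smul_lat_def, theta_val, ← mul_algebraMap]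
    exact Submodule.mul_mem_mul (Submodule.mul_mem_mul (Submodule.mem_span_singleton_self _)
      (mem_ext.2 ⟨f, hf, rfl⟩)) hy
  rw [mul_comm]
  intro w hw
  obtain ⟨z, hz, rfl⟩ := Submodule.mem_span_singleton_mul.1 hw
  rw [mem_one_iff]
  refine Submodule.mul_induction_on hz (fun f hf g hg => ?_) fun x y hx hy => ?_
  · refine IsIntegral.of_pow two_pos ?_
    have := mul_mem (key f hf) (key g hg)
    rwa [show (quatNrd (γ.1 : ℍ[F, c₁, c₂]) * (f * g)) ^ 2 =
      (f ^ 2 * quatNrd (γ.1 : ℍ[F, c₁, c₂])) * (g ^ 2 * quatNrd (γ.1 : ℍ[F, c₁, c₂])) by ring]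
  · rw [mul_add]
    exact add_mem hx hy

omit hD in
theorem picHom_sq_eq_one {L : QLat c₁ c₂} (hL : IsLat L) {γ : ℍ[F, c₁, c₂]ˣ × FracUnits F}
    (hγ : γ • L = L) : picHom γ ^ 2 = 1 := by
  have hγ' : γ⁻¹ • L = L := by rw [inv_smul_eq_iff, hγ]
  have h1 := sq_mul_nrd_le hL hγ
  have h2 := sq_mul_nrd_le hL hγ'
  have hν := nrd_unit_ne_zero γ.1
  rw [← map_pow, picHom_eq_one_iff]
  refine ⟨(quatNrd (γ.1 : ℍ[F, c₁, c₂]))⁻¹, inv_ne_zero hν, ?_⟩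
  have e : ∀ {f : F}, f ≠ 0 → Submodule.span ↥(RI F) {f} * Submodule.span ↥(RI F) {f⁻¹} = 1 := by
    intro f hf
    rw [Submodule.span_mul_span, Set.singleton_mul_singleton, mul_inv_cancel₀ hf, one_eq_span_one]
  rw [Prod.pow_snd, Units.val_pow_eq_pow_val, pow_two]
  refine le_antisymm ?_ ?_
  · have := mul_le_mul' h1
      (le_refl (Submodule.span ↥(RI F) {(quatNrd (γ.1 : ℍ[F, c₁, c₂]))⁻¹}))
    rwa [mul_assoc, e hν, mul_one, one_mul] at this
  · have := mul_le_mul' (le_refl (γ.2.1 * γ.2.1)) h2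
    rw [Prod.fst_inv, Prod.snd_inv, nrd_inv, mul_one] at this
    calc Submodule.span ↥(RI F) {(quatNrd (γ.1 : ℍ[F, c₁, c₂]))⁻¹}
        = γ.2.1 * γ.2.1 * ((γ.2⁻¹).1 * (γ.2⁻¹).1 *
          Submodule.span ↥(RI F) {(quatNrd (γ.1 : ℍ[F, c₁, c₂]))⁻¹}) := by
          rw [← mul_assoc, ← Units.val_mul, ← Units.val_mul, ← Units.val_mul]
          simp
      _ ≤ _ := this

theorem mem_center_of_commute {x : ℍ[F, c₁, c₂]ˣ}
    (hi : (x : ℍ[F, c₁, c₂]) * ⟨0, 1, 0, 0⟩ = ⟨0, 1, 0, 0⟩ * x)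
    (hj : (x : ℍ[F, c₁, c₂]) * ⟨0, 0, 1, 0⟩ = ⟨0, 0, 1, 0⟩ * x) :
    x ∈ Subgroup.center ℍ[F, c₁, c₂]ˣ := by
  rw [mem_center_iff hD, mem_range_algebraMap_iff]
  have n1 := c₁_ne_zero hD
  have n2 := c₂_ne_zero hD
  have h1 := congrArg QuaternionAlgebra.imK hi
  have h2 := congrArg QuaternionAlgebra.imJ hi
  have h3 := congrArg QuaternionAlgebra.imK hj
  simp at h1 h2 h3
  refine ⟨?_, ?_, ?_⟩
  · linear_combination (1 / 2 : F) * h3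
  · linear_combination (-1 / 2 : F) * h1
  · have : c₁ * x.1.imK = 0 := by linear_combination (-1 / 2 : F) * h2
    exact (mul_eq_zero.1 this).resolve_left n1

theorem finite_map_stabilizer (hF : TotReal F) (hdef : TotallyDefinite c₁ c₂) {L : QLat c₁ c₂}
    (hL : IsLat L) :
    Finite ((MulAction.stabilizer (ℍ[F, c₁, c₂]ˣ × FracUnits F) L).map projHom) := by
  have hord : ∀ y : ℍ[F, c₁, c₂], ∃ m : ℤ, m ≠ 0 ∧ ∀ z ∈ L, (m • y) * z ∈ L := by
    intro y
    obtain ⟨m, hm, h⟩ := hL.exists_smul_mem ((Submodule.fg_span_singleton y).mul hL.fg)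
    refine ⟨m, hm, fun z hz => ?_⟩
    rw [smul_mul_assoc]
    exact h _ (Submodule.mul_mem_mul (Submodule.mem_span_singleton_self y) hz)
  obtain ⟨n, hn, hn1⟩ := hL.full 1
  have hconj : ∀ γ ∈ MulAction.stabilizer (ℍ[F, c₁, c₂]ˣ × FracUnits F) L, ∀ y : ℍ[F, c₁, c₂],
      (∀ z ∈ L, y * z ∈ L) → n • ((γ.1 : ℍ[F, c₁, c₂]) * y * (γ.1⁻¹ : ℍ[F, c₁, c₂]ˣ)) ∈ L := by
    intro γ hγ y hy
    have hγ : γ • L = L := hγ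
    rw [smul_lat_def, theta_val] at hγ
    suffices h :
        Submodule.span ↥(RI F) {(γ.1 : ℍ[F, c₁, c₂]) * y * (γ.1⁻¹ : ℍ[F, c₁, c₂]ˣ)} * L ≤ L by
      rw [← mul_one (_ * _), ← mul_smul_comm]
      exact h (Submodule.mul_mem_mul (Submodule.mem_span_singleton_self _) hn1)
    have h1 : Submodule.span ↥(RI F) {y} * L ≤ L := by
      intro z hz
      obtain ⟨w, hw, rfl⟩ := Submodule.mem_span_singleton_mul.1 hz
      exact hy w hw
    have h2 : Submodule.span ↥(RI F) {(γ.1 : ℍ[F, c₁, c₂]) * y * (γ.1⁻¹ : ℍ[F, c₁, c₂]ˣ)} =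
        (pr γ.1).1 * Submodule.span ↥(RI F) {y} * ((pr γ.1)⁻¹).1 := by
      rw [← map_inv, pr_val, pr_val, Submodule.span_mul_span, Submodule.span_mul_span,
        Set.singleton_mul_singleton, Set.singleton_mul_singleton]
    calc _ = (pr γ.1).1 * Submodule.span ↥(RI F) {y} * ((pr γ.1)⁻¹).1 *
          ((pr γ.1).1 * ext γ.2.1 * L) := by rw [h2, hγ]
      _ = (pr γ.1).1 * (Submodule.span ↥(RI F) {y} * ext γ.2.1) * L := by
          simp only [mul_assoc]
          rw [Units.inv_mul_cancel_left]
      _ = (pr γ.1).1 * ext γ.2.1 * (Submodule.span ↥(RI F) {y} * L) := by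
          rw [← ext_mul_comm]
          simp only [mul_assoc]
      _ ≤ (pr γ.1).1 * ext γ.2.1 * L := mul_le_mul' le_rfl h1
      _ = L := hγ
  obtain ⟨m₁, hm₁, h₁⟩ := hord ⟨0, 1, 0, 0⟩
  obtain ⟨m₂, hm₂, h₂⟩ := hord ⟨0, 0, 1, 0⟩
  set y₁ : ℍ[F, c₁, c₂] := m₁ • ⟨0, 1, 0, 0⟩ with hy₁
  set y₂ : ℍ[F, c₁, c₂] := m₂ • ⟨0, 0, 1, 0⟩ with hy₂
  have hf₁ := (finite_nrd_eq hF hdef hL.fg (n ^ 2 • quatNrd y₁)).to_subtype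
  have hf₂ := (finite_nrd_eq hF hdef hL.fg (n ^ 2 • quatNrd y₂)).to_subtype
  have hrep : ∀ q : (MulAction.stabilizer (ℍ[F, c₁, c₂]ˣ × FracUnits F) L).map projHom,
      ∃ γ ∈ MulAction.stabilizer (ℍ[F, c₁, c₂]ˣ × FracUnits F) L, projHom γ = q.1 := fun q => q.2
  choose g hg hgq using hrep
  have hnrd : ∀ (x : ℍ[F, c₁, c₂]ˣ) (y : ℍ[F, c₁, c₂]),
      quatNrd (n • ((x : ℍ[F, c₁, c₂]) * y * ((x⁻¹ : ℍ[F, c₁, c₂]ˣ) : ℍ[F, c₁, c₂]))) =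
        n ^ 2 • quatNrd y := by
    intro x y
    have := nrd_unit_ne_zero x
    rw [nrd_zsmul, nrd_mul, nrd_mul, nrd_inv]
    field_simp
  have hinj : ∀ (x x' : ℍ[F, c₁, c₂]ˣ) (y : ℍ[F, c₁, c₂]) (m : ℤ), m ≠ 0 →
      n • ((x : ℍ[F, c₁, c₂]) * (m • y) * (x⁻¹ : ℍ[F, c₁, c₂]ˣ)) =
        n • ((x' : ℍ[F, c₁, c₂]) * (m • y) * (x'⁻¹ : ℍ[F, c₁, c₂]ˣ)) →
      ((x'⁻¹ * x : ℍ[F, c₁, c₂]ˣ) : ℍ[F, c₁, c₂]) * y = y * (x'⁻¹ * x : ℍ[F, c₁, c₂]ˣ) := by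
    intro x x' y m hm h
    have hz : ∀ {k : ℤ} {a b : ℍ[F, c₁, c₂]}, k ≠ 0 → k • a = k • b → a = b := by
      intro k a b hk hab
      rw [← Int.cast_smul_eq_zsmul F, ← Int.cast_smul_eq_zsmul F] at hab
      exact smul_right_injective _ (by exact_mod_cast hk : (k : F) ≠ 0) hab
    have h := hz hn h
    rw [mul_smul_comm, mul_smul_comm, smul_mul_assoc, smul_mul_assoc] at h
    have h := hz hm h
    rw [Units.val_mul, ← Units.mul_right_inj x', ← Units.mul_left_inj x⁻¹]
    simp only [mul_assoc, Units.mul_inv, Units.mul_inv_cancel_left, mul_one] at h ⊢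
    exact h
  refine Finite.of_injective (β := {x : ℍ[F, c₁, c₂] | x ∈ L ∧ quatNrd x = n ^ 2 • quatNrd y₁} ×
    {x : ℍ[F, c₁, c₂] | x ∈ L ∧ quatNrd x = n ^ 2 • quatNrd y₂}) (fun q =>
      (⟨n • (((g q).1 : ℍ[F, c₁, c₂]) * y₁ * ((g q).1⁻¹ : ℍ[F, c₁, c₂]ˣ)),
        hconj _ (hg q) _ h₁, hnrd _ _⟩,
      ⟨n • (((g q).1 : ℍ[F, c₁, c₂]) * y₂ * ((g q).1⁻¹ : ℍ[F, c₁, c₂]ˣ)),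
        hconj _ (hg q) _ h₂, hnrd _ _⟩)) ?_
  intro q q' h
  simp only [Prod.mk.injEq, Subtype.mk.injEq] at h
  have hc := mem_center_of_commute hD (hinj _ _ _ _ hm₁ h.1) (hinj _ _ _ _ hm₂ h.2)
  refine Subtype.ext ?_
  rw [← hgq q, ← hgq q', eq_comm]
  exact QuotientGroup.eq.2 hc

theorem quadraticOn_stabilizer (hF : TotReal F) (hdef : TotallyDefinite c₁ c₂) {L : QLat c₁ c₂}
    (hL : IsLat L) :
    QuadraticOn projHom picHom (MulAction.stabilizer (ℍ[F, c₁, c₂]ˣ × FracUnits F) L) where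
  finite_map := finite_map_stabilizer hD hF hdef hL
  sq_eq_one _ hγ := picHom_sq_eq_one hL hγ
  eq_one _ hγ hπ := (eq_one_of_projHom_eq_one hD hL hπ hγ).2

end QuatAlg

end IdeleAction

section LocallyPrincipal

namespace LatLoc

/-- Nakayama's lemma for localizations of lattices. -/
theorem le_loc_of_forall_exists {A D : Type*} [CommRing A] [Ring D] [Algebra A D]
    [Module.Finite ℤ A] {p : ℤ} {X Y : Submodule A D} (hX : X.FG)
    (h : ∀ x ∈ X, ∃ y ∈ Y, ∃ z ∈ X, x = y + p • z) : X ≤ loc (primeTo p) Y := by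
  have hX' : (X.restrictScalars ℤ).FG := Submodule.FG.restrictScalars_iff.2 hX
  obtain ⟨r, hr, hle⟩ :=
    Submodule.exists_sub_one_mem_and_smul_le_of_fg_of_le_sup
    (I := Ideal.span {p}) (N := Y.restrictScalars ℤ) hX' le_rfl (by
      intro x hx
      obtain ⟨y, hy, z, hz, rfl⟩ := h x hx
      exact Submodule.add_mem_sup hy
        (Submodule.smul_mem_smul (Ideal.mem_span_singleton_self p) hz))
  intro x hx
  refine ⟨r, ?_, hle (Submodule.smul_mem_pointwise_smul x r _ hx)⟩
  obtain ⟨k, hk⟩ := Ideal.mem_span_singleton.1 hr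
  exact ⟨1, -k, by linear_combination hk⟩

end LatLoc

open LatLoc

namespace QuatAlg

theorem exists_loc_eq_span (a : FracUnits F) (p : ℕ) (hp : p.Prime) :
    ∃ f : F, f ≠ 0 ∧ loc (primeTo p) a.1 = loc (primeTo p) (Submodule.span ↥(RI F) {f}) := by
  have hfg : a.1.FG := Submodule.fg_unit a
  obtain ⟨d, hd, h⟩ := exists_smul_mem_of_fg (M := nonZeroDivisors ℤ)
    (Y := (1 : Submodule ↥(RI F) F)) hfg fun f _ => by
      obtain ⟨n, hn, h⟩ := RI.exists_zsmul_mem f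
      exact ⟨n, mem_nonZeroDivisors_of_ne_zero hn, mem_one_iff.2 h⟩
  have hd0 : (d : F) ≠ 0 := Int.cast_ne_zero.2 (nonZeroDivisors.ne_zero hd)
  let I : Ideal ↥(RI F) := a.1.comap (LinearMap.toSpanSingleton ↥(RI F) F (d : F)⁻¹)
  have hI : ∀ r : ↥(RI F), r ∈ I ↔ (r : F) * (d : F)⁻¹ ∈ a.1 := fun r => Iff.rfl
  have hlift : ∀ f ∈ a.1, ∃ r ∈ I, (r : F) * (d : F)⁻¹ = f := by
    intro f hf
    have h1 := mem_one_iff.1 (h f hf)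
    have h2 : (d • f) * (d : F)⁻¹ = f := by
      rw [← Int.cast_smul_eq_zsmul F, smul_eq_mul]
      field_simp
    exact ⟨⟨_, h1⟩, (hI _).2 (by rw [h2]; exact hf), h2⟩
  have hp0 : (p : F) ≠ 0 := Nat.cast_ne_zero.2 hp.ne_zero
  have ha : a.1 ≠ ⊥ := a.ne_zero
  obtain ⟨g, hg, hg0⟩ := Submodule.exists_mem_ne_zero_of_ne_bot ha
  obtain ⟨z, hz, hzg⟩ := hlift g hg
  have hz0 : z ≠ 0 := by
    rintro rfl
    exact hg0 (by rw [← hzg]; simp)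
  have hpz : (p : ↥(RI F)) * z ≠ 0 := mul_ne_zero (Nat.cast_ne_zero.2 hp.ne_zero) hz0
  obtain ⟨y, hy⟩ := IsDedekindDomain.exists_eq_span_pair (I.mul_mem_left (p : ↥(RI F)) hz) hpz
  have hle : a.1 ≤ loc (primeTo p) (Submodule.span ↥(RI F) {(y : F) * (d : F)⁻¹}) := by
    refine le_loc_of_forall_exists hfg fun f hf => ?_
    obtain ⟨r, hr, rfl⟩ := hlift f hf
    rw [hy] at hr
    obtain ⟨s, t, rfl⟩ := Ideal.mem_span_pair.1 hr
    refine ⟨_, Submodule.smul_mem _ t (Submodule.mem_span_singleton_self _), _,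
      a.1.smul_mem s ((hI z).1 hz), ?_⟩
    rw [← Int.cast_smul_eq_zsmul F]
    simp only [Algebra.smul_def, Subalgebra.algebraMap_def, Algebra.algebraMap_self,
      RingHom.id_apply]
    push_cast
    ring
  refine ⟨_, ?_, le_antisymm (loc_le_iff.2 hle) (loc_mono ?_)⟩
  · intro h0
    obtain ⟨n, hn, h1⟩ := hle hg
    rw [h0, Submodule.span_zero_singleton, Submodule.mem_bot, ← Int.cast_smul_eq_zsmul F,
      smul_eq_mul, mul_eq_zero, Int.cast_eq_zero] at h1
    refine hg0 (h1.resolve_left ?_)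
    rintro rfl
    exact (mem_primeTo_iff hp).1 hn (dvd_zero _)
  · rw [Submodule.span_singleton_le_iff_mem]
    exact (hI y).1 (by rw [hy]; exact Ideal.subset_span (by simp))

theorem loc_ext_congr {M : Submonoid ℤ} {a b : Submodule ↥(RI F) F} (h : loc M a = loc M b) :
    loc M (ext a : QLat c₁ c₂) = loc M (ext b) := by
  have key : ∀ {a b : Submodule ↥(RI F) F}, loc M a = loc M b →
      (ext a : QLat c₁ c₂) ≤ loc M (ext b) := by
    intro a b h x hx
    obtain ⟨f, hf, rfl⟩ := mem_ext.1 hx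
    obtain ⟨n, hn, h1⟩ := h.le (le_loc a hf)
    exact ⟨n, hn, mem_ext.2 ⟨_, h1, map_zsmul _ _ _⟩⟩
  exact loc_eq_iff.2 ⟨key h, key h.symm⟩

/-- A nonzero scalar as a unit of `D`. -/
def scal (f : F) (hf : f ≠ 0) : ℍ[F, c₁, c₂]ˣ :=
  Units.map (algebraMap F ℍ[F, c₁, c₂]).toMonoidHom (Units.mk0 f hf)

omit [NumberField F] in
theorem scal_val (f : F) (hf : f ≠ 0) : (scal f hf : ℍ[F, c₁, c₂]ˣ).1 = algebraMap F _ f := rfl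

theorem pr_scal (f : F) (hf : f ≠ 0) :
    (pr (scal f hf)).1 = (ext (Submodule.span ↥(RI F) {f}) : QLat c₁ c₂) := by
  rw [ext_span, pr_val, scal_val]

/-- `L` is a lattice which is locally of the form `x B` at every prime. -/
def LocPrin (B L : QLat c₁ c₂) : Prop :=
  IsLat L ∧ ∀ p : ℕ, p.Prime → ∃ x : ℍ[F, c₁, c₂]ˣ,
    loc (primeTo p) L = loc (primeTo p) ((pr x).1 * B)

theorem LocPrin.smul {B L : QLat c₁ c₂} (h : LocPrin B L) (γ : ℍ[F, c₁, c₂]ˣ × FracUnits F) :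
    LocPrin B (γ • L) := by
  refine ⟨h.1.unit_mul _, fun p hp => ?_⟩
  obtain ⟨x, hx⟩ := h.2 p hp
  obtain ⟨f, hf, hf'⟩ := exists_loc_eq_span γ.2 p hp
  refine ⟨γ.1 * scal f hf * x, ?_⟩
  rw [smul_lat_def, theta_val, map_mul, map_mul, Units.val_mul, Units.val_mul, mul_assoc,
    mul_assoc, mul_assoc]
  refine loc_mul_congr rfl (loc_mul_congr ?_ hx)
  rw [pr_scal]
  exact loc_ext_congr hf'

theorem LocPrin.mul_right {B L : QLat c₁ c₂} (h : LocPrin B L) {R : QLat c₁ c₂}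
    (hR : B * R = R) (hRL : IsLat R) : LocPrin R (L * R) := by
  have hfg : (L * R).FG := h.1.fg.mul hRL.fg
  obtain ⟨n, hn, hn'⟩ := h.1.full 1
  refine ⟨hRL.of_smul_le hfg hn fun x hx => ?_, fun p hp => ?_⟩
  · have := Submodule.mul_mem_mul hn' hx
    rwa [smul_one_mul] at this
  · obtain ⟨x, hx⟩ := h.2 p hp
    refine ⟨x, ?_⟩
    rw [loc_mul_congr hx rfl, mul_assoc, hR]

end QuatAlg

end LocallyPrincipal

section ClassSet

open LatLoc

namespace QuatAlg

theorem span_rat_eq_top_iff {V : Type*} [AddCommGroup V] [Module ℚ V] (I : Submodule ℤ V) :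
    Submodule.span ℚ (I : Set V) = ⊤ ↔ ∀ d : V, ∃ n : ℤ, n ≠ 0 ∧ n • d ∈ I := by
  constructor
  · intro h d
    have hd : d ∈ Submodule.span ℚ (I : Set V) := h ▸ Submodule.mem_top
    induction hd using Submodule.span_induction with
    | mem x hx => exact ⟨1, one_ne_zero, by simpa using hx⟩
    | zero => exact ⟨1, one_ne_zero, by simp⟩
    | add x y _ _ hx hy =>
      obtain ⟨m, hm, hx⟩ := hx
      obtain ⟨n, hn, hy⟩ := hy
      refine ⟨m * n, mul_ne_zero hm hn, ?_⟩
      rw [smul_add]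
      refine add_mem ?_ ?_
      · rw [mul_comm, mul_smul]
        exact I.smul_mem _ hx
      · rw [mul_smul]
        exact I.smul_mem _ hy
    | smul q x _ hx =>
      obtain ⟨m, hm, hx⟩ := hx
      refine ⟨q.den * m, mul_ne_zero (Int.natCast_ne_zero.2 q.den_ne_zero) hm, ?_⟩
      have h1 : ((q.den : ℤ) * m) • q • x = q.num • m • x := by
        rw [← Int.cast_smul_eq_zsmul ℚ, ← Int.cast_smul_eq_zsmul ℚ, ← Int.cast_smul_eq_zsmul ℚ,
          smul_smul, smul_smul]
        congr 1
        push_cast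
        rw [mul_right_comm, Rat.den_mul_eq_num]
      rw [h1]
      exact I.smul_mem _ hx
  · intro h
    refine eq_top_iff.2 fun d _ => ?_
    obtain ⟨n, hn, hd⟩ := h d
    have h1 : d = (n : ℚ)⁻¹ • (n • d) := by
      rw [← Int.cast_smul_eq_zsmul ℚ, smul_smul, inv_mul_cancel₀ (Int.cast_ne_zero.2 hn), one_smul]
    rw [h1]
    exact Submodule.smul_mem _ _ (Submodule.subset_span hd)

theorem isLat_iff (L : QLat c₁ c₂) : IsLat L ↔ (L.restrictScalars ℤ).FG ∧
    Submodule.span ℚ ((L.restrictScalars ℤ : Submodule ℤ ℍ[F, c₁, c₂]) : Set ℍ[F, c₁, c₂]) = ⊤ := by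
  rw [span_rat_eq_top_iff, Submodule.FG.restrictScalars_iff]
  exact ⟨fun h => ⟨h.1, h.2⟩, fun h => ⟨h.1, h.2⟩⟩

variable (O : Subalgebra ℤ ℍ[F, c₁, c₂])
  (hA : ∀ f ∈ RI F, algebraMap F ℍ[F, c₁, c₂] f ∈ O)

/-- An order containing `O_F`, as an `O_F`-lattice. -/
def orderLat : QLat c₁ c₂ where
  carrier := O
  zero_mem' := O.zero_mem
  add_mem' := O.add_mem
  smul_mem' := fun a x hx => by
    have h : a • x = algebraMap F _ (a : F) * x := by rw [algebraMap_mul, RI.smul_def]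
    rw [h]
    exact O.mul_mem (hA a a.2) hx

theorem orderLat_mul_self : orderLat O hA * orderLat O hA = orderLat O hA := by
  refine le_antisymm (Submodule.mul_le.2 fun x hx y hy => O.mul_mem hx hy) fun x hx => ?_
  have := Submodule.mul_mem_mul (show (1 : ℍ[F, c₁, c₂]) ∈ orderLat O hA from O.one_mem) hx
  rwa [one_mul] at this

/-- The locally principal lattices, with the action of `Dˣ × J`. -/
def locPrinSet (B : QLat c₁ c₂) :
    SubMulAction (ℍ[F, c₁, c₂]ˣ × FracUnits F) (QLat c₁ c₂) where
  carrier := {L | LocPrin B L}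
  smul_mem' := fun γ _ h => h.smul γ

theorem locAt_eq_iff {p : ℕ} (hp : p.Prime) (L : QLat c₁ c₂) (x : ℍ[F, c₁, c₂]ˣ) :
    locAt p (L : Set ℍ[F, c₁, c₂]) = locAt p ((fun y => (x : ℍ[F, c₁, c₂]) * y) '' O) ↔
      loc (primeTo p) L = loc (primeTo p) ((pr x).1 * orderLat O hA) := by
  have h1 : locAt p (L : Set ℍ[F, c₁, c₂]) = (loc (primeTo p) L : Set ℍ[F, c₁, c₂]) := by
    ext z
    exact exists_congr fun n => and_congr_left fun _ => (mem_primeTo_iff hp).symm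
  have h2 : locAt p ((fun y => (x : ℍ[F, c₁, c₂]) * y) '' O) =
      (loc (primeTo p) ((pr x).1 * orderLat O hA) : Set ℍ[F, c₁, c₂]) := by
    ext z
    exact exists_congr fun n => and_congr (mem_primeTo_iff hp).symm
      (mem_pr_mul (x := x) (L := orderLat O hA)).symm
  rw [h1, h2]
  exact SetLike.coe_set_eq

theorem LocPrin.mul_mem {L : QLat c₁ c₂} {B : QLat c₁ c₂} (hB : B * B = B) (h : LocPrin B L) :
    L * B ≤ L := by
  refine le_of_forall_prime fun p hp => ?_
  obtain ⟨x, hx⟩ := h.2 p hp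
  rw [← loc_le_iff, loc_mul_congr hx rfl, mul_assoc, hB, hx]

/-- Locally principal right ideals of an order are the locally principal lattices. -/
def lpIdealsEquiv : LPIdeals O ≃ locPrinSet (orderLat O hA) where
  toFun I := ⟨{ I.1 with
      smul_mem' := fun a x hx => by
        have h : a • x = x * algebraMap F _ (a : F) := by rw [mul_algebraMap, RI.smul_def]
        rw [h]
        exact I.2.2.2.1 x hx _ (hA a a.2) },
    (isLat_iff _).2 ⟨I.2.1, I.2.2.1⟩, fun p hp => by
      obtain ⟨x, hx⟩ := I.2.2.2.2 p hp
      exact ⟨x, (locAt_eq_iff O hA hp _ x).1 hx⟩⟩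
  invFun L := ⟨L.1.restrictScalars ℤ, ((isLat_iff _).1 L.2.1).1, ((isLat_iff _).1 L.2.1).2,
    fun x hx r hr => L.2.mul_mem (orderLat_mul_self O hA) (Submodule.mul_mem_mul hx hr),
    fun p hp => by
      obtain ⟨x, hx⟩ := L.2.2 p hp
      exact ⟨x, (locAt_eq_iff O hA hp _ x).2 hx⟩⟩
  left_inv _ := rfl
  right_inv _ := rfl

theorem theta_of_picHom_eq_one {γ : ℍ[F, c₁, c₂]ˣ × FracUnits F} (h : picHom γ = 1) :
    ∃ x : ℍ[F, c₁, c₂]ˣ, (theta γ).1 = (pr x).1 := by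
  obtain ⟨f, hf, h⟩ := (picHom_eq_one_iff γ).1 h
  exact ⟨γ.1 * scal f hf, by rw [theta_val, h, map_mul, Units.val_mul, pr_scal]⟩

theorem hCl_eq : hCl O = Nat.card (MulAction.orbitRel.Quotient
    (picHom : ℍ[F, c₁, c₂]ˣ × FracUnits F →* Picard (RI F)).ker (locPrinSet (orderLat O hA))) := by
  refine Nat.card_congr (Quot.congr (lpIdealsEquiv O hA) fun I J => ?_)
  have key : ∀ x : ℍ[F, c₁, c₂]ˣ, I.1 = lmul x J.1 ↔
      (lpIdealsEquiv O hA I).1 = (pr x).1 * (lpIdealsEquiv O hA J).1 := by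
    intro x
    have h2 : (lmul x J.1 : Set ℍ[F, c₁, c₂]) =
        ((pr x).1 * (lpIdealsEquiv O hA J).1 : QLat c₁ c₂) := by
      ext z
      exact (mem_pr_mul (x := x) (L := (lpIdealsEquiv O hA J).1)).symm
    refine SetLike.coe_set_eq.symm.trans ?_
    rw [h2]
    exact SetLike.coe_set_eq (p := (lpIdealsEquiv O hA I).1)
  refine Iff.trans ?_ MulAction.orbitRel_apply.symm
  constructor
  · rintro ⟨x, hx⟩
    refine ⟨⟨(x, 1), MonoidHom.mem_ker.2 ((picHom_eq_one_iff _).2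
      ⟨1, one_ne_zero, one_eq_span_one⟩)⟩, Subtype.ext ?_⟩
    refine Eq.trans ?_ ((key x).1 hx).symm
    refine (congrArg (· * (lpIdealsEquiv O hA J).1) (theta_val _)).trans ?_
    change (pr x).1 * ext 1 * _ = _
    rw [map_one, mul_one]
  · rintro ⟨⟨γ, hγ⟩, h⟩
    obtain ⟨x, hx⟩ := theta_of_picHom_eq_one (MonoidHom.mem_ker.1 hγ)
    refine ⟨x, (key x).2 ?_⟩
    rw [← hx]
    exact (congrArg Subtype.val h).symm

end QuatAlg

end ClassSet

section MaximalOrders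

open LatLoc

namespace QuatAlg

theorem stdLat_fg : (stdLat c₁ c₂).FG := by
  refine Submodule.fg_def.2 ⟨{⟨1, 0, 0, 0⟩, ⟨0, 1, 0, 0⟩, ⟨0, 0, 1, 0⟩, ⟨0, 0, 0, 1⟩},
    Set.toFinite _, ?_⟩
  refine le_antisymm (Submodule.span_le.2 ?_) ?_
  · have h0 : (0 : F) ∈ RI F := zero_mem _
    have h1 : (1 : F) ∈ RI F := one_mem _
    intro x hx
    simp only [Set.mem_insert_iff, Set.mem_singleton_iff] at hx
    rcases hx with rfl | rfl | rfl | rfl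
    exacts [⟨h1, h0, h0, h0⟩, ⟨h0, h1, h0, h0⟩, ⟨h0, h0, h1, h0⟩, ⟨h0, h0, h0, h1⟩]
  · rintro x ⟨h1, h2, h3, h4⟩
    have h : x = (⟨x.re, h1⟩ : ↥(RI F)) • (⟨1, 0, 0, 0⟩ : ℍ[F, c₁, c₂])
        + (⟨x.imI, h2⟩ : ↥(RI F)) • (⟨0, 1, 0, 0⟩ : ℍ[F, c₁, c₂])
        + (⟨x.imJ, h3⟩ : ↥(RI F)) • (⟨0, 0, 1, 0⟩ : ℍ[F, c₁, c₂])
        + (⟨x.imK, h4⟩ : ↥(RI F)) • (⟨0, 0, 0, 1⟩ : ℍ[F, c₁, c₂]) := by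
      simp only [RI.smul_def]
      ext <;> simp
    rw [h]
    refine add_mem (add_mem (add_mem ?_ ?_) ?_) ?_ <;>
      exact Submodule.smul_mem _ _ (Submodule.subset_span (by simp))

/-- A maximal order, as an `O_F`-lattice. -/
structure IsMaxOrder (R : QLat c₁ c₂) : Prop where
  isLat : IsLat R
  one_mem : (1 : ℍ[F, c₁, c₂]) ∈ R
  mul_le : R * R ≤ R
  max : ∀ R' : QLat c₁ c₂, R ≤ R' → R'.FG → R' * R' ≤ R' → R' ≤ R

theorem exists_bound_of_isLat (hD : Anisotropic c₁ c₂) {B : QLat c₁ c₂} (hB : IsLat B) :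
    ∃ C : QLat c₁ c₂, C.FG ∧ ∀ x, (∀ b ∈ B, trd (x * b) ∈ RI F) → x ∈ C := by
  have h1 := c₁_ne_zero hD
  have h2 := c₂_ne_zero hD
  obtain ⟨n, hn, h⟩ := hB.exists_smul_mem (stdLat_fg (c₁ := c₁) (c₂ := c₂))
  obtain ⟨m₁, hm₁, hm₁', hm₁''⟩ := RI.exists_zsmul_mem₂ c₁⁻¹ c₂⁻¹
  obtain ⟨m₂, hm₂, hm₂'⟩ := RI.exists_zsmul_mem (c₁⁻¹ * c₂⁻¹)
  have hN : ((2 * n * m₁ * m₂ : ℤ) : F) ≠ 0 :=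
    Int.cast_ne_zero.2 (mul_ne_zero (mul_ne_zero (mul_ne_zero two_ne_zero hn) hm₁) hm₂)
  refine ⟨(pr (scal _ (inv_ne_zero hN))).1 * stdLat c₁ c₂,
    (Submodule.fg_unit _).mul stdLat_fg, fun x hx => ?_⟩
  have hz : ∀ (k : ℤ), (k : F) ∈ RI F := fun k => intCast_mem _ k
  have h0 : (0 : F) ∈ RI F := zero_mem _
  have h01 : (1 : F) ∈ RI F := one_mem _
  simp only [← Int.cast_smul_eq_zsmul F, smul_eq_mul] at hm₁' hm₁'' hm₂'
  have e1 := hx _ (h ⟨1, 0, 0, 0⟩ ⟨h01, h0, h0, h0⟩)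
  have e2 := hx _ (h ⟨0, 1, 0, 0⟩ ⟨h0, h01, h0, h0⟩)
  have e3 := hx _ (h ⟨0, 0, 1, 0⟩ ⟨h0, h0, h01, h0⟩)
  have e4 := hx _ (h ⟨0, 0, 0, 1⟩ ⟨h0, h0, h0, h01⟩)
  simp only [trd, ← Int.cast_smul_eq_zsmul F] at e1 e2 e3 e4
  simp at e1 e2 e3 e4
  refine mem_pr_mul.2 ⟨((2 * n * m₁ * m₂ : ℤ) : F) • x, ⟨?_, ?_, ?_, ?_⟩, ?_⟩
  · convert mul_mem (mul_mem (hz m₁) (hz m₂)) e1 using 1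
    simp
    ring
  · convert mul_mem (mul_mem hm₁' (hz m₂)) e2 using 1
    simp
    field_simp
    ring
  · convert mul_mem (mul_mem hm₁'' (hz m₂)) e3 using 1
    simp
    field_simp
    ring
  · convert mul_mem (mul_mem (neg_mem (hz m₁)) hm₂') e4 using 1
    simp
    field_simp
    ring
  · rw [scal_val, algebraMap_mul, smul_smul, inv_mul_cancel₀ hN, one_smul]

theorem exists_isMaxOrder (hD : Anisotropic c₁ c₂) {B : QLat c₁ c₂} (hB : IsLat B)
    (h1 : (1 : ℍ[F, c₁, c₂]) ∈ B) (hm : B * B ≤ B) : ∃ R : QLat c₁ c₂, B ≤ R ∧ IsMaxOrder R := by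
  obtain ⟨C, hC, hCB⟩ := exists_bound_of_isLat hD hB
  have hle : ∀ R : QLat c₁ c₂, B ≤ R → R.FG → R * R ≤ R → R ≤ C := fun R hR hfg hRR x hx =>
    hCB x fun b hb => trd_mem (hB.of_le hfg hR) fun y hy =>
      hRR (Submodule.mul_mem_mul (hRR (Submodule.mul_mem_mul hx (hR hb))) hy)
  have hN : IsNoetherian ↥(RI F) C := isNoetherian_of_fg_of_noetherian C hC
  obtain ⟨X, ⟨hX1, hX2⟩, hX3⟩ := set_has_maximal_iff_noetherian.2 hN
    {X : Submodule ↥(RI F) C | B ≤ X.map C.subtype ∧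
      X.map C.subtype * X.map C.subtype ≤ X.map C.subtype}
    ⟨B.comap C.subtype, by
      have : (B.comap C.subtype).map C.subtype = B := by
        rw [Submodule.map_comap_subtype]
        exact inf_eq_right.2 (hle B le_rfl hB.fg hm)
      simp only [Set.mem_ofPred_eq]
      rw [this]
      exact ⟨le_rfl, hm⟩⟩
  have hXfg : (X.map C.subtype).FG := (IsNoetherian.noetherian X).map _
  refine ⟨X.map C.subtype, hX1, hB.of_le hXfg hX1, hX1 h1, hX2, fun R' h hfg hR' => ?_⟩
  have hR'C := hle R' (hX1.trans h) hfg hR'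
  have e : (R'.comap C.subtype).map C.subtype = R' := by
    rw [Submodule.map_comap_subtype]
    exact inf_eq_right.2 hR'C
  have h3 := hX3 (R'.comap C.subtype) (by
    simp only [Set.mem_ofPred_eq]
    rw [e]
    exact ⟨hX1.trans h, hR'⟩)
  have h4 : X ≤ R'.comap C.subtype := Submodule.map_le_iff_le_comap.1 h
  have h5 : X = R'.comap C.subtype := by_contra fun hne => h3 (lt_of_le_of_ne h4 hne)
  rw [h5, e]

namespace IsMaxOrder

variable {R : QLat c₁ c₂} (hR : IsMaxOrder R)

include hR

theorem mul_mem {x y : ℍ[F, c₁, c₂]} (hx : x ∈ R) (hy : y ∈ R) : x * y ∈ R :=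
  hR.mul_le (Submodule.mul_mem_mul hx hy)

theorem one_le : 1 ≤ R := by
  rw [Submodule.one_eq_span, Submodule.span_singleton_le_iff_mem]
  exact hR.one_mem

theorem mul_self : R * R = R :=
  le_antisymm hR.mul_le ((one_mul R).ge.trans (mul_le_mul' hR.one_le le_rfl))

theorem nrd_mem {x : ℍ[F, c₁, c₂]} (hx : x ∈ R) : quatNrd x ∈ RI F :=
  QuatAlg.nrd_mem hR.isLat fun _ hy => hR.mul_mem hx hy

theorem trd_mem {x : ℍ[F, c₁, c₂]} (hx : x ∈ R) : trd x ∈ RI F :=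
  QuatAlg.trd_mem hR.isLat fun _ hy => hR.mul_mem hx hy

theorem algebraMap_mem_iff {f : F} : algebraMap F _ f ∈ R ↔ f ∈ RI F := by
  constructor
  · exact fun h => mem_of_algebraMap_mul_mem hR.isLat fun y hy => by
      rw [← algebraMap_mul]
      exact hR.mul_mem h hy
  · intro h
    have := R.smul_mem (⟨f, h⟩ : ↥(RI F)) hR.one_mem
    rwa [RI.smul_def, ← algebraMap_mul, mul_one] at this

theorem star_mem {x : ℍ[F, c₁, c₂]} (hx : x ∈ R) : star x ∈ R := by
  rw [star_eq]
  exact sub_mem (hR.algebraMap_mem_iff.2 (hR.trd_mem hx)) hx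

/-- An integral element with integral traces against a maximal order belongs to it. -/
theorem mem_of_trd_mem {t : ℍ[F, c₁, c₂]} (hn : quatNrd t ∈ RI F)
    (ht : ∀ z ∈ R, trd (t * z) ∈ RI F) : t ∈ R := by
  set T : QLat c₁ c₂ := Submodule.span ↥(RI F) {t} with hT
  have htT : t ∈ T := Submodule.mem_span_singleton_self t
  have hTRT : T * R * T ≤ R ⊔ T := by
    rw [mul_assoc, Submodule.mul_le]
    intro x hx y hy
    obtain ⟨a, rfl⟩ := Submodule.mem_span_singleton.1 hx
    rw [smul_mul_assoc]
    refine Submodule.smul_mem _ _ ?_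
    refine Submodule.mul_induction_on hy ?_ fun u v hu hv => by
      rw [mul_add]
      exact add_mem hu hv
    intro z hz w hw
    obtain ⟨b, rfl⟩ := Submodule.mem_span_singleton.1 hw
    rw [mul_smul_comm, mul_smul_comm, ← mul_assoc, mul_mul_self]
    refine Submodule.smul_mem _ _ (sub_mem ?_ ?_)
    · exact Submodule.mem_sup_right (T.smul_mem (⟨_, ht z hz⟩ : ↥(RI F)) htT)
    · exact Submodule.mem_sup_left (R.smul_mem (⟨_, hn⟩ : ↥(RI F)) (hR.star_mem hz))
  have hTle : T ≤ R * T * R := by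
    calc T = 1 * T * 1 := by rw [one_mul, mul_one]
      _ ≤ R * T * R := mul_le_mul' (mul_le_mul' hR.one_le le_rfl) hR.one_le
  have hRR := hR.mul_self
  have key : (R ⊔ R * T * R) * (R ⊔ R * T * R) ≤ R ⊔ R * T * R := by
    rw [Submodule.sup_mul, Submodule.mul_sup, Submodule.mul_sup]
    refine sup_le (sup_le ?_ ?_) (sup_le ?_ ?_)
    · exact hRR.le.trans le_sup_left
    · rw [← mul_assoc, ← mul_assoc, hRR]
      exact le_sup_right
    · rw [mul_assoc, hRR]
      exact le_sup_right
    · calc R * T * R * (R * T * R) = R * (T * (R * R) * T) * R := by simp only [mul_assoc]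
        _ ≤ R * (R ⊔ T) * R := by
          rw [hRR]
          exact mul_le_mul' (mul_le_mul' le_rfl hTRT) le_rfl
        _ = R ⊔ R * T * R := by rw [Submodule.mul_sup, Submodule.sup_mul, hRR, hRR]
  have hTfg : T.FG := Submodule.fg_span_singleton t
  have hfg : (R ⊔ R * T * R).FG :=
    hR.isLat.fg.sup ((hR.isLat.fg.mul hTfg).mul hR.isLat.fg)
  exact hR.max _ le_sup_left hfg key ((hTle.trans le_sup_right) htT)

end IsMaxOrder

end QuatAlg

end MaximalOrders

section DyadicPrimes

open LatLoc

namespace QuatAlg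

/-- `P` is a prime of `O_F` above `2`, and `u` is `P` as an invertible fractional ideal. -/
structure IsDyadic (P : Ideal ↥(RI F)) (u : FracUnits F) : Prop where
  isMaximal : P.IsMaximal
  two_mem : 2 ∈ P
  mem_iff : ∀ f : F, f ∈ u.1 ↔ ∃ a ∈ P, (a : F) = f

theorem exists_isDyadic (F : Type*) [Field F] [NumberField F] :
    ∃ (P : Ideal ↥(RI F)) (u : FracUnits F), IsDyadic P u := by
  have h2 : Ideal.span {(2 : ↥(RI F))} ≠ ⊤ := by
    rw [Ne, Ideal.span_singleton_eq_top]
    rintro ⟨v, hv⟩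
    have h1 : (2 : F) * ((v⁻¹ : (↥(RI F))ˣ) : ↥(RI F)) = 1 := by
      have := congrArg (fun a : ↥(RI F) => (a : F)) v.mul_inv
      rw [hv] at this
      exact this
    have h3 : IsIntegral ℤ (algebraMap ℚ F (1 / 2)) := by
      have h4 : algebraMap ℚ F (1 / 2) = ((v⁻¹ : (↥(RI F))ˣ) : ↥(RI F)) := by
        rw [map_div₀, map_one, map_ofNat, div_eq_iff two_ne_zero, mul_comm]
        exact h1.symm
      rw [h4]
      exact ((v⁻¹ : (↥(RI F))ˣ) : ↥(RI F)).2
    rw [isIntegral_algebraMap_iff (algebraMap ℚ F).injective,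
      IsIntegrallyClosed.isIntegral_iff] at h3
    obtain ⟨k, hk⟩ := h3
    have h5 : ((2 * k : ℤ) : ℚ) = (1 : ℤ) := by
      push_cast
      rw [show (k : ℚ) = 1 / 2 from hk]
      norm_num
    have := Int.cast_injective h5
    omega
  obtain ⟨P, hP, hle⟩ := Ideal.exists_le_maximal _ h2
  have h2P : (2 : ↥(RI F)) ∈ P := hle (Ideal.mem_span_singleton_self _)
  have hP0 : (P : FractionalIdeal (nonZeroDivisors ↥(RI F)) F) ≠ 0 := by
    rw [FractionalIdeal.coeIdeal_ne_zero]
    rintro rfl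
    exact two_ne_zero ((Submodule.mem_bot _).1 h2P)
  refine ⟨P, Units.map (FractionalIdeal.coeSubmoduleHom (nonZeroDivisors ↥(RI F)) F).toMonoidHom
    (Units.mk0 _ hP0), hP, h2P, fun f => ?_⟩
  change f ∈ (P : FractionalIdeal (nonZeroDivisors ↥(RI F)) F) ↔ _
  exact FractionalIdeal.mem_coeIdeal (nonZeroDivisors ↥(RI F))

namespace IsDyadic

variable {P : Ideal ↥(RI F)} {u : FracUnits F} (h : IsDyadic P u)

include h

theorem coe_mem_iff (a : ↥(RI F)) : (a : F) ∈ u.1 ↔ a ∈ P := by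
  rw [h.mem_iff]
  exact ⟨fun ⟨b, hb, e⟩ => Subtype.ext e ▸ hb, fun ha => ⟨a, ha, rfl⟩⟩

theorem mem_RI {f : F} (hf : f ∈ u.1) : f ∈ RI F := by
  obtain ⟨a, -, rfl⟩ := (h.mem_iff f).1 hf
  exact a.2

theorem two_mem' : (2 : F) ∈ u.1 := (h.coe_mem_iff 2).2 h.two_mem

theorem one_notMem : (1 : F) ∉ u.1 := fun h1 =>
  h.isMaximal.ne_top ((Ideal.eq_top_iff_one P).2 ((h.coe_mem_iff 1).1 h1))

omit h in
theorem mul_mem {f g : F} (hf : f ∈ RI F) (hg : g ∈ u.1) : f * g ∈ u.1 :=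
  u.1.smul_mem (⟨f, hf⟩ : ↥(RI F)) hg

theorem exists_one_sub_mem {f : F} (hf : f ∈ RI F) (hfu : f ∉ u.1) :
    ∃ g ∈ RI F, 1 - g * f ∈ u.1 := by
  obtain ⟨b, hb⟩ := h.isMaximal.exists_inv (x := ⟨f, hf⟩) (fun h' => hfu ((h.coe_mem_iff _).2 h'))
  obtain ⟨i, hi, e⟩ := hb
  refine ⟨b, b.2, ?_⟩
  have : (1 : F) - b * f = i := by
    have := congrArg (fun a : ↥(RI F) => (a : F)) e
    simp at this
    rw [← this]
    ring
  rw [this]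
  exact (h.coe_mem_iff _).2 hi

theorem mem_of_two_mul {f : F} (hf : f ∈ RI F) : 2 * f ∈ u.1 := by
  rw [mul_comm]
  exact mul_mem hf h.two_mem'

theorem finite_quotient : Finite (↥(RI F) ⧸ P) := by
  have : Module.Finite ℤ (↥(RI F) ⧸ P) := Module.Finite.of_surjective
    (P.mkQ.restrictScalars ℤ) (Submodule.mkQ_surjective P)
  refine Module.finite_of_fg_torsion _ fun x =>
    ⟨⟨2, mem_nonZeroDivisors_of_ne_zero two_ne_zero⟩, ?_⟩
  obtain ⟨a, rfl⟩ := Ideal.Quotient.mk_surjective x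
  change (2 : ℤ) • Ideal.Quotient.mk P a = 0
  rw [← map_zsmul, Ideal.Quotient.eq_zero_iff_mem, zsmul_eq_mul]
  exact P.mul_mem_right _ (by exact_mod_cast h.two_mem)

theorem exists_sq_sub_mem {f : F} (hf : f ∈ RI F) : ∃ s ∈ RI F, s ^ 2 - f ∈ u.1 := by
  have := h.finite_quotient
  have hinj : Function.Injective fun x : ↥(RI F) ⧸ P => x ^ 2 := by
    intro x y hxy
    obtain ⟨a, rfl⟩ := Ideal.Quotient.mk_surjective x
    obtain ⟨b, rfl⟩ := Ideal.Quotient.mk_surjective y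
    simp only [← map_pow] at hxy
    rw [Ideal.Quotient.eq] at hxy ⊢
    refine h.isMaximal.isPrime.mem_of_pow_mem 2 ?_
    have : (a - b) ^ 2 = a ^ 2 - b ^ 2 + 2 * (b * (b - a)) := by ring
    rw [this]
    exact P.add_mem hxy (P.mul_mem_right _ h.two_mem)
  obtain ⟨x, hx⟩ := Finite.surjective_of_injective hinj (Ideal.Quotient.mk P ⟨f, hf⟩)
  obtain ⟨s, rfl⟩ := Ideal.Quotient.mk_surjective x
  simp only [← map_pow] at hx
  rw [Ideal.Quotient.eq] at hx
  exact ⟨s, s.2, (h.coe_mem_iff _).2 hx⟩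

theorem eq_or_eq {b : Submodule ↥(RI F) F} (h1 : u.1 ≤ b) (h2 : b ≤ 1) : b = u.1 ∨ b = 1 := by
  by_cases hb : b ≤ u.1
  · exact Or.inl (le_antisymm hb h1)
  · refine Or.inr (le_antisymm h2 ?_)
    obtain ⟨f, hf, hfu⟩ := SetLike.not_le_iff_exists.1 hb
    obtain ⟨g, hg, hgf⟩ := h.exists_one_sub_mem (mem_one_iff.1 (h2 hf)) hfu
    rw [one_eq_span_one, Submodule.span_singleton_le_iff_mem]
    have := add_mem (h1 hgf) (b.smul_mem (⟨g, hg⟩ : ↥(RI F)) hf)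
    simpa [Algebra.smul_def] using this

theorem mem_mul_self_iff (a : ↥(RI F)) : (a : F) ∈ u.1 * u.1 ↔ a ∈ P ^ 2 := by
  have hu : u.1 = IsLocalization.coeSubmodule F P := by
    ext f
    rw [h.mem_iff, IsLocalization.mem_coeSubmodule]
    rfl
  rw [hu, ← IsLocalization.coeSubmodule_mul, IsLocalization.mem_coeSubmodule, sq]
  exact ⟨fun ⟨b, hb, e⟩ => Subtype.ext e ▸ hb, fun ha => ⟨a, ha, rfl⟩⟩

omit h in
theorem mem_of_mul_mem_mul {t : F} (ht : ∀ f ∈ u.1, f * t ∈ u.1 * u.1) : t ∈ u.1 := by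
  rw [← Submodule.span_singleton_le_iff_mem, ← unit_mul_le_iff u, Submodule.mul_le]
  intro f hf g hg
  obtain ⟨a, rfl⟩ := Submodule.mem_span_singleton.1 hg
  rw [mul_smul_comm]
  exact Submodule.smul_mem _ _ (ht f hf)

/-- An approximation of `1` at `P` and of `0` at the other dyadic primes. -/
theorem exists_approx : ∃ (b : Ideal ↥(RI F)) (e : ↥(RI F)), e ∈ b ∧ 1 - e ∈ P ^ 2 ∧
    ∀ q : Ideal ↥(RI F), q.IsPrime → 2 ∈ q → q ≠ P → b ≤ q := by
  have hP0 : P ≠ ⊥ := by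
    rintro rfl
    exact two_ne_zero ((Submodule.mem_bot _).1 h.two_mem)
  have hPp : Prime P := Ideal.prime_of_isPrime hP0 h.isMaximal.isPrime
  have h20 : Ideal.span {(2 : ↥(RI F))} ≠ 0 := by
    rw [Ne, Ideal.zero_eq_bot, Ideal.span_singleton_eq_bot]
    exact two_ne_zero
  obtain ⟨n, b, hb, hnb⟩ := WfDvdMonoid.max_power_factor h20 hPp.irreducible
  rw [Ideal.dvd_iff_le] at hb
  have hcop : IsCoprime P b := by
    rw [Ideal.isCoprime_iff_sup_eq]
    by_contra hne
    exact hb (le_sup_right.trans_eq (h.isMaximal.eq_of_le hne le_sup_left).symm)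
  obtain ⟨x, hx, e, he, hxe⟩ := Ideal.isCoprime_iff_exists.1 (hcop.pow_left (m := 2))
  refine ⟨b, e, he, by rw [← hxe]; simpa using hx, fun q hq h2q hqP => ?_⟩
  have h1 : P ^ n * b ≤ q := by
    rw [← hnb, Ideal.span_singleton_le_iff_mem]
    exact h2q
  rcases hq.mul_le.1 h1 with h1 | h1
  · exact absurd (h.isMaximal.eq_of_le hq.ne_top (hq.le_of_pow_le h1)).symm hqP
  · exact h1

theorem le_loc_span {b : Ideal ↥(RI F)}
    (hb : ∀ q : Ideal ↥(RI F), q.IsPrime → 2 ∈ q → q ≠ P → b ≤ q)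
    {ν : ↥(RI F)} (hν : ν ∈ P) (hν' : ν ∉ P ^ 2) (hνb : ν - 1 ∈ b) :
    u.1 ≤ loc (primeTo 2) (Submodule.span ↥(RI F) {(ν : F)}) := by
  have key : Ideal.span {ν} ⊔ Ideal.span {2} * P = P := by
    have hle : Ideal.span {ν} ⊔ Ideal.span {2} * P ≤ P :=
      sup_le ((Ideal.span_singleton_le_iff_mem _).2 hν) Ideal.mul_le_right
    obtain ⟨C, hC⟩ := Ideal.dvd_iff_le.2 hle
    suffices C = ⊤ by rw [hC, this, Ideal.mul_top]
    by_contra hCt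
    obtain ⟨q, hq, hCq⟩ := Ideal.exists_le_maximal C hCt
    have hP0 : P ≠ 0 := by
      rintro rfl
      exact two_ne_zero ((Submodule.mem_bot _).1 h.two_mem)
    have h2q : 2 ∈ q := by
      have h1 : P * Ideal.span {2} ≤ P * q := by
        rw [mul_comm]
        exact le_sup_right.trans (hC.le.trans (Ideal.mul_mono le_rfl hCq))
      rw [← Ideal.dvd_iff_le, mul_dvd_mul_iff_left hP0, Ideal.dvd_iff_le] at h1
      exact (Ideal.span_singleton_le_iff_mem _).1 h1
    have hνC : ν ∈ P * C := hC ▸ Ideal.mem_sup_left (Ideal.mem_span_singleton_self ν)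
    by_cases hqP : q = P
    · refine hν' ?_
      rw [sq]
      exact Ideal.mul_mono le_rfl (hqP ▸ hCq) hνC
    · have h1 := hb q hq.isPrime h2q hqP hνb
      have h3 : ν ∈ q := hCq (Ideal.mul_le_right hνC)
      refine hq.ne_top ((Ideal.eq_top_iff_one q).2 ?_)
      simpa using q.sub_mem h3 h1
  refine le_loc_of_forall_exists (Submodule.fg_unit u) fun f hf => ?_
  obtain ⟨a, ha, rfl⟩ := (h.mem_iff f).1 hf
  rw [← key] at ha
  obtain ⟨x, hx, y, hy, rfl⟩ := Submodule.mem_sup.1 ha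
  obtain ⟨z, hz, rfl⟩ := Ideal.mem_span_singleton_mul.1 hy
  obtain ⟨c, rfl⟩ := Ideal.mem_span_singleton'.1 hx
  refine ⟨_, Submodule.smul_mem _ c (Submodule.mem_span_singleton_self _), _,
    (h.coe_mem_iff z).2 hz, ?_⟩
  rw [zsmul_eq_mul, Algebra.smul_def]
  push_cast
  rfl

end IsDyadic

end QuatAlg

end DyadicPrimes

section Edges

open LatLoc

namespace QuatAlg

theorem smul_mem_ext_mul {a : Submodule ↥(RI F) F} {L : QLat c₁ c₂} {f : F} (hf : f ∈ a)
    {y : ℍ[F, c₁, c₂]} (hy : y ∈ L) : f • y ∈ ext a * L :=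
  ext_mul_le_iff.1 le_rfl f hf y hy

theorem ext_mul_induction {a : Submodule ↥(RI F) F} {L : QLat c₁ c₂} {p : ℍ[F, c₁, c₂] → Prop}
    {w : ℍ[F, c₁, c₂]} (hw : w ∈ ext a * L) (hsmul : ∀ f ∈ a, ∀ y ∈ L, p (f • y))
    (hadd : ∀ x ∈ ext a * L, ∀ y ∈ ext a * L, p x → p y → p (x + y)) : p w := by
  suffices w ∈ ext a * L ∧ p w from this.2
  refine Submodule.mul_induction_on hw ?_ fun x y hx hy =>
    ⟨add_mem hx.1 hy.1, hadd x hx.1 y hy.1 hx.2 hy.2⟩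
  intro m hm n hn
  obtain ⟨f, hf, rfl⟩ := mem_ext.1 hm
  rw [algebraMap_mul]
  exact ⟨smul_mem_ext_mul hf hn, hsmul f hf n hn⟩

/-- `M` lies strictly between `u J` and `J` and is stable under the maximal order `R`. -/
structure IsEdge (u : FracUnits F) (R J M : QLat c₁ c₂) : Prop where
  lt_left : ext u.1 * J < M
  lt_right : M < J
  mul_le : M * R ≤ M

section MaxOrder

variable {P : Ideal ↥(RI F)} {u : FracUnits F} (h : IsDyadic P u) {R : QLat c₁ c₂}
  (hR : IsMaxOrder R)

include h hR

omit h in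
theorem trd_mem_of_mem_ext_mul {w : ℍ[F, c₁, c₂]} (hw : w ∈ ext u.1 * R) : trd w ∈ u.1 := by
  refine ext_mul_induction (p := fun w => trd w ∈ u.1) hw
    (fun f hf y hy => ?_) fun x _ y _ hx hy => ?_
  · rw [trd_smul, mul_comm]
    exact IsDyadic.mul_mem (hR.trd_mem hy) hf
  · rw [trd_add]
    exact add_mem hx hy

omit h in
theorem mul_mem_ext_mul {w z : ℍ[F, c₁, c₂]} (hw : w ∈ ext u.1 * R) (hz : z ∈ R) :
    w * z ∈ ext u.1 * R := by
  have := Submodule.mul_mem_mul hw hz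
  rwa [mul_assoc, hR.mul_self] at this

omit h in
theorem mul_mem_ext_mul' {w z : ℍ[F, c₁, c₂]} (hw : w ∈ ext u.1 * R) (hz : z ∈ R) :
    z * w ∈ ext u.1 * R := by
  have := Submodule.mul_mem_mul hz hw
  rwa [← mul_assoc, ← ext_mul_comm, mul_assoc, hR.mul_self] at this

omit hR in
theorem ext_mul_le : ext u.1 * R ≤ R :=
  ext_mul_le_iff.2 fun _ hf _ hy => R.smul_mem (⟨_, h.mem_RI hf⟩ : ↥(RI F)) hy

theorem nrd_mem_of_mem_ext_mul {w : ℍ[F, c₁, c₂]} (hw : w ∈ ext u.1 * R) : quatNrd w ∈ u.1 := by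
  refine ext_mul_induction (p := fun w => quatNrd w ∈ u.1) hw
    (fun f hf y hy => ?_) fun x hx y hy hx' hy' => ?_
  · rw [nrd_smul, sq, mul_comm, ← mul_assoc]
    exact IsDyadic.mul_mem (RI F |>.mul_mem (hR.nrd_mem hy) (h.mem_RI hf)) hf
  · rw [nrd_add]
    exact add_mem (add_mem hx' (trd_mem_of_mem_ext_mul hR
      (mul_mem_ext_mul hR hx (hR.star_mem (ext_mul_le h hy))))) hy'

omit h hR in
theorem trd_mul_star_mem {M : QLat c₁ c₂} (hM : ∀ m ∈ M, quatNrd m ∈ u.1)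
    {x y : ℍ[F, c₁, c₂]} (hx : x ∈ M) (hy : y ∈ M) : trd (x * star y) ∈ u.1 := by
  have := sub_mem (sub_mem (hM _ (add_mem hx hy)) (hM x hx)) (hM y hy)
  rw [nrd_add] at this
  convert this using 1
  ring

namespace IsEdge

variable {M : QLat c₁ c₂} (hM : IsEdge u R R M)

include hM

omit h hR in
theorem one_notMem : (1 : ℍ[F, c₁, c₂]) ∉ M := fun h1 => hM.lt_right.not_ge fun x hx => by
  have := hM.mul_le (Submodule.mul_mem_mul h1 hx)
  rwa [one_mul] at this

theorem nrd_mem {m : ℍ[F, c₁, c₂]} (hm : m ∈ M) : quatNrd m ∈ u.1 := by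
  by_contra hn
  obtain ⟨g, hg, hgn⟩ := h.exists_one_sub_mem (hR.nrd_mem (hM.lt_right.le hm)) hn
  refine hM.one_notMem ?_
  have h1 : algebraMap F _ (quatNrd m) ∈ M := by
    rw [← mul_star]
    exact hM.mul_le (Submodule.mul_mem_mul hm (hR.star_mem (hM.lt_right.le hm)))
  have h2 := add_mem (hM.lt_left.le (smul_mem_ext_mul hgn hR.one_mem))
    (M.smul_mem (⟨g, hg⟩ : ↥(RI F)) h1)
  convert h2 using 1
  rw [RI.smul_def, ← algebraMap_mul, ← algebraMap_mul, mul_one, ← map_mul, ← map_add]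
  simp

omit h in
theorem exists_nrd_notMem : ∃ x ∈ M, quatNrd x ∉ u.1 * u.1 := by
  by_contra! hall
  refine hM.lt_left.not_ge ?_
  have htr : ∀ m ∈ M, trd m ∈ u.1 := fun m hm => IsDyadic.mem_of_mul_mem_mul fun f hf => by
    have hfM : algebraMap F _ f ∈ M := by
      have := hM.lt_left.le (smul_mem_ext_mul hf hR.one_mem)
      rwa [← algebraMap_mul, mul_one] at this
    have := sub_mem (sub_mem (hall _ (add_mem hm hfM)) (hall m hm)) (hall _ hfM)
    rw [nrd_add, star_algebraMap, mul_algebraMap, trd_smul] at this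
    convert this using 1
    ring
  have hle : ext (u⁻¹).1 * M ≤ R := by
    refine ext_mul_le_iff.2 fun f hf m hm => hR.mem_of_trd_mem ?_ fun z hz => ?_
    · rw [nrd_smul, ← mem_one_iff]
      have h1 : (u⁻¹).1 * (u⁻¹).1 * (u.1 * u.1) = 1 := by
        rw [mul_assoc, ← mul_assoc _ u.1 u.1, Units.inv_mul, one_mul, Units.inv_mul]
      rw [← h1, sq]
      exact Submodule.mul_mem_mul (Submodule.mul_mem_mul hf hf) (hall m hm)
    · rw [smul_mul_assoc, trd_smul, ← mem_one_iff, ← Units.inv_mul u]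
      exact Submodule.mul_mem_mul hf (htr _ (hM.mul_le (Submodule.mul_mem_mul hm hz)))
  have := mul_le_mul' (le_refl (ext u.1)) hle
  rwa [← mul_assoc, ← map_mul, Units.mul_inv, map_one, one_mul] at this

theorem exists_gen (hD : Anisotropic c₁ c₂) : ∃ y : ℍ[F, c₁, c₂]ˣ, (y : ℍ[F, c₁, c₂]) ∈ M ∧
    quatNrd (y : ℍ[F, c₁, c₂]) ∉ u.1 * u.1 ∧
    loc (primeTo 2) M = loc (primeTo 2) ((pr y).1 * R) := by
  obtain ⟨x, hx, hxn⟩ := hM.exists_nrd_notMem hR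
  obtain ⟨b, e, heb, heP, hb⟩ := h.exists_approx
  have hxR := hM.lt_right.le hx
  set ν : ↥(RI F) := ⟨_, hR.nrd_mem hxR⟩ with hν
  set τ : ↥(RI F) := ⟨_, hR.trd_mem hxR⟩ with hτ
  set y : ℍ[F, c₁, c₂] := (e : F) • x + algebraMap F _ (1 - e : F) with hy
  have heP' : 1 - e ∈ P := Ideal.pow_le_self two_ne_zero heP
  have hyM : y ∈ M := by
    refine add_mem (M.smul_mem e hx) (hM.lt_left.le ?_)
    have := smul_mem_ext_mul ((h.coe_mem_iff (1 - e)).2 heP') hR.one_mem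
    rw [← algebraMap_mul, mul_one] at this
    exact this
  have hyn : quatNrd y = ((e ^ 2 * ν + e * (1 - e) * τ + (1 - e) ^ 2 : ↥(RI F)) : F) := by
    rw [hy, nrd_add, star_algebraMap, mul_algebraMap, trd_smul, trd_smul, nrd_smul, nrd_algebraMap]
    push_cast
    rw [hν, hτ]
    ring
  have hνP : ν ∉ P ^ 2 := fun h1 => hxn ((h.mem_mul_self_iff ν).2 h1)
  set N : ↥(RI F) := e ^ 2 * ν + e * (1 - e) * τ + (1 - e) ^ 2 with hN
  have hNP : N ∈ P := (h.coe_mem_iff N).1 (hyn ▸ hM.nrd_mem h hR hyM)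
  have hNP2 : N ∉ P ^ 2 := by
    intro h1
    refine hνP ?_
    have h2 : ν = N + (1 - e) * ((1 + e) * ν - e * τ - (1 - e)) := by
      rw [hN]
      ring
    rw [h2]
    exact add_mem h1 (Ideal.mul_mem_right _ _ heP)
  have hNb : N - 1 ∈ b := by
    have h2 : N - 1 = e * (e * ν + (1 - e) * τ - 2 + e) := by
      rw [hN]
      ring
    rw [h2]
    exact Ideal.mul_mem_right _ _ heb
  have hloc := h.le_loc_span hb hNP hNP2 hNb
  obtain ⟨n, hn, hnle⟩ := exists_smul_mem_of_fg (Submodule.fg_unit u) hloc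
  have hyn0 : quatNrd y ≠ 0 := by
    intro h0
    refine hNP2 ?_
    have h1 : N = 0 := Subtype.ext (hyn.symm.trans h0)
    rw [h1]
    exact zero_mem _
  obtain ⟨y', hy'⟩ := isUnit_of_ne_zero hD (x := y) (fun h0 => hyn0 (by rw [h0, nrd_zero]))
  have hdiv : ∀ f ∈ u.1, (n : F) * f * (quatNrd y)⁻¹ ∈ RI F := by
    intro f hf
    obtain ⟨a, ha⟩ := Submodule.mem_span_singleton.1 (hnle f hf)
    rw [Algebra.smul_def, ← hyn, ← Int.cast_smul_eq_zsmul F, smul_eq_mul] at ha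
    rw [← ha, mul_assoc, mul_inv_cancel₀ hyn0, mul_one]
    exact a.2
  refine ⟨y', hy' ▸ hyM, ?_,
    loc_eq_iff.2 ⟨?_, le_trans (pr_mul_le_iff.2 fun z hz => ?_) (le_loc M)⟩⟩
  · rw [hy', hyn, h.mem_mul_self_iff]
    exact hNP2
  · intro m hm
    refine ⟨n, hn, mem_pr_mul.2 ⟨n • ((y'⁻¹).1 * m), ?_, ?_⟩⟩
    · have hinv : (y'⁻¹).1 = (quatNrd y)⁻¹ • star y := by rw [val_inv, hy']
      have hRI : ((n : ℤ) : F) ∈ RI F := intCast_mem _ n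
      refine hR.mem_of_trd_mem ?_ fun z hz => ?_
      · rw [nrd_zsmul, hinv, nrd_mul, nrd_smul, nrd_star, ← Int.cast_smul_eq_zsmul F, smul_eq_mul]
        have := RI F |>.mul_mem hRI (hdiv _ (hM.nrd_mem h hR hm))
        convert this using 1
        push_cast
        field_simp
      · rw [← Int.cast_smul_eq_zsmul F, hinv, smul_mul_assoc, smul_mul_assoc, smul_mul_assoc,
          trd_smul, trd_smul, mul_assoc, trd_mul_comm]
        have := hdiv _ (trd_mul_star_mem (fun m hm => hM.nrd_mem h hR hm)
          (hM.mul_le (Submodule.mul_mem_mul hm hz)) hyM)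
        convert this using 1
        ring
    · rw [mul_smul_comm, Units.mul_inv_cancel_left]
  · rw [hy']
    exact hM.mul_le (Submodule.mul_mem_mul hyM hz)

theorem le_of_le (hD : Anisotropic c₁ c₂) {M' : QLat c₁ c₂} (hM' : IsEdge u R R M') (hle : M ≤ M') :
    M' ≤ M := by
  obtain ⟨y, hy, hyn, -⟩ := hM.exists_gen h hR hD
  obtain ⟨y', hy', hyn', hloc'⟩ := hM'.exists_gen h hR hD
  have h2 : ∀ x ∈ R, (2 : ℤ) • x ∈ M := fun x hx => by
    refine hM.lt_left.le ?_
    have := smul_mem_ext_mul h.two_mem' hx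
    rw [← Int.cast_smul_eq_zsmul F]
    exact_mod_cast this
  have key : ∀ x ∈ R, ∀ n : ℤ, IsCoprime n 2 → n • x ∈ M → x ∈ M := fun x hx n hn hnx =>
    mem_of_isCoprime hn hnx (h2 x hx)
  obtain ⟨n, hn, hny⟩ := hloc'.le (le_loc M' (hle hy))
  obtain ⟨c, hc, hyc⟩ := mem_pr_mul.1 hny
  have hny' : n ^ 2 • quatNrd (y : ℍ[F, c₁, c₂]) =
      quatNrd (y' : ℍ[F, c₁, c₂]) * quatNrd c := by
    rw [← nrd_zsmul, ← hyc, nrd_mul]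
  have hcn : quatNrd c ∉ u.1 := by
    intro hcu
    refine hyn ?_
    have h3 : n ^ 2 • quatNrd (y : ℍ[F, c₁, c₂]) ∈ u.1 * u.1 := by
      rw [hny']
      exact Submodule.mul_mem_mul (hM'.nrd_mem h hR hy') hcu
    have h4 : (2 : ℤ) • quatNrd (y : ℍ[F, c₁, c₂]) ∈ u.1 * u.1 := by
      rw [← Int.cast_smul_eq_zsmul F, smul_eq_mul]
      exact Submodule.mul_mem_mul (by exact_mod_cast h.two_mem') (hM.nrd_mem h hR hy)
    exact mem_of_isCoprime (IsCoprime.pow_left hn) h3 h4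
  have hy'M : (y' : ℍ[F, c₁, c₂]) ∈ M := by
    obtain ⟨g, hg, hgc⟩ := h.exists_one_sub_mem (hR.nrd_mem hc) hcn
    have hy'R := hM'.lt_right.le hy'
    have h3 : quatNrd c • (y' : ℍ[F, c₁, c₂]) ∈ M := by
      have := hM.mul_le (Submodule.mul_mem_mul (zsmul_mem hy n) (hR.star_mem hc))
      rwa [← hyc, mul_assoc, mul_star, mul_algebraMap] at this
    have h4 := add_mem (hM.lt_left.le (smul_mem_ext_mul hgc hy'R))
      (M.smul_mem (⟨g, hg⟩ : ↥(RI F)) h3)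
    convert h4 using 1
    rw [RI.smul_def, smul_smul, ← add_smul]
    simp
  intro m hm
  obtain ⟨k, hk, hkm⟩ := hloc'.le (le_loc M' hm)
  obtain ⟨r, hr, hkr⟩ := mem_pr_mul.1 hkm
  refine key m (hM'.lt_right.le hm) k hk ?_
  rw [← hkr]
  exact hM.mul_le (Submodule.mul_mem_mul hy'M hr)

end IsEdge

theorem isEdge_span_sup {z : ℍ[F, c₁, c₂]} (hz : z ∈ R) (hzn : quatNrd z ∈ u.1)
    (hzu : z ∉ ext u.1 * R) :
    IsEdge u R R (Submodule.span ↥(RI F) {z} * R ⊔ ext u.1 * R) := by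
  refine ⟨lt_of_le_of_ne le_sup_right fun he => hzu ?_, lt_of_le_of_ne (sup_le ?_ (ext_mul_le h))
    fun he => ?_, ?_⟩
  · rw [he]
    exact Submodule.mem_sup_left (Submodule.mem_span_singleton_mul.2 ⟨1, hR.one_mem, mul_one z⟩)
  · rw [Submodule.mul_le]
    intro x hx y hy
    exact hR.mul_mem ((Submodule.span_singleton_le_iff_mem _ _).2 hz hx) hy
  · have h1 := hR.one_mem
    rw [← he] at h1
    obtain ⟨x, hx, w, hw, e⟩ := Submodule.mem_sup.1 h1
    obtain ⟨r, hr, rfl⟩ := Submodule.mem_span_singleton_mul.1 hx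
    have h3 : quatNrd (1 + -w) ∈ u.1 := by
      rw [← e, add_neg_cancel_right, nrd_mul, mul_comm]
      exact IsDyadic.mul_mem (hR.nrd_mem hr) hzn
    have hw' := neg_mem hw
    rw [nrd_one_add] at h3
    refine h.one_notMem ?_
    have h4 := sub_mem (sub_mem h3 (trd_mem_of_mem_ext_mul hR hw'))
      (nrd_mem_of_mem_ext_mul h hR hw')
    convert h4 using 1
    ring
  · rw [Submodule.sup_mul, mul_assoc, mul_assoc, hR.mul_self]

end MaxOrder

end QuatAlg

end Edges

section Parity

theorem Set.even_ncard_of_involution {α : Type*} [Finite α] (s : Set α) (f : α → α)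
    (hf : ∀ a ∈ s, f a ∈ s) (hff : ∀ a ∈ s, f (f a) = a) (hne : ∀ a ∈ s, f a ≠ a) :
    Even s.ncard := by
  classical
  have := Fintype.ofFinite α
  rw [Set.ncard_eq_toFinset_card', even_iff_two_dvd, ← ZMod.natCast_eq_zero_iff]
  have := Finset.sum_involution (s := s.toFinset) (f := fun _ => (1 : ZMod 2)) (fun a _ => f a)
    (fun _ _ => by decide) (fun a ha _ => hne a (by simpa using ha))
    (fun a ha => by simpa using hf a (by simpa using ha)) (fun a ha => hff a (by simpa using ha))
  simpa using this

theorem Set.odd_ncard_diff_singleton {α : Type*} [Finite α] {s : Set α} (hs : Even s.ncard)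
    {a : α} (ha : a ∈ s) : Odd (s \ {a}).ncard := by
  rw [← Set.ncard_sdiff_singleton_add_one ha, Nat.even_add_one, Nat.not_even_iff_odd] at hs
  exact hs

theorem odd_card_of_odd_ncard_fiber {α β : Type*} [Finite α] (s : Set α) (hs : Odd s.ncard)
    (r : α → β → Prop) (hr : ∀ a ∈ s, ∃! b, r a b) (hodd : ∀ b, Odd {a ∈ s | r a b}.ncard) :
    Odd (Nat.card β) := by
  classical
  choose g hg hg' using fun a : s => hr a.1 a.2
  have hcard : ∀ b, Nat.card {a : s // g a = b} = {a ∈ s | r a b}.ncard := fun b => by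
    rw [← Nat.card_coe_set_eq]
    exact Nat.card_congr
      { toFun := fun a => ⟨a.1.1, a.1.2, by simpa only [a.2] using hg a.1⟩
        invFun := fun a => ⟨⟨a.1, a.2.1⟩, (hg' ⟨a.1, a.2.1⟩ b a.2.2).symm⟩
        left_inv := fun a => rfl
        right_inv := fun a => rfl }
  have hsurj : Function.Surjective g := fun b => by
    have h1 : Nat.card {a : s // g a = b} ≠ 0 := by
      rw [hcard]
      exact (hodd b).pos.ne'
    obtain ⟨⟨a, ha⟩⟩ := (Nat.card_ne_zero.1 h1).1
    exact ⟨a, ha⟩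
  have := Finite.of_surjective g hsurj
  have := Fintype.ofFinite β
  rw [← Nat.card_coe_set_eq, Nat.card_congr (Equiv.sigmaFiberEquiv g).symm, Nat.card_sigma,
    Finset.odd_sum_iff_odd_card_odd, Finset.filter_true_of_mem fun b _ => by
      rw [hcard]
      exact hodd b] at hs
  rwa [Nat.card_eq_fintype_card]

end Parity

section OddEdges

open LatLoc

namespace QuatAlg

variable {P : Ideal ↥(RI F)} {u : FracUnits F} (h : IsDyadic P u) {R : QLat c₁ c₂}
  (hR : IsMaxOrder R)

include h in
theorem ext_eq_smul : ext u.1 * R = P • R := by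
  refine le_antisymm (ext_mul_le_iff.2 fun f hf y hy => ?_)
    (Submodule.smul_le.2 fun a ha y hy => ?_)
  · obtain ⟨a, ha, rfl⟩ := (h.mem_iff f).1 hf
    exact Submodule.smul_mem_smul ha hy
  · exact smul_mem_ext_mul ((h.coe_mem_iff a).2 ha) hy

theorem commute_of_mem_span_pair {x y z : ℍ[F, c₁, c₂]}
    (hy : y ∈ Submodule.span ↥(RI F) {1, x}) (hz : z ∈ Submodule.span ↥(RI F) {1, x}) :
    y * z = z * y := by
  obtain ⟨a, b, rfl⟩ := Submodule.mem_span_pair.1 hy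
  obtain ⟨c, d, rfl⟩ := Submodule.mem_span_pair.1 hz
  simp only [RI.smul_def, add_mul, mul_add, smul_mul_smul_comm, one_mul, mul_one, mul_comm]
  abel

include h hR in
theorem exists_trd_mem : ∃ x ∈ R, trd x ∈ u.1 ∧
    ∀ s ∈ RI F, x - algebraMap F _ s ∉ ext u.1 * R := by
  by_contra! hall
  obtain ⟨x₀, hx₀⟩ : ∃ x₀, R ≤ Submodule.span ↥(RI F) {1, x₀} ⊔ ext u.1 * R := by
    have key : ∀ {x₀ x}, x ∈ R → trd x ∈ u.1 →
        x ∈ Submodule.span ↥(RI F) {1, x₀} ⊔ ext u.1 * R := fun {x₀ x} hx ht => by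
      obtain ⟨s, hs, hxs⟩ := hall x hx ht
      refine Submodule.mem_sup.2 ⟨_, Submodule.mem_span_pair.2 ⟨⟨s, hs⟩, 0, rfl⟩, _, hxs, ?_⟩
      rw [zero_smul, add_zero, RI.smul_def, ← algebraMap_mul, mul_one]
      exact add_sub_cancel _ _
    by_cases ht : ∀ x ∈ R, trd x ∈ u.1
    · exact ⟨1, fun x hx => key hx (ht x hx)⟩
    · push Not at ht
      obtain ⟨x₀, hx₀, ht₀⟩ := ht
      refine ⟨x₀, fun x hx => ?_⟩
      obtain ⟨g, hg, hgt⟩ := h.exists_one_sub_mem (hR.trd_mem hx₀) ht₀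
      have hm : trd x * g ∈ RI F := (RI F).mul_mem (hR.trd_mem hx) hg
      have h1 : (trd x * g) • x₀ ∈ R := R.smul_mem (⟨_, hm⟩ : ↥(RI F)) hx₀
      have h2 := key (x₀ := x₀) (sub_mem hx h1) (by
        have := IsDyadic.mul_mem (hR.trd_mem hx) hgt
        rw [sub_eq_add_neg, trd_add, ← neg_smul, trd_smul]
        convert this using 1
        ring)
      have h3 : (trd x * g) • x₀ ∈ Submodule.span ↥(RI F) {1, x₀} ⊔ ext u.1 * R :=
        Submodule.mem_sup_left (Submodule.mem_span_pair.2
          ⟨0, ⟨_, hm⟩, by rw [zero_smul, zero_add, RI.smul_def]⟩)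
      simpa using add_mem h2 h3
  rw [ext_eq_smul h] at hx₀
  obtain ⟨r, hr, hle⟩ :=
    Submodule.exists_sub_one_mem_and_smul_le_of_fg_of_le_sup hR.isLat.fg le_rfl hx₀
  have hr0 : (r : F) ≠ 0 := by
    intro h0
    have h0' : r = 0 := Subtype.ext h0
    rw [h0', zero_sub, Ideal.neg_mem_iff] at hr
    exact h.isMaximal.ne_top ((Ideal.eq_top_iff_one P).2 hr)
  have hmem : ∀ d : ℍ[F, c₁, c₂], ∃ f : F, f ≠ 0 ∧ f • d ∈ Submodule.span ↥(RI F) {1, x₀} := by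
    intro d
    obtain ⟨n, hn, hnd⟩ := hR.isLat.full d
    refine ⟨r * n, mul_ne_zero hr0 (Int.cast_ne_zero.2 hn), ?_⟩
    have := hle (Submodule.smul_mem_pointwise_smul _ r R hnd)
    rwa [RI.smul_def, ← Int.cast_smul_eq_zsmul F, smul_smul] at this
  obtain ⟨f, hf, hfi⟩ := hmem ⟨0, 1, 0, 0⟩
  obtain ⟨g, hg, hgj⟩ := hmem ⟨0, 0, 1, 0⟩
  have := congrArg (fun q => q.imK) (commute_of_mem_span_pair hfi hgj)
  simp at this
  have h2 : (2 : F) * (f * g) = 0 := by linear_combination this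
  simp [hf, hg] at h2

include h hR in
theorem exists_nilpotent : ∃ v ∈ R, v ∉ ext u.1 * R ∧ trd v ∈ u.1 ∧ quatNrd v ∈ u.1 := by
  obtain ⟨x, hx, ht, hs⟩ := exists_trd_mem h hR
  obtain ⟨s, hsR, hsn⟩ := h.exists_sq_sub_mem (hR.nrd_mem hx)
  have hsR' : -s ∈ RI F := neg_mem hsR
  refine ⟨x + algebraMap F _ (-s), add_mem hx (hR.algebraMap_mem_iff.2 hsR'), ?_, ?_, ?_⟩
  · rw [map_neg, ← sub_eq_add_neg]
    exact hs s hsR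
  · rw [trd_add, trd_algebraMap]
    have := add_mem ht (h.mem_of_two_mul hsR')
    convert this using 1
  · rw [nrd_add, star_algebraMap, mul_algebraMap, trd_smul, nrd_algebraMap]
    have := add_mem (add_mem hsn (h.mem_of_two_mul (hR.nrd_mem hx))) (IsDyadic.mul_mem hsR' ht)
    convert this using 1
    ring

/-- `R / uR`. -/
abbrev residue (u : FracUnits F) (R : QLat c₁ c₂) : Type _ :=
  ↥R ⧸ (ext u.1 * R).comap R.subtype

theorem residue_mk_eq_zero_iff {z : ↥R} : (Submodule.Quotient.mk z : residue u R) = 0 ↔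
    (z : ℍ[F, c₁, c₂]) ∈ ext u.1 * R := by
  rw [Submodule.Quotient.mk_eq_zero]
  rfl

theorem residue_mk_eq_iff {z z' : ↥R} :
    (Submodule.Quotient.mk z : residue u R) = Submodule.Quotient.mk z' ↔
    (z : ℍ[F, c₁, c₂]) - z' ∈ ext u.1 * R := by
  rw [Submodule.Quotient.eq]
  rfl

include h in
theorem residue_add_self (v : residue u R) : v + v = 0 := by
  obtain ⟨z, rfl⟩ := Submodule.Quotient.mk_surjective _ v
  rw [← Submodule.Quotient.mk_add, residue_mk_eq_zero_iff]
  have := smul_mem_ext_mul h.two_mem' z.2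
  rwa [two_smul] at this

include h hR in
theorem finite_residue : Finite (residue u R) := by
  have : Module.Finite ↥(RI F) ↥R := Module.Finite.iff_fg.2 hR.isLat.fg
  have : Module.Finite ℤ (residue u R) := Module.Finite.trans ↥(RI F) _
  refine Module.finite_of_fg_torsion _ fun x =>
    ⟨⟨2, mem_nonZeroDivisors_of_ne_zero two_ne_zero⟩, ?_⟩
  change (2 : ℤ) • x = 0
  rw [two_smul, residue_add_self h]

/-- The residue classes whose reduced norm lies in `u`. -/
def isotropic (u : FracUnits F) (R : QLat c₁ c₂) : Set (residue u R) :=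
  {v | ∃ z : ↥R, Submodule.Quotient.mk z = v ∧ quatNrd (z : ℍ[F, c₁, c₂]) ∈ u.1}

include h hR in
theorem mk_mem_isotropic_iff {z : ↥R} : (Submodule.Quotient.mk z ∈ isotropic u R) ↔
    quatNrd (z : ℍ[F, c₁, c₂]) ∈ u.1 := by
  refine ⟨fun ⟨z', e, hz'⟩ => ?_, fun hz => ⟨z, rfl, hz⟩⟩
  have hw := residue_mk_eq_iff.1 e.symm
  have := add_mem (add_mem (nrd_mem_of_mem_ext_mul h hR hw) (trd_mem_of_mem_ext_mul hR
    (mul_mem_ext_mul hR hw (hR.star_mem z'.2)))) hz'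
  rwa [← nrd_add, sub_add_cancel] at this

include h hR in
theorem even_ncard_isotropic_compl : Even (isotropic u R)ᶜ.ncard := by
  have := finite_residue h hR
  obtain ⟨v, hv, hvu, ht, hn⟩ := exists_nilpotent h hR
  have hmul : ∀ z : ↥R, (z : ℍ[F, c₁, c₂]) * (1 + v) ∈ R := fun z =>
    hR.mul_mem z.2 (add_mem hR.one_mem hv)
  obtain ⟨f, hfm⟩ : ∃ f : residue u R → residue u R, ∀ z : ↥R,
      f (Submodule.Quotient.mk z) = Submodule.Quotient.mk ⟨_, hmul z⟩ := by
    refine ⟨fun a => Submodule.Quotient.mk ⟨_, hmul a.out⟩, fun z => ?_⟩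
    rw [residue_mk_eq_iff]
    change _ * (1 + v) - _ * (1 + v) ∈ _
    rw [← sub_mul]
    exact mul_mem_ext_mul hR (residue_mk_eq_iff.1 (Quotient.out_eq' _)) (add_mem hR.one_mem hv)
  have hvv : v * v ∈ ext u.1 * R := by
    have h1 := smul_mem_ext_mul hn hR.one_mem
    rw [← algebraMap_mul, mul_one] at h1
    rw [sq_eq]
    exact sub_mem (smul_mem_ext_mul ht hv) h1
  refine Set.even_ncard_of_involution _ f ?_ ?_ ?_
  · intro a ha
    obtain ⟨z, rfl⟩ := Submodule.Quotient.mk_surjective _ a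
    rw [hfm]
    refine fun hz => ha ?_
    rw [mk_mem_isotropic_iff h hR] at hz ⊢
    rw [nrd_mul, nrd_one_add] at hz
    have := sub_mem hz (IsDyadic.mul_mem (hR.nrd_mem z.2) (add_mem ht hn))
    convert this using 1
    ring
  · intro a _
    obtain ⟨z, rfl⟩ := Submodule.Quotient.mk_surjective _ a
    rw [hfm, hfm, residue_mk_eq_iff]
    have h1 := add_mem (smul_mem_ext_mul h.two_mem' (hR.mul_mem z.2 hv))
      (mul_mem_ext_mul' hR hvv z.2)
    convert h1 using 1
    change _ * (1 + v) * (1 + v) - _ = _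
    rw [two_smul]
    noncomm_ring
  · intro a ha
    obtain ⟨z, rfl⟩ := Submodule.Quotient.mk_surjective _ a
    rw [hfm, Ne, residue_mk_eq_iff]
    intro hz
    rw [Set.mem_compl_iff, mk_mem_isotropic_iff h hR] at ha
    obtain ⟨g, hg, hgz⟩ := h.exists_one_sub_mem (hR.nrd_mem z.2) ha
    refine hvu ?_
    have h1 := mul_mem_ext_mul' hR hz (hR.star_mem z.2)
    have h2 : star (z : ℍ[F, c₁, c₂]) * (z * (1 + v) - z) = quatNrd (z : ℍ[F, c₁, c₂]) • v := by
      rw [mul_add, mul_one, add_sub_cancel_left, ← mul_assoc, star_mul, algebraMap_mul]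
    change star (z : ℍ[F, c₁, c₂]) * (z * (1 + v) - z) ∈ _ at h1
    rw [h2] at h1
    have h3 := add_mem (smul_mem_ext_mul hgz hv) ((ext u.1 * R).smul_mem (⟨g, hg⟩ : ↥(RI F)) h1)
    rw [RI.smul_def, smul_smul, ← add_smul] at h3
    simpa using h3

include h hR in
theorem even_ncard_isotropic : Even (isotropic u R).ncard := by
  have := finite_residue h hR
  have h1 := Set.ncard_add_ncard_compl (isotropic u R)
  rw [← Set.ncard_univ] at h1
  have h2 : Even (Set.univ : Set (residue u R)).ncard := by
    refine Set.even_ncard_of_involution _ (fun v => v + Submodule.Quotient.mk ⟨1, hR.one_mem⟩)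
      (fun _ _ => trivial) (fun v _ => ?_) (fun v _ => ?_)
    · rw [add_assoc, residue_add_self h, add_zero]
    · rw [Ne, add_eq_left, residue_mk_eq_zero_iff]
      intro h3
      have := nrd_mem_of_mem_ext_mul h hR h3
      rw [nrd_one] at this
      exact h.one_notMem this
  rw [← h1, Nat.even_add] at h2
  exact h2.2 (even_ncard_isotropic_compl h hR)

include h hR in
theorem odd_card_edges_self (hD : Anisotropic c₁ c₂) :
    Odd (Nat.card {M : QLat c₁ c₂ // IsEdge u R R M}) := by
  have := finite_residue h hR
  have h0 : (0 : residue u R) ∈ isotropic u R := ⟨0, rfl, by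
    rw [ZeroMemClass.coe_zero, nrd_zero]; exact zero_mem _⟩
  refine odd_card_of_odd_ncard_fiber (isotropic u R \ {0})
    (Set.odd_ncard_diff_singleton (even_ncard_isotropic h hR) h0)
    (fun v M => ∃ z : ↥R, Submodule.Quotient.mk z = v ∧ (z : ℍ[F, c₁, c₂]) ∈ M.1) ?_ ?_
  · rintro _ ⟨⟨z, rfl, hzn⟩, hz0⟩
    have hzu := fun hz => hz0 (residue_mk_eq_zero_iff.2 hz)
    have hE := isEdge_span_sup h hR z.2 hzn hzu
    refine ⟨⟨_, hE⟩, ⟨z, rfl, Submodule.mem_sup_left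
      (Submodule.mem_span_singleton_mul.2 ⟨1, hR.one_mem, mul_one _⟩)⟩, ?_⟩
    rintro ⟨M, hM⟩ ⟨z', e, hz'⟩
    have hzM : (z : ℍ[F, c₁, c₂]) ∈ M := by
      have := sub_mem hz' (hM.lt_left.le (residue_mk_eq_iff.1 e))
      rwa [sub_sub_cancel] at this
    have hle : Submodule.span ↥(RI F) {(z : ℍ[F, c₁, c₂])} * R ⊔ ext u.1 * R ≤ M := by
      refine sup_le (le_trans (mul_le_mul' ?_ le_rfl) hM.mul_le) hM.lt_left.le
      rwa [Submodule.span_singleton_le_iff_mem]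
    exact Subtype.ext (le_antisymm (hE.le_of_le h hR hD hM hle) hle)
  · rintro ⟨M, hM⟩
    have hset : {v ∈ isotropic u R \ {0} | ∃ z : ↥R, Submodule.Quotient.mk z = v ∧
        (z : ℍ[F, c₁, c₂]) ∈ M} = {v : residue u R | ∃ z : ↥R, Submodule.Quotient.mk z = v ∧
        (z : ℍ[F, c₁, c₂]) ∈ M} \ {0} := by
      ext v
      refine ⟨fun ⟨⟨_, h1⟩, h2⟩ => ⟨h2, h1⟩, fun ⟨⟨z, e, hz⟩, h1⟩ =>
        ⟨⟨⟨z, e, hM.nrd_mem h hR hz⟩, h1⟩, z, e, hz⟩⟩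
    rw [hset]
    refine Set.odd_ncard_diff_singleton ?_ ⟨0, rfl, zero_mem _⟩
    obtain ⟨m, hm, hmu⟩ := SetLike.exists_of_lt hM.lt_left
    refine Set.even_ncard_of_involution _
      (fun v => v + Submodule.Quotient.mk ⟨m, hM.lt_right.le hm⟩) ?_ (fun v _ => ?_) (fun v _ => ?_)
    · rintro _ ⟨z, rfl, hz⟩
      exact ⟨z + ⟨m, hM.lt_right.le hm⟩, rfl, add_mem hz hm⟩
    · rw [add_assoc, residue_add_self h, add_zero]
    · rw [Ne, add_eq_left, residue_mk_eq_zero_iff]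
      exact hmu

end QuatAlg

end OddEdges

section TransferEdges

open LatLoc

namespace QuatAlg

theorem ext_mul_smul (a : Submodule ↥(RI F) F) (γ : ℍ[F, c₁, c₂]ˣ × FracUnits F)
    (L : QLat c₁ c₂) : ext a * (γ • L) = γ • (ext a * L) := by
  rw [smul_lat_def, smul_lat_def, ← mul_assoc, ext_mul_comm, mul_assoc]

theorem smul_lat_le_iff (γ : ℍ[F, c₁, c₂]ˣ × FracUnits F) {L L' : QLat c₁ c₂} :
    γ • L ≤ γ • L' ↔ L ≤ L' := unit_mul_le_iff _

theorem smul_lat_lt_iff (γ : ℍ[F, c₁, c₂]ˣ × FracUnits F) {L L' : QLat c₁ c₂} :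
    γ • L < γ • L' ↔ L < L' := by
  simp only [lt_iff_le_not_ge, smul_lat_le_iff]

theorem smul_lat_mul (γ : ℍ[F, c₁, c₂]ˣ × FracUnits F) (L L' : QLat c₁ c₂) :
    (γ • L) * L' = γ • (L * L') := mul_assoc _ _ _

theorem IsEdge.smul {u : FracUnits F} {R J M : QLat c₁ c₂} (hM : IsEdge u R J M)
    (γ : ℍ[F, c₁, c₂]ˣ × FracUnits F) : IsEdge u R (γ • J) (γ • M) :=
  ⟨by rw [ext_mul_smul, smul_lat_lt_iff]; exact hM.lt_left, (smul_lat_lt_iff γ).2 hM.lt_right, by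
    rw [smul_lat_mul, smul_lat_le_iff]; exact hM.mul_le⟩

variable {P : Ideal ↥(RI F)} {u : FracUnits F} (h : IsDyadic P u) {R J X M : QLat c₁ c₂}

include h

theorem ext_mul_le_self (L : QLat c₁ c₂) : ext u.1 * L ≤ L :=
  ext_mul_le_iff.2 fun _ hf _ hy => L.smul_mem (⟨_, h.mem_RI hf⟩ : ↥(RI F)) hy

namespace IsEdge

variable (hM : IsEdge u R J M)

include hM

theorem two_smul_mem {x : ℍ[F, c₁, c₂]} (hx : x ∈ J) : (2 : ℤ) • x ∈ M := by
  refine hM.lt_left.le ?_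
  have := smul_mem_ext_mul h.two_mem' hx
  rw [← Int.cast_smul_eq_zsmul F]
  exact_mod_cast this

theorem inf_loc_eq : J ⊓ loc (primeTo 2) M = M :=
  le_antisymm (fun _ ⟨hx, _, hn, hnx⟩ => mem_of_isCoprime hn hnx (hM.two_smul_mem h hx))
    (le_inf hM.lt_right.le (le_loc M))

omit h in
theorem loc_inf_loc (hloc : loc (primeTo 2) J = loc (primeTo 2) X) :
    loc (primeTo 2) (X ⊓ loc (primeTo 2) M) = loc (primeTo 2) M := by
  rw [loc_inf, loc_loc, ← hloc]
  exact inf_eq_right.2 (loc_mono hM.lt_right.le)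

theorem inf_loc_inf_loc (hloc : loc (primeTo 2) J = loc (primeTo 2) X) :
    J ⊓ loc (primeTo 2) (X ⊓ loc (primeTo 2) M) = M := by
  rw [hM.loc_inf_loc hloc, hM.inf_loc_eq h]

theorem transfer (hloc : loc (primeTo 2) J = loc (primeTo 2) X) (hX : X * R ≤ X) :
    IsEdge u R X (X ⊓ loc (primeTo 2) M) := by
  have hu : loc (primeTo 2) (ext u.1 * J) = loc (primeTo 2) (ext u.1 * X) := loc_mul_congr rfl hloc
  refine ⟨lt_of_le_of_ne (le_inf (ext_mul_le_self h X) ?_) fun he => ?_,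
    lt_of_le_of_ne inf_le_left fun he => ?_, le_inf ?_ ?_⟩
  · exact (le_loc _).trans (hu.ge.trans (loc_mono hM.lt_left.le))
  · have h1 := hM.inf_loc_inf_loc h hloc
    rw [← he, ← hu] at h1
    refine hM.lt_left.not_ge fun m hm => ?_
    obtain ⟨hmJ, n, hn, hnm⟩ := h1.ge hm
    refine mem_of_isCoprime hn hnm ?_
    have := smul_mem_ext_mul h.two_mem' hmJ
    rw [← Int.cast_smul_eq_zsmul F]
    exact_mod_cast this
  · have h1 := hM.inf_loc_inf_loc h hloc
    rw [he, ← hloc, inf_eq_left.2 (le_loc J)] at h1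
    exact hM.lt_right.ne h1.symm
  · exact (mul_le_mul' inf_le_left le_rfl).trans hX
  · calc (X ⊓ loc (primeTo 2) M) * R ≤ loc (primeTo 2) M * loc (primeTo 2) R :=
        mul_le_mul' inf_le_right (le_loc R)
      _ ≤ loc (primeTo 2) (M * R) := loc_mul_le _ _
      _ ≤ loc (primeTo 2) M := loc_mono hM.mul_le

end IsEdge

theorem card_edges_congr (hloc : loc (primeTo 2) J = loc (primeTo 2) X) (hJ : J * R ≤ J)
    (hX : X * R ≤ X) : Nat.card {M // IsEdge u R J M} = Nat.card {M // IsEdge u R X M} :=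
  Nat.card_congr
    { toFun := fun M => ⟨_, M.2.transfer h hloc hX⟩
      invFun := fun M => ⟨_, M.2.transfer h hloc.symm hJ⟩
      left_inv := fun M => Subtype.ext (M.2.inf_loc_inf_loc h hloc)
      right_inv := fun M => Subtype.ext (M.2.inf_loc_inf_loc h hloc.symm) }

omit h in
theorem card_edges_smul (γ : ℍ[F, c₁, c₂]ˣ × FracUnits F) :
    Nat.card {M // IsEdge u R (γ • J) M} = Nat.card {M // IsEdge u R J M} :=
  Nat.card_congr
    { toFun := fun M => ⟨γ⁻¹ • M.1, by simpa using M.2.smul γ⁻¹⟩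
      invFun := fun M => ⟨γ • M.1, M.2.smul γ⟩
      left_inv := fun M => Subtype.ext (smul_inv_smul γ M.1)
      right_inv := fun M => Subtype.ext (inv_smul_smul γ M.1) }

variable (hR : IsMaxOrder R) (hJ : LocPrin R J)

omit h in
theorem pr_mul_eq_smul (x : ℍ[F, c₁, c₂]ˣ) (L : QLat c₁ c₂) :
    (pr x).1 * L = ((x, 1) : ℍ[F, c₁, c₂]ˣ × FracUnits F) • L := by
  rw [smul_lat_def, theta_val, Units.val_one, map_one, mul_one]

include hR hJ in
theorem odd_card_edges (hD : Anisotropic c₁ c₂) :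
    Odd (Nat.card {M : QLat c₁ c₂ // IsEdge u R J M}) := by
  obtain ⟨x, hx⟩ := hJ.2 2 Nat.prime_two
  have hxR : (pr x).1 * R * R ≤ (pr x).1 * R := by rw [mul_assoc, hR.mul_self]
  have := odd_card_edges_self h hR hD
  rwa [card_edges_congr h hx (hJ.mul_mem hR.mul_self) hxR, pr_mul_eq_smul, card_edges_smul]

namespace IsEdge

variable (hM : IsEdge u R J M)

include hM hR hJ

theorem exists_loc_eq (hD : Anisotropic c₁ c₂) : ∃ y : ℍ[F, c₁, c₂]ˣ,
    loc (primeTo 2) M = loc (primeTo 2) ((pr y).1 * J) := by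
  obtain ⟨x, hx⟩ := hJ.2 2 Nat.prime_two
  rw [Nat.cast_ofNat] at hx
  have hx' : loc (primeTo 2) ((pr x⁻¹).1 * J) = loc (primeTo 2) R := by
    rw [loc_mul_congr rfl hx, ← mul_assoc, ← Units.val_mul, ← map_mul, inv_mul_cancel, map_one,
      Units.val_one, one_mul]
  have hM' := hM.smul (x⁻¹, 1)
  rw [← pr_mul_eq_smul, ← pr_mul_eq_smul] at hM'
  obtain ⟨y, -, -, hy⟩ := (hM'.transfer h hx' hR.mul_self.le).exists_gen h hR hD
  rw [hM'.loc_inf_loc hx'] at hy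
  refine ⟨x * y * x⁻¹, ?_⟩
  have h1 := loc_mul_congr (rfl : loc (primeTo 2) (pr x).1 = _)
    (hy.trans (loc_mul_congr rfl hx'.symm))
  rw [← mul_assoc, ← Units.val_mul, ← map_mul, mul_inv_cancel, map_one, Units.val_one,
    one_mul] at h1
  rw [h1, map_mul, map_mul, Units.val_mul, Units.val_mul, mul_assoc, mul_assoc]

omit hR hJ in
theorem loc_powers_eq : loc (Submonoid.powers 2) M = loc (Submonoid.powers 2) J :=
  loc_eq_iff.2 ⟨hM.lt_right.le.trans (le_loc J),
    fun _ hx => ⟨2, Submonoid.mem_powers 2, hM.two_smul_mem h hx⟩⟩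

omit h in
theorem symm : IsEdge u R M (ext u.1 * J) := by
  have := (smul_lat_lt_iff ((1, u) : ℍ[F, c₁, c₂]ˣ × FracUnits F)).2 hM.lt_right
  rw [smul_lat_def, smul_lat_def, theta_val, map_one, Units.val_one, one_mul] at this
  refine ⟨this, hM.lt_left, ?_⟩
  rw [mul_assoc]
  exact mul_le_mul' le_rfl (hJ.mul_mem hR.mul_self)

end IsEdge

end QuatAlg

end TransferEdges

section Twist

namespace LatLoc

variable {A D : Type*} [CommRing A] [Ring D] [Algebra A D]

theorem exists_eq_two_pow_mul {n : ℤ} (hn : n ≠ 0) :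
    ∃ (k : ℕ) (m : ℤ), IsCoprime m 2 ∧ n = 2 ^ k * m := by
  have h : FiniteMultiplicity 2 n := Int.finiteMultiplicity_iff.2 ⟨by decide, hn⟩
  obtain ⟨m, e, hm⟩ := h.exists_eq_pow_mul_and_not_dvd
  exact ⟨_, m, (mem_primeTo_iff Nat.prime_two).2 hm, e⟩

theorem loc_primeTo_loc_powers {L : Submodule A D} (hL : IsLat L) :
    loc (primeTo 2) (loc (Submonoid.powers 2) L) = ⊤ := by
  refine eq_top_iff.2 fun d _ => ?_
  obtain ⟨n, hn, hd⟩ := hL.full d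
  obtain ⟨k, m, hm, rfl⟩ := exists_eq_two_pow_mul hn
  exact ⟨m, hm, 2 ^ k, ⟨k, rfl⟩, by rwa [smul_smul]⟩

theorem loc_powers_loc_primeTo {L : Submodule A D} (hL : IsLat L) :
    loc (Submonoid.powers 2) (loc (primeTo 2) L) = ⊤ := by
  refine eq_top_iff.2 fun d _ => ?_
  obtain ⟨n, hn, hd⟩ := hL.full d
  obtain ⟨k, m, hm, rfl⟩ := exists_eq_two_pow_mul hn
  exact ⟨2 ^ k, ⟨k, rfl⟩, m, hm, by rwa [smul_smul, mul_comm]⟩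

/-- The lattice which agrees with `X` at `2` and with `I` away from `2`. -/
def glue (X I : Submodule A D) : Submodule A D :=
  loc (primeTo 2) X ⊓ loc (Submonoid.powers 2) I

variable {X I : Submodule A D}

theorem loc_primeTo_glue (hI : IsLat I) : loc (primeTo 2) (glue X I) = loc (primeTo 2) X := by
  rw [glue, loc_inf, loc_loc, loc_primeTo_loc_powers hI, inf_top_eq]

theorem loc_powers_glue (hX : IsLat X) :
    loc (Submonoid.powers 2) (glue X I) = loc (Submonoid.powers 2) I := by
  rw [glue, loc_inf, loc_loc, loc_powers_loc_primeTo hX, top_inf_eq]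

theorem eq_of_loc_eq {L L' : Submodule A D} (h1 : loc (primeTo 2) L = loc (primeTo 2) L')
    (h2 : loc (Submonoid.powers 2) L = loc (Submonoid.powers 2) L') : L = L' := by
  rw [← loc_primeTo_inf_loc_powers 2 L, h1, h2, loc_primeTo_inf_loc_powers]

theorem isLat_glue [IsNoetherianRing A] [IsAddTorsionFree D] (hX : IsLat X) (hI : IsLat I) :
    IsLat (glue X I) := by
  obtain ⟨n, hn, hnX⟩ := hI.exists_smul_mem hX.fg
  refine ⟨?_, fun d => ?_⟩
  · refine Submodule.fg_of_fg_map_injective (DistribSMul.toLinearMap A D n)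
      (zsmul_right_injective hn) (hI.fg.of_le ?_)
    rintro _ ⟨x, ⟨⟨m, hm, hmx⟩, _, ⟨k, rfl⟩, hkx⟩, rfl⟩
    refine mem_of_isCoprime (IsCoprime.pow_right (n := k) hm) ?_ ?_
    · change m • n • x ∈ I
      rw [smul_comm]
      exact hnX _ hmx
    · change 2 ^ k • n • x ∈ I
      rw [smul_comm]
      exact zsmul_mem hkx n
  · obtain ⟨a, ha, had⟩ := hX.full d
    obtain ⟨b, hb, hbd⟩ := hI.full d
    refine ⟨a * b, mul_ne_zero ha hb, le_loc X ?_, le_loc I ?_⟩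
    · rw [mul_comm, mul_smul]
      exact zsmul_mem had b
    · rw [mul_smul]
      exact zsmul_mem hbd a

end LatLoc

open LatLoc

namespace QuatAlg

instance : IsAddTorsionFree ℍ[F, c₁, c₂] := by
  have : Module ℚ ℍ[F, c₁, c₂] := inferInstance
  exact IsAddTorsionFree.of_module_rat _

variable {B R J J' I : QLat c₁ c₂}

theorem LocPrin.glue (hI : LocPrin B I) (x : ℍ[F, c₁, c₂]ˣ) :
    LocPrin B (glue ((pr x).1 * I) I) := by
  have hX : IsLat ((pr x).1 * I) := hI.1.unit_mul _
  refine ⟨isLat_glue hX hI.1, fun p hp => ?_⟩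
  obtain ⟨y, hy⟩ := hI.2 p hp
  rcases eq_or_ne p 2 with rfl | hp2
  · refine ⟨x * y, (loc_primeTo_glue hI.1).trans ?_⟩
    rw [map_mul, Units.val_mul, mul_assoc]
    exact loc_mul_congr rfl hy
  · refine ⟨y, hy ▸ loc_primeTo_congr_of_powers ?_ (loc_powers_glue hX)⟩
    exact_mod_cast (Nat.coprime_primes Nat.prime_two hp).2 hp2.symm

theorem pr_inv_mul_mul (x : ℍ[F, c₁, c₂]ˣ) (L : QLat c₁ c₂) :
    (pr x⁻¹).1 * ((pr x).1 * L) = L := by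
  rw [map_inv, Units.inv_mul_cancel_left]

theorem LocPrin.glue_inv (hI : LocPrin B I) (x : ℍ[F, c₁, c₂]ˣ) :
    LatLoc.glue ((pr x⁻¹).1 * LatLoc.glue ((pr x).1 * I) I) (LatLoc.glue ((pr x).1 * I) I) = I := by
  refine eq_of_loc_eq ?_ ?_
  · rw [loc_primeTo_glue (hI.glue x).1, loc_mul_congr rfl (loc_primeTo_glue hI.1), pr_inv_mul_mul]
  · rw [loc_powers_glue ((hI.glue x).1.unit_mul _), loc_powers_glue (hI.1.unit_mul _)]

theorem LocPrin.glue_mul (hI : LocPrin B I) (hIR : I * R = J) {x : ℍ[F, c₁, c₂]ˣ}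
    (h2 : loc (primeTo 2) J' = loc (primeTo 2) ((pr x).1 * J))
    (hp : loc (Submonoid.powers 2) J' = loc (Submonoid.powers 2) J) :
    LatLoc.glue ((pr x).1 * I) I * R = J' := by
  refine eq_of_loc_eq ?_ ?_
  · rw [h2, loc_mul_congr (loc_primeTo_glue hI.1) rfl, mul_assoc, hIR]
  · rw [hp, loc_mul_congr (loc_powers_glue (hI.1.unit_mul _)) rfl, hIR]

/-- The locally principal lattices generating `J` over `R`. -/
abbrev Below (B R J : QLat c₁ c₂) : Type _ := {I : QLat c₁ c₂ // LocPrin B I ∧ I * R = J}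

theorem loc_pr_inv_mul {x : ℍ[F, c₁, c₂]ˣ}
    (h2 : loc (primeTo 2) J' = loc (primeTo 2) ((pr x).1 * J)) :
    loc (primeTo 2) J = loc (primeTo 2) ((pr x⁻¹).1 * J') := by
  rw [loc_mul_congr rfl h2, pr_inv_mul_mul]

/-- Lattices which are locally equal away from `2` and locally similar at `2` have equally many
lattices below them. -/
def belowEquiv (x : ℍ[F, c₁, c₂]ˣ)
    (h2 : loc (primeTo 2) J' = loc (primeTo 2) ((pr x).1 * J))
    (hp : loc (Submonoid.powers 2) J' = loc (Submonoid.powers 2) J) :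
    Below B R J ≃ Below B R J' where
  toFun I := ⟨_, I.2.1.glue x, I.2.1.glue_mul I.2.2 h2 hp⟩
  invFun I := ⟨_, I.2.1.glue x⁻¹, I.2.1.glue_mul I.2.2 (loc_pr_inv_mul h2) hp.symm⟩
  left_inv I := Subtype.ext (I.2.1.glue_inv x)
  right_inv I := Subtype.ext (by simpa only [inv_inv] using I.2.1.glue_inv x⁻¹)

theorem finite_submodule_between {L L' : QLat c₁ c₂} (hfg : L'.FG) {n : ℤ} (hn : n ≠ 0)
    (hL : ∀ x ∈ L', n • x ∈ L) : {I : QLat c₁ c₂ | L ≤ I ∧ I ≤ L'}.Finite := by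
  let K : Submodule ↥(RI F) ↥L' := L.comap L'.subtype
  have : Finite (↥L' ⧸ K) := by
    have : Module.Finite ↥(RI F) ↥L' := Module.Finite.iff_fg.2 hfg
    have : Module.Finite ℤ (↥L' ⧸ K) := Module.Finite.trans ↥(RI F) _
    refine Module.finite_of_fg_torsion _ fun v => ⟨⟨n, mem_nonZeroDivisors_of_ne_zero hn⟩, ?_⟩
    obtain ⟨x, rfl⟩ := Submodule.Quotient.mk_surjective _ v
    change n • (Submodule.Quotient.mk x : ↥L' ⧸ K) = _
    rw [← Submodule.Quotient.mk_smul, Submodule.Quotient.mk_eq_zero]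
    exact hL x x.2
  have : Finite (Submodule ↥(RI F) (↥L' ⧸ K)) := Finite.of_injective _ SetLike.coe_injective
  refine Set.Finite.of_injOn (f := fun I => (I.comap L'.subtype).map K.mkQ)
    (Set.mapsTo_univ _ _) ?_ Set.finite_univ
  rintro I ⟨h1, h2⟩ I' ⟨h1', h2'⟩ he
  have h3 := congrArg (Submodule.comap K.mkQ) he
  simp only [Submodule.comap_map_mkQ] at h3
  rw [sup_eq_right.2 (Submodule.comap_mono h1), sup_eq_right.2 (Submodule.comap_mono h1')] at h3
  have h4 := congrArg (Submodule.map L'.subtype) h3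
  rwa [Submodule.map_comap_subtype, Submodule.map_comap_subtype, inf_eq_right.2 h2,
    inf_eq_right.2 h2'] at h4

theorem finite_below (hB : IsLat B) (hBB : B * B = B) (hR : IsMaxOrder R) (hJ : J.FG) :
    Finite (Below B R J) := by
  obtain ⟨n, hn, hnB⟩ := hB.exists_smul_mem hR.isLat.fg
  refine (Set.Finite.subset (finite_submodule_between
    (L := J.map (DistribSMul.toLinearMap ↥(RI F) ℍ[F, c₁, c₂] n)) hJ hn
    fun x hx => ⟨x, hx, rfl⟩) ?_).to_subtype
  rintro I ⟨hI, rfl⟩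
  refine ⟨?_, fun x hx => ?_⟩
  · rw [Submodule.map_le_iff_le_comap, Submodule.mul_le]
    intro x hx y hy
    change n • (x * y) ∈ I
    rw [← mul_smul_comm]
    exact hI.mul_mem hBB (Submodule.mul_mem_mul hx (hnB y hy))
  · have := Submodule.mul_mem_mul hx hR.one_mem
    rwa [mul_one] at this

end QuatAlg

end Twist

section ClassNumber

open LatLoc

namespace QuatAlg

theorem le_one_of_ext_mul_le {L : QLat c₁ c₂} (hL : IsLat L) {a : Submodule ↥(RI F) F}
    (h : ext a * L ≤ L) : a ≤ 1 := fun f hf =>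
  mem_one_iff.2 (mem_of_algebraMap_mul_mem hL (ext_mul_le_iff.1 h f hf))

variable {P : Ideal ↥(RI F)} {u : FracUnits F} (h : IsDyadic P u) {B R J J' : QLat c₁ c₂}

include h in
theorem IsEdge.smul_ne (hD : Anisotropic c₁ c₂) (hJ : IsLat J) (hM : IsEdge u R J J')
    {γ : ℍ[F, c₁, c₂]ˣ × FracUnits F} (hγ : projHom γ = 1) : γ • J ≠ J' := by
  intro he
  obtain ⟨-, -, v, -, hc⟩ := exists_theta_eq_extU hD hγ
  generalize v * γ.2 = c at hc
  rw [smul_lat_def, hc, extU_val] at he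
  have h1 : c.1 ≤ 1 := le_one_of_ext_mul_le hJ (he.le.trans hM.lt_right.le)
  have h2 : u.1 ≤ c.1 := by
    have h3 := hM.lt_left.le
    rw [← he, ← extU_val, ← extU_val, ← unit_mul_le_iff (extU c)⁻¹, Units.inv_mul_cancel_left,
      ← mul_assoc, ← map_inv, extU_val, extU_val, ← map_mul] at h3
    rw [← unit_mul_le_iff c⁻¹, Units.inv_mul]
    exact le_one_of_ext_mul_le hJ h3
  rcases h.eq_or_eq h2 h1 with h3 | h3
  · rw [h3] at he
    exact hM.lt_left.ne he
  · rw [h3, map_one, one_mul] at he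
    exact hM.lt_right.ne he.symm

/-- Pairs of a lattice and an edge of its saturation. -/
def markedSet (u : FracUnits F) (B R : QLat c₁ c₂) :
    SubMulAction (ℍ[F, c₁, c₂]ˣ × FracUnits F) (QLat c₁ c₂ × QLat c₁ c₂) where
  carrier := {e | LocPrin B e.1 ∧ IsEdge u R (e.1 * R) e.2}
  smul_mem' := fun γ e he => ⟨he.1.smul γ, by
    have := he.2.smul γ
    rwa [← smul_lat_mul] at this⟩

/-- The edges of the saturations of the locally principal lattices. -/
def edgeSet (u : FracUnits F) (B R : QLat c₁ c₂) :
    SubMulAction (ℍ[F, c₁, c₂]ˣ × FracUnits F) (QLat c₁ c₂ × QLat c₁ c₂) where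
  carrier := {e | Nonempty (Below B R e.1) ∧ IsEdge u R e.1 e.2}
  smul_mem' := fun γ e he => ⟨he.1.map fun I => ⟨γ • I.1, I.2.1.smul γ, by
    rw [smul_lat_mul, I.2.2]; rfl⟩, he.2.smul γ⟩

variable (hR : IsMaxOrder R) (hBR : B * R = R)

include hBR hR in
theorem locPrin_of_below (I : Below B R J) : LocPrin R J :=
  I.2.2 ▸ I.2.1.mul_right hBR hR.isLat

include h hR hBR in
theorem nonempty_equiv_below (hD : Anisotropic c₁ c₂) (hI : Nonempty (Below B R J))
    (hM : IsEdge u R J J') : Nonempty (Below B R J ≃ Below B R J') := by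
  have hJ := hI.elim fun I => locPrin_of_below hR hBR I
  obtain ⟨x, hx⟩ := hM.exists_loc_eq h hR hJ hD
  exact ⟨belowEquiv x hx (hM.loc_powers_eq h)⟩

/-- Reversal of edges. -/
def reverseEdge (hD : Anisotropic c₁ c₂) (e : edgeSet u B R) : edgeSet u B R :=
  ⟨(e.1.2, ext u.1 * e.1.1), by
    obtain ⟨f⟩ := nonempty_equiv_below h hR hBR hD e.2.1 e.2.2
    exact e.2.1.map f, e.2.2.symm hR (e.2.1.elim fun I => locPrin_of_below hR hBR I)⟩

/-- The edge underlying a marked edge. -/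
def toEdge (e : markedSet u B R) : edgeSet u B R :=
  ⟨(e.1.1 * R, e.1.2), ⟨⟨e.1.1, e.2.1, rfl⟩⟩, e.2.2⟩

/-- The fibres of `toEdge` are the sets of lattices below the initial vertex. -/
def toEdgeFiberEquiv (b : edgeSet u B R) :
    {e : markedSet u B R // toEdge e = b} ≃ Below B R b.1.1 where
  toFun e := ⟨e.1.1.1, e.1.2.1, congrArg (fun b => b.1.1) e.2⟩
  invFun I := ⟨⟨(I.1, b.1.2), I.2.1, by
    change IsEdge u R (I.1 * R) b.1.2
    rw [I.2.2]
    exact b.2.2⟩, Subtype.ext (Prod.ext I.2.2 rfl)⟩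
  left_inv e := Subtype.ext (Subtype.ext (Prod.ext rfl (congrArg (fun b => b.1.2) e.2).symm))
  right_inv I := rfl

/-- The marked edges over a lattice are the edges of its saturation. -/
def markedFiberEquiv (w : locPrinSet B) :
    {e : markedSet u B R // (⟨e.1.1, e.2.1⟩ : locPrinSet B) = w} ≃
      {M // IsEdge u R (w.1 * R) M} where
  toFun e := ⟨e.1.1.2, by
    have h1 := congrArg Subtype.val e.2
    change e.1.1.1 = w.1 at h1
    rw [← h1]
    exact e.1.2.2⟩
  invFun M := ⟨⟨(w.1, M.1), w.2, M.2⟩, rfl⟩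
  left_inv e := Subtype.ext (Subtype.ext (Prod.ext (congrArg Subtype.val e.2).symm rfl))
  right_inv M := rfl

theorem card_picard_dvd (hF : TotReal F) (hdef : TotallyDefinite c₁ c₂) (hB : IsLat B)
    (h1 : (1 : ℍ[F, c₁, c₂]) ∈ B) (hBB : B * B = B) :
    Nat.card (Picard (RI F)) ∣ 2 * Nat.card (MulAction.orbitRel.Quotient
      (picHom : ℍ[F, c₁, c₂]ˣ × FracUnits F →* Picard (RI F)).ker (locPrinSet B)) := by
  have hD := anisotropic hF hdef
  obtain ⟨R, hBR, hR⟩ := exists_isMaxOrder hD hB h1 hBB.le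
  obtain ⟨P, u, h⟩ := exists_isDyadic F
  have hBR : B * R = R := by
    refine le_antisymm ((mul_le_mul' hBR le_rfl).trans hR.mul_self.le) fun x hx => ?_
    have := Submodule.mul_mem_mul h1 hx
    rwa [one_mul] at this
  have hlat : ∀ b : edgeSet u B R, IsLat b.1.1 := fun b =>
    b.2.1.elim fun I => (locPrin_of_below hR hBR I).1
  have hfix : ∀ {L : QLat c₁ c₂}, IsLat L → ∀ k : ℍ[F, c₁, c₂]ˣ × FracUnits F, projHom k = 1 →
      k • L = L → ∀ e : markedSet u B R, k • e = e := by
    intro L hL k hk hkL e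
    have h2 := (eq_one_of_projHom_eq_one hD hL hk hkL).1
    have h3 : ∀ L : QLat c₁ c₂, k • L = L := fun L => by
      rw [smul_lat_def, h2, Units.val_one, one_mul]
    exact Subtype.ext (Prod.ext (h3 _) (h3 _))
  refine card_dvd_two_mul_card_orbits projHom picHom (twoSubgroupsDihedral hD) picHom_surjective
    (W := locPrinSet B) (E := markedSet u B R) (E' := edgeSet u B R)
    (fun w => (quadraticOn_stabilizer hD hF hdef w.2.1).mono fun k hk => congrArg Subtype.val hk)
    (fun b => (quadraticOn_stabilizer hD hF hdef (hlat b)).mono fun k hk =>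
      congrArg (fun b : edgeSet u B R => b.1.1) hk)
    (fun k hk w hw => hfix w.2.1 k hk (congrArg Subtype.val hw))
    (fun k hk b hb => hfix (hlat b) k hk (congrArg (fun b : edgeSet u B R => b.1.1) hb))
    (fun e => ⟨e.1.1, e.2.1⟩) (fun _ _ => rfl) (fun w => ?_)
    toEdge (fun g e => Subtype.ext (Prod.ext (smul_lat_mul g _ _) rfl)) (fun b => ?_) (fun b => ?_)
    (reverseEdge h hR hBR hD) (fun g b => Subtype.ext (Prod.ext rfl (ext_mul_smul _ g _))) (1, u)
    rfl (fun b => ?_) (fun k hk b hb => ?_) (fun b => ?_)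
  · rw [Nat.card_congr (markedFiberEquiv w)]
    exact odd_card_edges h hR (w.2.mul_right hBR hR.isLat) hD
  · exact b.2.1.elim fun I => ⟨_, ((toEdgeFiberEquiv b).symm I).2⟩
  · have := finite_below hB hBB hR (hlat b).fg
    exact Finite.of_equiv _ (toEdgeFiberEquiv b).symm
  · have h2 : ∀ L : QLat c₁ c₂, ext u.1 * L = ((1, u) : ℍ[F, c₁, c₂]ˣ × FracUnits F) • L :=
      fun L => by rw [smul_lat_def, theta_val, map_one, Units.val_one, one_mul]
    exact Subtype.ext (Prod.ext (h2 _) (h2 _))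
  · exact b.2.2.smul_ne h hD (hlat b) hk (congrArg (fun b : edgeSet u B R => b.1.1) hb)
  · rw [Nat.card_congr (toEdgeFiberEquiv _), Nat.card_congr (toEdgeFiberEquiv _)]
    obtain ⟨f⟩ := nonempty_equiv_below h hR hBR hD b.2.1 b.2.2
    exact (Nat.card_congr f).symm

end QuatAlg

end ClassNumber

theorem class_number_dvd_two_mul
    {F : Type*} [Field F] [NumberField F] {c₁ c₂ : F}
    (hF : TotReal F) (hdef : TotallyDefinite c₁ c₂)
    (O : Subalgebra ℤ ℍ[F, c₁, c₂]) (hO : IsProperOrder (integralClosure ℤ F) O) :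
    hPic (integralClosure ℤ F) ∣ 2 * hCl O := by
  have hA : ∀ f ∈ RI F, algebraMap F ℍ[F, c₁, c₂] f ∈ O := fun f hf => (hO.2 f).2 hf
  rw [QuatAlg.hCl_eq O hA]
  exact QuatAlg.card_picard_dvd hF hdef ((QuatAlg.isLat_iff _).2 hO.1) O.one_mem
    (QuatAlg.orderLat_mul_self O hA)

end
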